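/- arXiv:2004.01284 — 2 statements merged into one kernel-verified Lean document; each statement's English description precedes it below -/
import Mathlib

section
/- (One-dimensional characterization of the Dirichlet positivity set: A_D = (q_D, 1).) Let L > 0 and let a : [0,L] → ℝ be continuous and change sign, and assume the open set {x ∈ (0,L) : a(x) > 0} has finitely many connected components. Then there exists q_D ∈ [0,1) such that for every q ∈ (0,1) the following equivalence holds: every nontrivial solution of the Dirichlet problem (P_D) with weight a and exponent q is strongly positive if and only if q_D < q. -/
open Real Set

/-- `u` (with first and second derivatives `u'`, `u''`) is a solution of the
one-dimensional Dirichlet problem `(P_D)` on `[0, L]` with weight `a` and exponent `q`: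
`u` is twice continuously differentiable on `[0, L]`, nonnegative, vanishes at the
endpoints, and satisfies `-u'' = a(x) u^q` on `[0, L]`. -/
def DirichletSolution (L q : ℝ) (a u u' u'' : ℝ → ℝ) : Prop :=
  (∀ x ∈ Set.Icc (0 : ℝ) L, HasDerivWithinAt u (u' x) (Set.Icc 0 L) x) ∧
  (∀ x ∈ Set.Icc (0 : ℝ) L, HasDerivWithinAt u' (u'' x) (Set.Icc 0 L) x) ∧
  ContinuousOn u'' (Set.Icc 0 L) ∧
  (∀ x ∈ Set.Icc (0 : ℝ) L, 0 ≤ u x) ∧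
  u 0 = 0 ∧ u L = 0 ∧
  (∀ x ∈ Set.Icc (0 : ℝ) L, -u'' x = a x * u x ^ q)

/-- The weight `a` changes sign on `[0, L]`: it attains both positive and negative
values. -/
def ChangesSign (L : ℝ) (a : ℝ → ℝ) : Prop :=
  (∃ x ∈ Set.Icc (0 : ℝ) L, 0 < a x) ∧ (∃ x ∈ Set.Icc (0 : ℝ) L, a x < 0)

open Filter Topology

/-- A one-dimensional maximum principle: a function that is convex wherever it is positive and is
nonpositive at the endpoints is nonpositive. -/
theorem nonpos_of_convex_where_pos {c d : ℝ} {g g' g'' : ℝ → ℝ} (hg : ContinuousOn g (Icc c d))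
    (hg' : ∀ x ∈ Ioo c d, HasDerivAt g (g' x) x)
    (hg'' : ∀ x ∈ Ioo c d, HasDerivAt g' (g'' x) x)
    (hpos : ∀ x ∈ Ioo c d, 0 < g x → 0 ≤ g'' x) (hc : g c ≤ 0) (hd : g d ≤ 0) :
    ∀ x ∈ Icc c d, g x ≤ 0 := by
  intro x hx
  by_contra! hgx
  have hcx : c < x := lt_of_le_of_ne hx.1 (by rintro rfl; linarith)
  have hxd : x < d := lt_of_le_of_ne hx.2 (by rintro rfl; linarith)
  have hcd : 0 < d - c := by linarith
  obtain ⟨ε, hε, hεx⟩ : ∃ ε : ℝ, 0 < ε ∧ ε * (d - c) ^ 2 < g x := by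
    refine ⟨g x / (2 * (d - c) ^ 2), by positivity, ?_⟩
    have : g x / (2 * (d - c) ^ 2) * (d - c) ^ 2 = g x / 2 := by field_simp
    linarith
  set h : ℝ → ℝ := fun y => g y + ε * (y - c) ^ 2 - ε * (d - c) ^ 2 with hh
  have hhc : ContinuousOn h (Icc c d) := by
    apply ContinuousOn.sub (ContinuousOn.add hg (by fun_prop)) (by fun_prop)
  obtain ⟨m, hm, hmax⟩ := isCompact_Icc.exists_isMaxOn ⟨x, hx⟩ hhc
  have hle : ∀ y ∈ Icc c d, h y ≤ g y := by
    intro y hy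
    have h1 : (y - c) ^ 2 ≤ (d - c) ^ 2 := by
      apply pow_le_pow_left₀ <;> linarith [hy.1, hy.2]
    have := mul_le_mul_of_nonneg_left h1 hε.le
    simp only [hh]; linarith
  have hhm : 0 < h m := by
    have h1 : h x ≤ h m := hmax hx
    have h2 : 0 ≤ ε * (x - c) ^ 2 := by positivity
    have h3 : h x = g x + ε * (x - c) ^ 2 - ε * (d - c) ^ 2 := rfl
    linarith
  have hgm : 0 < g m := hhm.trans_le (hle m hm)
  have hm' : m ∈ Ioo c d :=
    ⟨lt_of_le_of_ne hm.1 (by rintro rfl; linarith), lt_of_le_of_ne hm.2 (by rintro rfl; linarith)⟩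
  have hd1 : ∀ y ∈ Ioo c d, HasDerivAt h (g' y + ε * (2 * (y - c))) y := by
    intro y hy
    have h1 : HasDerivAt (fun y => (y - c) ^ 2) (2 * (y - c)) y := by
      simpa using ((hasDerivAt_id y).sub_const c).fun_pow 2
    exact ((hg' y hy).add (h1.const_mul ε)).sub_const _
  have hd2 : HasDerivAt (fun y => g' y + ε * (2 * (y - c))) (g'' m + ε * 2) m := by
    have h1 : HasDerivAt (fun y => 2 * (y - c)) 2 m := by
      simpa using ((hasDerivAt_id m).sub_const c).const_mul 2
    exact (hg'' m hm').add (h1.const_mul ε)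
  have hnhds : Ioo c d ∈ 𝓝 m := isOpen_Ioo.mem_nhds hm'
  have hev : deriv h =ᶠ[𝓝 m] fun y => g' y + ε * (2 * (y - c)) := by
    filter_upwards [hnhds] with y hy using (hd1 y hy).deriv
  have hdd : deriv (deriv h) m = g'' m + ε * 2 := hev.deriv_eq.trans hd2.deriv
  have hddpos : 0 < deriv (deriv h) m := by
    rw [hdd]; linarith [hpos m hm' hgm]
  have hlmax : IsLocalMax h m := by
    filter_upwards [hnhds] with y hy using hmax (Ioo_subset_Icc_self hy)
  have hlmin : IsLocalMin h m :=
    isLocalMin_of_deriv_deriv_pos hddpos hlmax.deriv_eq_zero (hd1 m hm').continuousAt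
  have hconst : h =ᶠ[𝓝 m] fun _ => h m := by
    filter_upwards [hlmax, hlmin] with y h1 h2 using le_antisymm h1 h2
  have : deriv h =ᶠ[𝓝 m] fun _ => 0 := by
    filter_upwards [hconst.deriv] with y hy
    simpa using hy
  have h0 : deriv (deriv h) m = 0 := by simpa using this.deriv_eq
  linarith

/-- Taylor bounds for a function with a double zero and bounded second derivative. -/
theorem abs_le_of_double_zero {A B : ℝ} {u u' u'' : ℝ → ℝ}
    (hu : ∀ x ∈ Icc A B, HasDerivWithinAt u (u' x) (Icc A B) x)
    (hu' : ∀ x ∈ Icc A B, HasDerivWithinAt u' (u'' x) (Icc A B) x)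
    {e x K : ℝ} (he : e ∈ Icc A B) (hx : x ∈ Icc A B) (h0 : u e = 0) (h0' : u' e = 0)
    (hK : ∀ y ∈ uIcc e x, |u'' y| ≤ K) :
    ∀ y ∈ uIcc e x, |u' y| ≤ K * |y - e| ∧ |u y| ≤ K * (y - e) ^ 2 := by
  have hsub : ∀ y ∈ uIcc e x, uIcc e y ⊆ uIcc e x := fun y hy => uIcc_subset_uIcc_left hy
  have hsub' : uIcc e x ⊆ Icc A B := ordConnected_Icc.uIcc_subset he hx
  have key1 : ∀ y ∈ uIcc e x, |u' y| ≤ K * |y - e| := by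
    intro y hy
    have := Convex.norm_image_sub_le_of_norm_hasDerivWithin_le (f := u') (f' := u'')
      (s := uIcc e y) (C := K) (x := e) (y := y)
      (fun t ht => (hu' t (hsub' (hsub y hy ht))).mono ((hsub y hy).trans hsub'))
      (fun t ht => hK t (hsub y hy ht)) (convex_uIcc e y) left_mem_uIcc right_mem_uIcc
    simpa [h0'] using this
  intro y hy
  refine ⟨key1 y hy, ?_⟩
  have hK0 : 0 ≤ K := (abs_nonneg _).trans (hK e left_mem_uIcc)
  have := Convex.norm_image_sub_le_of_norm_hasDerivWithin_le (f := u) (f' := u')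
    (s := uIcc e y) (C := K * |y - e|) (x := e) (y := y)
    (fun t ht => (hu t (hsub' (hsub y hy ht))).mono ((hsub y hy).trans hsub'))
    (fun t ht => (key1 t (hsub y hy ht)).trans
      (mul_le_mul_of_nonneg_left (abs_sub_left_of_mem_uIcc ht) hK0))
    (convex_uIcc e y) left_mem_uIcc right_mem_uIcc
  rw [h0, sub_zero, Real.norm_eq_abs, Real.norm_eq_abs, mul_assoc, abs_mul_abs_self] at this
  rw [pow_two]; exact this

/-- Differentiation commutes with limits when the derivatives converge uniformly on an interval. -/
theorem hasDerivWithinAt_of_tendsto {A B : ℝ} {f g : ℕ → ℝ → ℝ} {F G : ℝ → ℝ}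
    (hf : ∀ n, ∀ x ∈ Icc A B, HasDerivWithinAt (f n) (g n x) (Icc A B) x)
    (hF : ∀ x ∈ Icc A B, Tendsto (fun n => f n x) atTop (𝓝 (F x)))
    (hg : TendstoUniformlyOn g G atTop (Icc A B)) (hG : ContinuousOn G (Icc A B)) :
    ∀ x ∈ Icc A B, HasDerivWithinAt F (G x) (Icc A B) x := by
  intro x hx
  rw [hasDerivWithinAt_iff_isLittleO, Asymptotics.isLittleO_iff]
  intro ε hε
  have h1 := Metric.continuousWithinAt_iff.1 (hG x hx) (ε / 2) (half_pos hε)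
  obtain ⟨δ, hδ, hδG⟩ := h1
  filter_upwards [inter_mem_nhdsWithin _ (Metric.ball_mem_nhds x hδ)] with y hy
  have hlim : Tendsto (fun n => ‖f n y - f n x - (y - x) • G x‖) atTop
      (𝓝 ‖F y - F x - (y - x) • G x‖) :=
    (((hF y hy.1).sub (hF x hx)).sub_const _).norm
  refine le_of_tendsto hlim ?_
  filter_upwards [Metric.tendstoUniformlyOn_iff.1 hg (ε / 2) (half_pos hε)] with n hn
  have hsub : uIcc x y ⊆ Icc A B := ordConnected_Icc.uIcc_subset hx hy.1
  have := Convex.norm_image_sub_le_of_norm_hasDerivWithin_le (f := fun t => f n t - t * G x)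
    (f' := fun t => g n t - 1 * G x) (s := uIcc x y) (C := ε) (x := x) (y := y)
    (fun t ht => ((hf n t (hsub ht)).mono hsub).sub ((hasDerivWithinAt_id t _).mul_const _))
    (fun t ht => by
      have h2 := hn t (hsub ht)
      have h3 : dist (G t) (G x) < ε / 2 := by
        apply hδG (hsub ht)
        rw [Real.dist_eq]
        have h4 : |y - x| < δ := by simpa [Real.dist_eq] using hy.2
        exact (abs_sub_left_of_mem_uIcc ht).trans_lt h4
      rw [← dist_eq_norm, one_mul]
      have := dist_triangle (g n t) (G t) (G x)
      have h5 := dist_comm (g n t) (G t)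
      linarith)
    (convex_uIcc x y) left_mem_uIcc right_mem_uIcc
  rw [show f n y - f n x - (y - x) • G x = f n y - y * G x - (f n x - x * G x) by
    simp only [smul_eq_mul]; ring]
  exact this

/-- Solvability of the Dirichlet problem `-z'' = f(x, z)` for a bounded right-hand side which is
Lipschitz in `z`, by shooting. -/
theorem exists_dirichlet_of_lipschitz {A B : ℝ} (hAB : A < B) {f : ℝ → ℝ → ℝ} {M : ℝ} {K : NNReal}
    (hfc : ∀ z, ContinuousOn (fun t => f t z) (Icc A B))
    (hfL : ∀ t ∈ Icc A B, LipschitzWith K (f t))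
    (hM : ∀ t ∈ Icc A B, ∀ z, |f t z| ≤ M) :
    ∃ z z' : ℝ → ℝ, (∀ x ∈ Icc A B, HasDerivWithinAt z (z' x) (Icc A B) x) ∧
      (∀ x ∈ Icc A B, HasDerivWithinAt z' (-f x (z x)) (Icc A B) x) ∧ z A = 0 ∧ z B = 0 := by
  have hM0 : 0 ≤ M := (abs_nonneg _).trans (hM A (left_mem_Icc.2 hAB.le) 0)
  have hl : 0 < B - A := sub_pos.2 hAB
  set S : ℝ := M * (B - A) with hS
  have hS0 : 0 ≤ S := by positivity
  set F : ℝ → ℝ × ℝ → ℝ × ℝ := fun t p => (max (-(2 * S)) (min (2 * S) p.2), -f t p.1) with hF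
  have hPL : IsPicardLindelof F (⟨A, left_mem_Icc.2 hAB.le⟩ : Icc A B) (0 : ℝ × ℝ)
      (⟨S + (2 * S + M) * (B - A), by positivity⟩ : NNReal) ⟨S, hS0⟩
      ⟨2 * S + M, by positivity⟩ (max 1 K) := by
    refine ⟨fun t ht => LipschitzWith.lipschitzOnWith ?_, fun p _ => ?_, fun t ht p _ => ?_, ?_⟩
    · refine LipschitzWith.prodMk ?_ ?_
      · exact (LipschitzWith.prod_snd.const_min _).const_max _
      · have h1 := (hfL t ht).comp (LipschitzWith.prod_fst (α := ℝ) (β := ℝ))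
        rw [mul_one] at h1
        exact h1.neg
    · exact continuousOn_const.prodMk (hfc p.1).neg
    · rw [Prod.norm_def]
      refine max_le ?_ ?_
      · change |max (-(2 * S)) (min (2 * S) p.2)| ≤ 2 * S + M
        have h1 : |max (-(2 * S)) (min (2 * S) p.2)| ≤ 2 * S :=
          abs_le.2 ⟨le_max_left _ _, max_le (by linarith) (min_le_left _ _)⟩
        linarith
      · change ‖-f t p.1‖ ≤ 2 * S + M
        rw [norm_neg, Real.norm_eq_abs]
        linarith [hM t ht p.1]
    · change (2 * S + M) * max (B - A) (A - A) ≤ (S + (2 * S + M) * (B - A)) - S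
      rw [sub_self, max_eq_left hl.le]
      linarith
  obtain ⟨φ, hφ, hφc⟩ := hPL.exists_forall_mem_closedBall_eq_hasDerivWithinAt_continuousOn
  have hball : ∀ s ∈ Icc (-S) S, ((0 : ℝ), s) ∈ Metric.closedBall (0 : ℝ × ℝ) S := by
    intro s hs
    rw [mem_closedBall_zero_iff, Prod.norm_def]
    exact max_le (by simpa using hS0) (abs_le.2 hs)
  have key : ∀ s ∈ Icc (-S) S,
      (∀ x ∈ Icc A B, HasDerivWithinAt (fun t => (φ ((0, s), t)).1) (φ ((0, s), x)).2
        (Icc A B) x) ∧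
      (∀ x ∈ Icc A B, HasDerivWithinAt (fun t => (φ ((0, s), t)).2) (-f x (φ ((0, s), x)).1)
        (Icc A B) x) ∧ φ ((0, s), A) = (0, s) ∧
      ∀ x ∈ Icc A B, |(φ ((0, s), x)).2 - s| ≤ S := by
    intro s hs
    obtain ⟨h0, hd⟩ := hφ _ (hball s hs)
    have hd1 : ∀ x ∈ Icc A B, HasDerivWithinAt (fun t => (φ ((0, s), t)).1)
        (max (-(2 * S)) (min (2 * S) (φ ((0, s), x)).2)) (Icc A B) x := fun x hx =>
      (hd x hx).fst
    have hd2 : ∀ x ∈ Icc A B, HasDerivWithinAt (fun t => (φ ((0, s), t)).2)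
        (-f x (φ ((0, s), x)).1) (Icc A B) x := fun x hx => (hd x hx).snd
    have hA : φ ((0, s), A) = (0, s) := h0
    have hb : ∀ x ∈ Icc A B, |(φ ((0, s), x)).2 - s| ≤ S := by
      intro x hx
      have := Convex.norm_image_sub_le_of_norm_hasDerivWithin_le hd2
        (fun t ht => (norm_neg (f t _)).trans_le (hM t ht _)) (convex_Icc A B)
        (left_mem_Icc.2 hAB.le) hx
      rw [hA, Real.norm_eq_abs, Real.norm_eq_abs, abs_of_nonneg (sub_nonneg.2 hx.1)] at this
      exact this.trans (mul_le_mul_of_nonneg_left (by linarith [hx.2]) hM0)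
    refine ⟨fun x hx => ?_, hd2, hA, hb⟩
    have h1 := hd1 x hx
    have h2 := abs_le.1 (hb x hx)
    rwa [min_eq_right (by linarith [hs.2]), max_eq_right (by linarith [hs.1])] at h1
  have hmono : ∀ s ∈ Icc (-S) S, |(φ ((0, s), B)).1 - s * (B - A)| ≤ S * (B - A) := by
    intro s hs
    obtain ⟨h1, -, hA, hb⟩ := key s hs
    have := Convex.norm_image_sub_le_of_norm_hasDerivWithin_le
      (f := fun t => (φ ((0, s), t)).1 - t * s)
      (fun x hx => (h1 x hx).sub ((hasDerivWithinAt_id x _).mul_const s))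
      (fun t ht => by rw [one_mul]; exact hb t ht) (convex_Icc A B)
      (left_mem_Icc.2 hAB.le) (right_mem_Icc.2 hAB.le)
    simp only [hA, Real.norm_eq_abs, abs_of_pos hl] at this
    convert this using 2
    ring
  have hcont : ContinuousOn (fun s => (φ ((0, s), B)).1) (Icc (-S) S) := by
    refine continuous_fst.comp_continuousOn (hφc.comp (by fun_prop) fun s hs => ?_)
    exact ⟨hball s hs, right_mem_Icc.2 hAB.le⟩
  have hneg : (φ ((0, -S), B)).1 ≤ 0 := by
    have := (abs_le.1 (hmono (-S) (left_mem_Icc.2 (by linarith)))).2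
    linarith
  have hpos : 0 ≤ (φ ((0, S), B)).1 := by
    have := (abs_le.1 (hmono S (right_mem_Icc.2 (by linarith)))).1
    linarith
  obtain ⟨s, hs, hsB⟩ := intermediate_value_Icc (by linarith : -S ≤ S) hcont ⟨hneg, hpos⟩
  obtain ⟨h1, h2, hA, -⟩ := key s hs
  exact ⟨_, _, h1, h2, by simp [hA], hsB⟩

/-- Compactness for the one-dimensional Dirichlet problem: a sequence with bounded second
derivatives converges in `C¹` along a subsequence. -/
theorem exists_subseq_tendstoUniformlyOn {A B : ℝ} (hAB : A < B) {z z' h : ℕ → ℝ → ℝ} {M : ℝ}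
    (hz : ∀ n, ∀ x ∈ Icc A B, HasDerivWithinAt (z n) (z' n x) (Icc A B) x)
    (hz' : ∀ n, ∀ x ∈ Icc A B, HasDerivWithinAt (z' n) (h n x) (Icc A B) x)
    (hh : ∀ n, ∀ x ∈ Icc A B, |h n x| ≤ M) (hA : ∀ n, z n A = 0) (hB : ∀ n, z n B = 0) :
    ∃ (φ : ℕ → ℕ) (y y' : ℝ → ℝ), StrictMono φ ∧
      ContinuousOn y (Icc A B) ∧ ContinuousOn y' (Icc A B) ∧
      TendstoUniformlyOn (fun n => z (φ n)) y atTop (Icc A B) ∧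
      TendstoUniformlyOn (fun n => z' (φ n)) y' atTop (Icc A B) := by
  have hl : 0 < B - A := sub_pos.2 hAB
  have hM0 : 0 ≤ M := (abs_nonneg _).trans (hh 0 A (left_mem_Icc.2 hAB.le))
  set S : ℝ := M * (B - A) with hS
  have hS0 : 0 ≤ S := by positivity
  have hz'L : ∀ n, ∀ x ∈ Icc A B, ∀ y ∈ Icc A B, |z' n y - z' n x| ≤ M * |y - x| :=
    fun n x hx y hy => Convex.norm_image_sub_le_of_norm_hasDerivWithin_le (hz' n)
      (fun t ht => hh n t ht) (convex_Icc A B) hx hy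
  have hz'b : ∀ n, ∀ x ∈ Icc A B, |z' n x| ≤ S := by
    intro n x hx
    obtain ⟨c, hc, hc0⟩ := exists_hasDerivAt_eq_zero hAB
      (fun x hx => (hz n x hx).continuousWithinAt) ((hA n).trans (hB n).symm)
      (fun x hx => (hz n x (Ioo_subset_Icc_self hx)).hasDerivAt (Icc_mem_nhds hx.1 hx.2))
    have := hz'L n c (Ioo_subset_Icc_self hc) x hx
    rw [hc0, sub_zero] at this
    refine this.trans (mul_le_mul_of_nonneg_left ?_ hM0)
    rw [abs_le]; constructor <;> linarith [hx.1, hx.2, hc.1, hc.2]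
  have hzL : ∀ n, ∀ x ∈ Icc A B, ∀ y ∈ Icc A B, |z n y - z n x| ≤ S * |y - x| :=
    fun n x hx y hy => Convex.norm_image_sub_le_of_norm_hasDerivWithin_le (hz n)
      (fun t ht => hz'b n t ht) (convex_Icc A B) hx hy
  have hzb : ∀ n, ∀ x ∈ Icc A B, |z n x| ≤ S * (B - A) := by
    intro n x hx
    have := hzL n A (left_mem_Icc.2 hAB.le) x hx
    rw [hA, sub_zero, abs_of_nonneg (sub_nonneg.2 hx.1)] at this
    exact this.trans (mul_le_mul_of_nonneg_left (by linarith [hx.2]) hS0)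
  set C : ℝ := M + S + S * (B - A) with hC
  have hC0 : 0 ≤ C := by positivity
  have hLip : ∀ n, LipschitzWith C.toNNReal (fun x : Icc A B => (z n x, z' n x)) := by
    intro n
    refine LipschitzWith.of_dist_le_mul fun x y => ?_
    rw [Real.coe_toNNReal _ hC0, Prod.dist_eq, Subtype.dist_eq]
    have := dist_nonneg (x := (x : ℝ)) (y := y)
    refine max_le ((hzL n y y.2 x x.2).trans ?_) ((hz'L n y y.2 x x.2).trans ?_) <;>
    · refine mul_le_mul_of_nonneg_right ?_ this
      have : 0 ≤ S * (B - A) := by positivity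
      linarith
  set G : ℕ → BoundedContinuousFunction (Icc A B) (ℝ × ℝ) := fun n =>
    BoundedContinuousFunction.mkOfCompact ⟨_, (hLip n).continuous⟩ with hG
  have hcpt : IsCompact (closure (range G)) := by
    refine BoundedContinuousFunction.arzela_ascoli (Metric.closedBall (0 : ℝ × ℝ) C)
      (isCompact_closedBall _ _) _ ?_ ?_
    · rintro _ x ⟨n, rfl⟩
      rw [mem_closedBall_zero_iff]
      have : 0 ≤ S * (B - A) := by positivity
      change max |z n x| |z' n x| ≤ C
      refine max_le ((hzb n x x.2).trans ?_) ((hz'b n x x.2).trans ?_) <;> linarith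
    · refine (LipschitzWith.uniformEquicontinuous _ C.toNNReal ?_).equicontinuous
      rintro ⟨_, n, rfl⟩
      exact hLip n
  obtain ⟨g, -, φ, hφ, hlim⟩ := hcpt.tendsto_subseq (fun n => subset_closure (mem_range_self n))
  rw [BoundedContinuousFunction.tendsto_iff_tendstoUniformly] at hlim
  have hproj : ∀ x (hx : x ∈ Icc A B), projIcc A B hAB.le x = ⟨x, hx⟩ :=
    fun x hx => projIcc_of_mem hAB.le hx
  have hgc : Continuous fun x => g (projIcc A B hAB.le x) := g.continuous.comp continuous_projIcc
  refine ⟨φ, fun x => (g (projIcc A B hAB.le x)).1, fun x => (g (projIcc A B hAB.le x)).2, hφ,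
    (continuous_fst.comp hgc).continuousOn, (continuous_snd.comp hgc).continuousOn, ?_, ?_⟩ <;>
  · rw [Metric.tendstoUniformlyOn_iff]
    intro ε hε
    filter_upwards [Metric.tendstoUniformly_iff.1 hlim ε hε] with n hn x hx
    have h1 := hn ⟨x, hx⟩
    rw [Prod.dist_eq, max_lt_iff] at h1
    rw [hproj x hx]
    first | exact h1.1 | exact h1.2

/-- Uniform convergence of `-(c a g ^ q)` under uniform convergence of `g` and convergence of the
parameters `c` and `q`. -/
theorem tendstoUniformlyOn_neg_mul_rpow {A B M R q c : ℝ} {a g : ℝ → ℝ} {gn : ℕ → ℝ → ℝ}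
    {qn cn : ℕ → ℝ} (haM : ∀ x ∈ Icc A B, |a x| ≤ M)
    (hgn : ∀ n, ∀ x ∈ Icc A B, gn n x ∈ Icc 0 R) (hg : ∀ x ∈ Icc A B, g x ∈ Icc 0 R)
    (hlim : TendstoUniformlyOn gn g atTop (Icc A B)) (hq : 0 < q)
    (hqn : Tendsto qn atTop (𝓝 q)) (hcn : Tendsto cn atTop (𝓝 c)) :
    TendstoUniformlyOn (fun n x => -(cn n * a x * gn n x ^ qn n)) (fun x => -(c * a x * g x ^ q))
      atTop (Icc A B) := by
  set T : Set (ℝ × ℝ × ℝ × ℝ) := Icc (c - 1) (c + 1) ×ˢ Icc (-M) M ×ˢ Icc 0 R ×ˢ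
    Icc (q / 2) (q + 1) with hT
  have hTc : IsCompact T :=
    isCompact_Icc.prod (isCompact_Icc.prod (isCompact_Icc.prod isCompact_Icc))
  have hcont : ContinuousOn (fun y : ℝ × ℝ × ℝ × ℝ => -(y.1 * y.2.1 * y.2.2.1 ^ y.2.2.2)) T := by
    refine (ContinuousOn.mul (by fun_prop) ?_).neg
    refine ContinuousOn.rpow (by fun_prop) (by fun_prop) fun y hy => Or.inr ?_
    have := hy.2.2.2.1
    linarith
  have huc := Metric.uniformContinuousOn_iff.1 (hTc.uniformContinuousOn_of_continuous hcont)
  rw [Metric.tendstoUniformlyOn_iff]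
  intro ε hε
  obtain ⟨δ, hδ, hδε⟩ := huc ε hε
  filter_upwards [Metric.tendstoUniformlyOn_iff.1 hlim δ hδ,
    Metric.tendsto_nhds.1 hqn (min δ (min (q / 2) 1)) (by positivity),
    Metric.tendsto_nhds.1 hcn (min δ 1) (by positivity)] with n hn1 hn2 hn3 x hx
  rw [lt_min_iff, lt_min_iff] at hn2
  rw [lt_min_iff] at hn3
  have h1 := hn2.2.1
  have h2 := hn2.2.2
  have h3 := hn3.2
  rw [Real.dist_eq, abs_lt] at h1 h2 h3
  refine hδε (c, a x, g x, q) ⟨⟨by linarith, by linarith⟩, abs_le.1 (haM x hx), hg x hx,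
    by linarith, by linarith⟩ (cn n, a x, gn n x, qn n) ⟨⟨by linarith, by linarith⟩,
    abs_le.1 (haM x hx), hgn n x hx, by linarith, by linarith⟩ ?_
  simp only [Prod.dist_eq, max_lt_iff, dist_self]
  exact ⟨dist_comm (cn n) c ▸ hn3.1, hδ, hn1 x hx, dist_comm (qn n) q ▸ hn2.1⟩

/-- The problem `(P_D)` has a nontrivial solution which vanishes to first order at some point. -/
def HasDegenerateSolution (L q : ℝ) (a : ℝ → ℝ) : Prop :=
  ∃ u u' u'' : ℝ → ℝ, DirichletSolution L q a u u' u'' ∧ (∃ x ∈ Icc (0 : ℝ) L, u x ≠ 0) ∧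
    ∃ z ∈ Icc (0 : ℝ) L, u z = 0 ∧ u' z = 0

namespace DirichletSolution

variable {L q : ℝ} {a u u' u'' : ℝ → ℝ}

theorem hasDerivAt (h : DirichletSolution L q a u u' u'') {x : ℝ} (hx : x ∈ Ioo 0 L) :
    HasDerivAt u (u' x) x :=
  (h.1 x (Ioo_subset_Icc_self hx)).hasDerivAt (Icc_mem_nhds hx.1 hx.2)

theorem hasDerivAt' (h : DirichletSolution L q a u u' u'') {x : ℝ} (hx : x ∈ Ioo 0 L) :
    HasDerivAt u' (u'' x) x :=
  (h.2.1 x (Ioo_subset_Icc_self hx)).hasDerivAt (Icc_mem_nhds hx.1 hx.2)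

theorem continuousOn (h : DirichletSolution L q a u u' u'') : ContinuousOn u (Icc 0 L) :=
  fun x hx => (h.1 x hx).continuousWithinAt

theorem nonneg (h : DirichletSolution L q a u u' u'') {x : ℝ} (hx : x ∈ Icc 0 L) : 0 ≤ u x :=
  h.2.2.2.1 x hx

theorem eq_neg (h : DirichletSolution L q a u u' u'') {x : ℝ} (hx : x ∈ Icc 0 L) :
    u'' x = -(a x * u x ^ q) := by
  linarith [h.2.2.2.2.2.2 x hx]

/-- Between two zeros around a point where a solution is positive, the weight is somewhere
positive. -/
theorem exists_weight_pos (h : DirichletSolution L q a u u' u'') {α β x : ℝ} (hα : 0 ≤ α)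
    (hβ : β ≤ L) (huα : u α = 0) (huβ : u β = 0) (hx : x ∈ Icc α β) (hux : 0 < u x) :
    ∃ y ∈ Ioo α β, 0 < a y ∧ 0 < u y := by
  by_contra! hcon
  have hsub : Ioo α β ⊆ Ioo 0 L := Ioo_subset_Ioo hα hβ
  have := nonpos_of_convex_where_pos (h.continuousOn.mono (Icc_subset_Icc hα hβ))
    (fun y hy => h.hasDerivAt (hsub hy)) (fun y hy => h.hasDerivAt' (hsub hy)) ?_ huα.le huβ.le x hx
  · linarith
  intro y hy hy0
  rw [h.eq_neg (Ioo_subset_Icc_self (hsub hy))]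
  have h1 : a y ≤ 0 := by
    by_contra! h2
    linarith [hcon y hy h2]
  nlinarith [Real.rpow_nonneg hy0.le q]

theorem concaveOn_add_sq (h : DirichletSolution L q a u u' u'') {s : Set ℝ} (hs : Convex ℝ s)
    (hsL : s ⊆ Icc 0 L) {k p : ℝ} (hk : ∀ x ∈ s, k ≤ a x * u x ^ q) :
    ConcaveOn ℝ s fun x => u x + k / 2 * (x - p) ^ 2 := by
  have hinterior : interior s ⊆ Ioo 0 L := by
    rw [← interior_Icc]; exact interior_mono hsL
  refine concaveOn_of_hasDerivWithinAt2_nonpos (f' := fun x => u' x + k / 2 * (2 * (x - p)))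
    (f'' := fun x => u'' x + k / 2 * 2) hs ((h.continuousOn.mono hsL).add (by fun_prop)) ?_ ?_ ?_
  · intro x hx
    have h1 : HasDerivAt (fun y => (y - p) ^ 2) (2 * (x - p)) x := by
      simpa using ((hasDerivAt_id x).sub_const p).fun_pow 2
    exact ((h.hasDerivAt (hinterior hx)).add (h1.const_mul _)).hasDerivWithinAt
  · intro x hx
    have h1 : HasDerivAt (fun y => 2 * (y - p)) 2 x := by
      simpa using ((hasDerivAt_id x).sub_const p).const_mul 2
    exact ((h.hasDerivAt' (hinterior hx)).add (h1.const_mul _)).hasDerivWithinAt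
  · intro x hx
    have h1 := hk x (interior_subset hx)
    rw [h.eq_neg (hsL (interior_subset hx))]
    linarith

theorem concaveOn (h : DirichletSolution L q a u u' u'') {s : Set ℝ} (hs : Convex ℝ s)
    (hsL : s ⊆ Icc 0 L) (hk : ∀ x ∈ s, 0 ≤ a x) : ConcaveOn ℝ s u := by
  simpa using h.concaveOn_add_sq (k := 0) (p := 0) hs hsL
    fun x hx => mul_nonneg (hk x hx) (Real.rpow_nonneg (h.nonneg (hsL hx)) q)

/-- On an interval where the weight is bounded below by `a₀ > 0`, a solution that is positive at
the center is bounded below there. -/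
theorem rpow_sub_one_le (h : DirichletSolution L q a u u' u'') (hq : 0 < q) (hq1 : q < 1)
    {p δ a₀ : ℝ} (hδ : 0 < δ) (ha₀ : 0 < a₀) (hsub : Icc (p - δ) (p + δ) ⊆ Icc 0 L)
    (ha : ∀ x ∈ Icc (p - δ) (p + δ), a₀ ≤ a x) (hup : 0 < u p) :
    u p ^ (q - 1) ≤ 16 / (a₀ * δ ^ 2) := by
  have hconc := h.concaveOn (convex_Icc (p - δ) (p + δ)) hsub fun x hx => ha₀.le.trans (ha x hx)
  have hpm : p ∈ Icc (p - δ) (p + δ) := ⟨by linarith, by linarith⟩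
  have hhalf : ∀ x ∈ Icc (p - δ / 2) (p + δ / 2), u p / 2 ≤ u x := by
    have aux : ∀ e ∈ Icc (p - δ) (p + δ), ∀ t ∈ Icc (0 : ℝ) (1 / 2),
        u p / 2 ≤ u ((1 - t) * p + t * e) := by
      intro e he t ht
      have h1 := hconc.2 hpm he (by linarith [ht.2] : 0 ≤ 1 - t) ht.1 (by ring)
      simp only [smul_eq_mul] at h1
      nlinarith [h.nonneg (hsub he), mul_nonneg ht.1 (h.nonneg (hsub he)), ht.2]
    intro x hx
    rcases le_total p x with hpx | hpx
    · have h1 := aux (p + δ) ⟨by linarith, le_rfl⟩ ((x - p) / δ)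
        ⟨div_nonneg (by linarith) hδ.le, by rw [div_le_iff₀ hδ]; linarith [hx.2]⟩
      convert h1 using 2
      field_simp; ring
    · have h1 := aux (p - δ) ⟨le_rfl, by linarith⟩ ((p - x) / δ)
        ⟨div_nonneg (by linarith) hδ.le, by rw [div_le_iff₀ hδ]; linarith [hx.1]⟩
      convert h1 using 2
      field_simp; ring
  set k : ℝ := a₀ * (u p / 2) ^ q with hk
  have hsub2 : Icc (p - δ / 2) (p + δ / 2) ⊆ Icc (p - δ) (p + δ) :=
    Icc_subset_Icc (by linarith) (by linarith)
  have hconc2 := h.concaveOn_add_sq (k := k) (p := p) (convex_Icc (p - δ / 2) (p + δ / 2))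
    (hsub2.trans hsub) fun x hx => mul_le_mul (ha x (hsub2 hx))
      (Real.rpow_le_rpow (by positivity) (hhalf x hx) hq.le) (by positivity)
      (ha₀.le.trans (ha x (hsub2 hx)))
  have hl : p - δ / 2 ∈ Icc (p - δ / 2) (p + δ / 2) := ⟨le_rfl, by linarith⟩
  have hr : p + δ / 2 ∈ Icc (p - δ / 2) (p + δ / 2) := ⟨by linarith, le_rfl⟩
  have h1 := hconc2.2 hl hr (by norm_num : (0 : ℝ) ≤ 1 / 2) (by norm_num : (0 : ℝ) ≤ 1 / 2)
    (by norm_num)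
  have h2 : (1 / 2 : ℝ) • (p - δ / 2) + (1 / 2 : ℝ) • (p + δ / 2) = p := by
    simp only [smul_eq_mul]; ring
  rw [h2] at h1
  simp only [smul_eq_mul] at h1
  have h3 : k * δ ^ 2 / 8 ≤ u p := by
    nlinarith [h.nonneg (hsub (hsub2 hl)), h.nonneg (hsub (hsub2 hr))]
  have h4 : (u p / 2) ^ q = u p ^ q / 2 ^ q := Real.div_rpow hup.le (by norm_num) q
  have h5 : (2 : ℝ) ^ q ≤ 2 := by
    simpa using Real.rpow_le_rpow_of_exponent_le (by norm_num : (1 : ℝ) ≤ 2) hq1.le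
  have h6 : u p ^ q / 2 ≤ (u p / 2) ^ q := by
    rw [h4]
    exact div_le_div_of_nonneg_left (by positivity) (by positivity) h5
  rw [Real.rpow_sub_one hup.ne', div_le_div_iff₀ hup (by positivity)]
  have h7 := mul_le_mul_of_nonneg_left h6 (by positivity : 0 ≤ a₀ * δ ^ 2)
  rw [hk] at h3
  nlinarith

/-- A solution that is positive at one point of an interval where the weight is positive is
positive throughout the interval, up to the endpoints. -/
theorem pos_of_pos (h : DirichletSolution L q a u u' u'') {x p δ : ℝ} (hδ : 0 < δ)
    (hp : Icc (p - δ) (p + δ) ⊆ {x | x ∈ Ioo (0 : ℝ) L ∧ 0 < a x})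
    (hxp : uIcc x p ⊆ {x | x ∈ Ioo (0 : ℝ) L ∧ 0 < a x}) (hux : 0 < u x) : 0 < u p := by
  have aux : ∀ e ∈ Icc (p - δ) (p + δ), e ≠ p → p ∈ uIcc x e → 0 < u p := by
    intro e he hep hpe
    have hunion : uIcc x e ⊆ {x | x ∈ Ioo (0 : ℝ) L ∧ 0 < a x} := by
      refine uIcc_subset_uIcc_union_uIcc.trans (union_subset hxp ?_)
      exact (ordConnected_Icc.uIcc_subset ⟨by linarith, by linarith⟩ he).trans hp
    have hconc := h.concaveOn (convex_uIcc x e)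
      (fun y hy => Ioo_subset_Icc_self (hunion hy).1) fun y hy => (hunion hy).2.le
    rw [← segment_eq_uIcc] at hpe
    obtain ⟨s, t, hs, ht, hst, hpst⟩ := hpe
    have h1 := hconc.2 left_mem_uIcc right_mem_uIcc hs ht hst
    rw [hpst] at h1
    simp only [smul_eq_mul] at h1 hpst
    have hs0 : 0 < s := by
      refine lt_of_le_of_ne hs ?_
      rintro rfl
      apply hep
      have : t = 1 := by linarith
      rw [this] at hpst
      linarith
    have h2 := mul_nonneg ht (h.nonneg (Ioo_subset_Icc_self (hp he).1))
    have h3 := mul_pos hs0 hux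
    linarith
  rcases le_total x p with hle | hle
  · refine aux (p + δ) ⟨by linarith, le_rfl⟩ (by linarith) ?_
    rw [uIcc_of_le (by linarith)]; exact ⟨hle, by linarith⟩
  · refine aux (p - δ) ⟨le_rfl, by linarith⟩ (by linarith) ?_
    rw [uIcc_of_ge (by linarith)]; exact ⟨by linarith, hle⟩

end DirichletSolution

/-- A lower bound for nontrivial solutions which is uniform in the exponent. -/
theorem exists_rpow_sub_one_le {L : ℝ} {a : ℝ → ℝ} (ha : ContinuousOn a (Icc 0 L))
    (hfin : Finite (ConnectedComponents {x : ℝ // x ∈ Ioo (0 : ℝ) L ∧ 0 < a x})) :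
    ∃ C : ℝ, ∀ q ∈ Ioo (0 : ℝ) 1, ∀ u u' u'' : ℝ → ℝ, DirichletSolution L q a u u' u'' →
      (∃ x ∈ Icc (0 : ℝ) L, u x ≠ 0) → ∀ m, (∀ x ∈ Icc (0 : ℝ) L, u x ≤ m) → m ^ (q - 1) ≤ C := by
  have hball : ∀ p : {x : ℝ // x ∈ Ioo (0 : ℝ) L ∧ 0 < a x}, ∃ δ : ℝ, 0 < δ ∧
      ∀ x ∈ Icc ((p : ℝ) - δ) (p + δ), x ∈ Ioo 0 L ∧ a p / 2 ≤ a x := by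
    intro p
    have hnhds : Ioo 0 L ∈ 𝓝 (p : ℝ) := isOpen_Ioo.mem_nhds p.2.1
    have hcont : ContinuousAt a p :=
      ha.continuousAt (Icc_mem_nhds p.2.1.1 p.2.1.2)
    have h1 : ∀ᶠ x in 𝓝 (p : ℝ), x ∈ Ioo 0 L ∧ a p / 2 < a x :=
      Filter.Eventually.and hnhds (hcont.eventually_const_lt (by linarith [p.2.2]))
    obtain ⟨δ, hδ, hsub⟩ := Metric.nhds_basis_closedBall.eventually_iff.1 h1
    refine ⟨δ, hδ, fun x hx => ?_⟩
    rw [← Real.closedBall_eq_Icc] at hx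
    exact ⟨(hsub hx).1, (hsub hx).2.le⟩
  choose δ hδ hδs using hball
  set rep : ConnectedComponents {x : ℝ // x ∈ Ioo (0 : ℝ) L ∧ 0 < a x} → _ := Quotient.out
  obtain ⟨C, hC⟩ := Set.finite_range (fun c => 16 / (a (rep c) / 2 * δ (rep c) ^ 2)) |>.bddAbove
  refine ⟨C, fun q hq u u' u'' h hne m hm => ?_⟩
  obtain ⟨x₀, hx₀, hux₀⟩ := hne
  obtain ⟨x, hx, hax, hux⟩ := h.exists_weight_pos le_rfl le_rfl h.2.2.2.2.1 h.2.2.2.2.2.1 hx₀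
    (lt_of_le_of_ne (h.nonneg hx₀) hux₀.symm)
  set xs : {x : ℝ // x ∈ Ioo (0 : ℝ) L ∧ 0 < a x} := ⟨x, hx, hax⟩
  set p := rep (xs : ConnectedComponents _) with hp
  have hpx : (p : ConnectedComponents {x : ℝ // x ∈ Ioo (0 : ℝ) L ∧ 0 < a x}) = xs :=
    Quotient.out_eq _
  have hcomp : IsPreconnected (Subtype.val '' connectedComponent xs) :=
    isPreconnected_connectedComponent.image _ continuous_subtype_val.continuousOn
  have hpm : p ∈ connectedComponent xs := by
    rw [← ConnectedComponents.coe_eq_coe.1 hpx]; exact mem_connectedComponent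
  have hsubx : uIcc x (p : ℝ) ⊆ {x | x ∈ Ioo (0 : ℝ) L ∧ 0 < a x} := by
    refine (hcomp.ordConnected.uIcc_subset ⟨xs, mem_connectedComponent, rfl⟩
      ⟨p, hpm, rfl⟩).trans ?_
    rintro _ ⟨y, -, rfl⟩
    exact y.2
  have hap : 0 < a p / 2 := half_pos p.2.2
  have hup : 0 < u p := h.pos_of_pos (hδ p)
    (fun y hy => ⟨(hδs p y hy).1, hap.trans_le (hδs p y hy).2⟩) hsubx hux
  have hle := h.rpow_sub_one_le hq.1 hq.2 (hδ p) hap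
    (fun y hy => Ioo_subset_Icc_self (hδs p y hy).1) (fun y hy => (hδs p y hy).2) hup
  exact (Real.rpow_le_rpow_of_nonpos hup (hm p (Ioo_subset_Icc_self p.2.1))
    (by linarith [hq.2])).trans (hle.trans (hC ⟨_, rfl⟩))

/-- Normalized degenerate solutions converge to a degenerate solution of the limit problem. -/
theorem exists_limit_of_hasDegenerateSolution {L : ℝ} (hL : 0 < L) {a : ℝ → ℝ}
    (ha : ContinuousOn a (Icc 0 L))
    (hfin : Finite (ConnectedComponents {x : ℝ // x ∈ Ioo (0 : ℝ) L ∧ 0 < a x}))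
    {qn : ℕ → ℝ} {q : ℝ} (hqn : ∀ n, qn n ∈ Ioo (0 : ℝ) 1) (hlim : Tendsto qn atTop (𝓝 q))
    (hq : 0 < q) (hdeg : ∀ n, HasDegenerateSolution L (qn n) a) :
    ∃ μ : ℝ, 0 < μ ∧ ∃ w w' : ℝ → ℝ,
      (∀ x ∈ Icc 0 L, HasDerivWithinAt w (w' x) (Icc 0 L) x) ∧
      (∀ x ∈ Icc 0 L, HasDerivWithinAt w' (-(μ * a x * w x ^ q)) (Icc 0 L) x) ∧
      (∀ x ∈ Icc 0 L, 0 ≤ w x) ∧ w 0 = 0 ∧ w L = 0 ∧ (∃ x ∈ Icc 0 L, w x ≠ 0) ∧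
      ∃ z ∈ Icc 0 L, w z = 0 ∧ w' z = 0 := by
  obtain ⟨C, hC⟩ := exists_rpow_sub_one_le ha hfin
  obtain ⟨M, hM⟩ := isCompact_Icc.exists_bound_of_continuousOn ha
  have h0L : (0 : ℝ) ∈ Icc 0 L := left_mem_Icc.2 hL.le
  have hM0 : 0 ≤ M := (norm_nonneg _).trans (hM 0 h0L)
  choose u u' u'' hu hne z hz hzu hzu' using hdeg
  have hmax : ∀ n, ∃ x ∈ Icc 0 L, ∀ y ∈ Icc 0 L, u n y ≤ u n x := fun n =>
    isCompact_Icc.exists_isMaxOn ⟨0, h0L⟩ (hu n).continuousOn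
  choose t ht hmaxt using hmax
  have hm : ∀ n, 0 < u n (t n) := by
    intro n
    obtain ⟨x, hx, hux⟩ := hne n
    exact (lt_of_le_of_ne ((hu n).nonneg hx) hux.symm).trans_le (hmaxt n x hx)
  set μ : ℕ → ℝ := fun n => u n (t n) ^ (qn n - 1) with hμ
  have hμC : ∀ n, μ n ∈ Icc 0 C := fun n =>
    ⟨Real.rpow_nonneg (hm n).le _, hC _ (hqn n) _ _ _ (hu n) (hne n) _ (hmaxt n)⟩
  have hC0 : 0 ≤ C := (hμC 0).1.trans (hμC 0).2
  obtain ⟨⟨z₀, t₀, μ₀⟩, hmem, φ, hφ, hφlim⟩ :=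
    (isCompact_Icc.prod (isCompact_Icc.prod isCompact_Icc)).tendsto_subseq
      (x := fun n => (z n, t n, μ n)) (fun n => ⟨hz n, ht n, hμC n⟩)
  set v : ℕ → ℝ → ℝ := fun n x => u n x / u n (t n) with hv
  have hv01 : ∀ n, ∀ x ∈ Icc 0 L, v n x ∈ Icc 0 1 := fun n x hx =>
    ⟨div_nonneg ((hu n).nonneg hx) (hm n).le, (div_le_one (hm n)).2 (hmaxt n x hx)⟩
  have hvd : ∀ n, ∀ x ∈ Icc 0 L, HasDerivWithinAt (v n) (u' n x / u n (t n)) (Icc 0 L) x :=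
    fun n x hx => ((hu n).1 x hx).div_const _
  have hvd' : ∀ n, ∀ x ∈ Icc 0 L, HasDerivWithinAt (fun y => u' n y / u n (t n))
      (-(μ n * a x * v n x ^ qn n)) (Icc 0 L) x := by
    intro n x hx
    have h1 := ((hu n).2.1 x hx).div_const (u n (t n))
    suffices h2 : u'' n x / u n (t n) = -(μ n * a x * v n x ^ qn n) by rwa [h2] at h1
    rw [(hu n).eq_neg hx]
    simp only [hv, hμ]
    rw [Real.div_rpow ((hu n).nonneg hx) (hm n).le, Real.rpow_sub_one (hm n).ne']
    have := (Real.rpow_pos_of_pos (hm n) (qn n)).ne'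
    have := (hm n).ne'
    field_simp
  have hbound : ∀ n, ∀ x ∈ Icc 0 L, |-(μ n * a x * v n x ^ qn n)| ≤ C * M := by
    intro n x hx
    have h1 : v n x ^ qn n ≤ 1 := Real.rpow_le_one (hv01 n x hx).1 (hv01 n x hx).2 (hqn n).1.le
    have h2 : 0 ≤ v n x ^ qn n := Real.rpow_nonneg (hv01 n x hx).1 _
    rw [abs_neg, abs_mul, abs_mul, abs_of_nonneg h2, abs_of_nonneg (hμC n).1]
    calc μ n * |a x| * v n x ^ qn n ≤ C * M * 1 :=
          mul_le_mul (mul_le_mul (hμC n).2 (hM x hx) (abs_nonneg _) hC0) h1 h2 (by positivity)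
      _ = C * M := mul_one _
  obtain ⟨ψ, w, w', hψ, hwc, hwc', hw, hw'⟩ := exists_subseq_tendstoUniformlyOn hL
    (fun n => hvd (φ n)) (fun n => hvd' (φ n)) (fun n => hbound (φ n))
    (fun n => by simp [hv, (hu (φ n)).2.2.2.2.1]) (fun n => by simp [hv, (hu (φ n)).2.2.2.2.2.1])
  have hχ : Tendsto (fun n => φ (ψ n)) atTop atTop := hφ.tendsto_atTop.comp hψ.tendsto_atTop
  have hlim3 := hφlim.comp hψ.tendsto_atTop
  have hzlim : Tendsto (fun n => z (φ (ψ n))) atTop (𝓝 z₀) :=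
    (continuous_fst.tendsto _).comp hlim3
  have htlim : Tendsto (fun n => t (φ (ψ n))) atTop (𝓝 t₀) :=
    ((continuous_fst.comp continuous_snd).tendsto _).comp hlim3
  have hμlim : Tendsto (fun n => μ (φ (ψ n))) atTop (𝓝 μ₀) :=
    ((continuous_snd.comp continuous_snd).tendsto _).comp hlim3
  have hzlim' : Tendsto (fun n => z (φ (ψ n))) atTop (𝓝[Icc 0 L] z₀) :=
    tendsto_nhdsWithin_iff.2 ⟨hzlim, Eventually.of_forall fun n => hz _⟩
  have htlim' : Tendsto (fun n => t (φ (ψ n))) atTop (𝓝[Icc 0 L] t₀) :=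
    tendsto_nhdsWithin_iff.2 ⟨htlim, Eventually.of_forall fun n => ht _⟩
  have hw01 : ∀ x ∈ Icc 0 L, w x ∈ Icc 0 1 := fun x hx =>
    isClosed_Icc.mem_of_tendsto (hw.tendsto_at hx) (Eventually.of_forall fun n => hv01 _ x hx)
  have hdw := hasDerivWithinAt_of_tendsto (fun n => hvd (φ (ψ n)))
    (fun x hx => hw.tendsto_at hx) hw' hwc'
  have hunif := tendstoUniformlyOn_neg_mul_rpow hM (fun n => hv01 (φ (ψ n))) hw01 hw hq
    (hlim.comp hχ) hμlim
  have hcont : ContinuousOn (fun x => -(μ₀ * a x * w x ^ q)) (Icc 0 L) :=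
    ((continuousOn_const.mul ha).mul (hwc.rpow_const fun x _ => Or.inr hq.le)).neg
  have hdw' := hasDerivWithinAt_of_tendsto (fun n => hvd' (φ (ψ n)))
    (fun x hx => hw'.tendsto_at hx) hunif hcont
  have hends : ∀ x ∈ Icc 0 L, (∀ n, u n x = 0) → w x = 0 := fun x hx h0 =>
    tendsto_nhds_unique (hw.tendsto_at hx) (by simp [hv, h0])
  have hw0 : w 0 = 0 := hends 0 h0L fun n => (hu n).2.2.2.2.1
  have hwL : w L = 0 := hends L (right_mem_Icc.2 hL.le) fun n => (hu n).2.2.2.2.2.1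
  have hwt : w t₀ = 1 := tendsto_nhds_unique (hw.tendsto_comp (hwc t₀ hmem.2.1) htlim')
    (by simp [hv, (hm _).ne'])
  have hμ₀ : 0 < μ₀ := by
    refine lt_of_le_of_ne hmem.2.2.1 ?_
    rintro rfl
    have h1 := nonpos_of_convex_where_pos hwc
      (fun x hx => (hdw x (Ioo_subset_Icc_self hx)).hasDerivAt (Icc_mem_nhds hx.1 hx.2))
      (fun x hx => (hdw' x (Ioo_subset_Icc_self hx)).hasDerivAt (Icc_mem_nhds hx.1 hx.2))
      (fun x _ _ => by simp) hw0.le hwL.le t₀ hmem.2.1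
    linarith
  refine ⟨μ₀, hμ₀, w, w', hdw, hdw', fun x hx => (hw01 x hx).1, hw0, hwL,
    ⟨t₀, hmem.2.1, by rw [hwt]; exact one_ne_zero⟩, z₀, hmem.1, ?_, ?_⟩
  · exact tendsto_nhds_unique (hw.tendsto_comp (hwc z₀ hmem.1) hzlim') (by simp [hv, hzu])
  · exact tendsto_nhds_unique (hw'.tendsto_comp (hwc' z₀ hmem.1) hzlim') (by simp [hzu'])

/-- A nonnegative function with a double zero whose second derivative it dominates vanishes. -/
theorem eq_zero_of_double_zero {A B M : ℝ} {w w' w'' : ℝ → ℝ}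
    (hw : ∀ x ∈ Icc A B, HasDerivWithinAt w (w' x) (Icc A B) x)
    (hw' : ∀ x ∈ Icc A B, HasDerivWithinAt w' (w'' x) (Icc A B) x)
    (hw0 : ∀ x ∈ Icc A B, 0 ≤ w x) (hM : 0 ≤ M) (hb : ∀ x ∈ Icc A B, |w'' x| ≤ M * w x)
    {z : ℝ} (hz : z ∈ Icc A B) (hwz : w z = 0) (hwz' : w' z = 0) : ∀ x ∈ Icc A B, w x = 0 := by
  obtain ⟨δ, hδ, hδM⟩ : ∃ δ : ℝ, 0 < δ ∧ M * δ ^ 2 < 1 := by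
    refine ⟨1 / (M + 1), by positivity, ?_⟩
    rw [div_pow, one_pow, mul_one_div, div_lt_one (by positivity)]
    nlinarith
  have hstep : ∀ e ∈ Icc A B, w e = 0 → w' e = 0 → ∀ x ∈ Icc A B, |x - e| ≤ δ →
      w x = 0 ∧ w' x = 0 := by
    intro e he hwe hwe' x hx hxe
    have hsub : uIcc e x ⊆ Icc A B := ordConnected_Icc.uIcc_subset he hx
    obtain ⟨y, hy, hymax⟩ := isCompact_uIcc.exists_isMaxOn ⟨e, left_mem_uIcc⟩
      fun t (ht : t ∈ uIcc e x) => ((hw t (hsub ht)).continuousWithinAt.mono hsub)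
    have hbd := abs_le_of_double_zero hw hw' he hx hwe hwe' (K := M * w y)
      fun t ht => (hb t (hsub ht)).trans (mul_le_mul_of_nonneg_left (hymax ht) hM)
    have hwy : 0 ≤ w y := hw0 y (hsub hy)
    have hye : (y - e) ^ 2 ≤ δ ^ 2 :=
      sq_le_sq' (by linarith [(abs_le.1 ((abs_sub_left_of_mem_uIcc hy).trans hxe)).1])
        (abs_le.1 ((abs_sub_left_of_mem_uIcc hy).trans hxe)).2
    have hy0 : w y = 0 := by
      have h1 := (abs_le.1 (hbd y hy).2).2
      have h2 := mul_le_mul_of_nonneg_left hye (mul_nonneg hM hwy)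
      nlinarith
    have h3 := hbd x right_mem_uIcc
    rw [hy0, mul_zero, zero_mul, zero_mul] at h3
    exact ⟨abs_eq_zero.1 (le_antisymm h3.2 (abs_nonneg _)),
      abs_eq_zero.1 (le_antisymm h3.1 (abs_nonneg _))⟩
  have hind : ∀ n : ℕ, ∀ x ∈ Icc A B, |x - z| ≤ n * δ → w x = 0 ∧ w' x = 0 := by
    intro n
    induction n with
    | zero =>
      intro x _ hxz
      have : x = z := by
        rw [Nat.cast_zero, zero_mul] at hxz
        linarith [abs_eq_zero.1 (le_antisymm hxz (abs_nonneg _))]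
      rw [this]; exact ⟨hwz, hwz'⟩
    | succ n ih =>
      intro x hx hxz
      have hn : (0 : ℝ) ≤ n := n.cast_nonneg
      have hn1 : (0 : ℝ) < n + 1 := by linarith
      set e : ℝ := z + n / (n + 1) * (x - z) with he
      have hfrac : (n : ℝ) / (n + 1) ∈ Icc (0 : ℝ) 1 :=
        ⟨by positivity, by rw [div_le_one hn1]; linarith⟩
      have heI : e ∈ Icc A B := by
        have := (convex_Icc A B).add_smul_sub_mem hz hx hfrac
        simpa using this
      push_cast at hxz
      have hez : |e - z| ≤ n * δ := by
        rw [he, add_sub_cancel_left, abs_mul, abs_of_nonneg hfrac.1, div_mul_eq_mul_div,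
          div_le_iff₀ hn1]
        nlinarith
      have hxe : |x - e| ≤ δ := by
        have h1 : x - e = 1 / (n + 1) * (x - z) := by
          rw [he]; field_simp; ring
        rw [h1, abs_mul, abs_of_nonneg (by positivity), div_mul_eq_mul_div, div_le_iff₀ hn1]
        linarith
      obtain ⟨h1, h2⟩ := ih e heI hez
      exact hstep e heI h1 h2 x hx hxe
  intro x hx
  obtain ⟨n, hn⟩ := exists_nat_ge (|x - z| / δ)
  exact (hind n x hx ((div_le_iff₀ hδ).1 hn)).1

/-- The set of exponents admitting degenerate solutions is closed in `(0, 1)` and bounded away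
from `1`. -/
theorem hasDegenerateSolution_of_tendsto {L : ℝ} (hL : 0 < L) {a : ℝ → ℝ}
    (ha : ContinuousOn a (Icc 0 L))
    (hfin : Finite (ConnectedComponents {x : ℝ // x ∈ Ioo (0 : ℝ) L ∧ 0 < a x}))
    {qn : ℕ → ℝ} {q : ℝ} (hqn : ∀ n, qn n ∈ Ioo (0 : ℝ) 1) (hlim : Tendsto qn atTop (𝓝 q))
    (hq : 0 < q) (hdeg : ∀ n, HasDegenerateSolution L (qn n) a) :
    q < 1 ∧ HasDegenerateSolution L q a := by
  obtain ⟨μ, hμ, w, w', hw, hw', hw0, h0, hL', hne, z, hz, hwz, hwz'⟩ :=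
    exists_limit_of_hasDegenerateSolution hL ha hfin hqn hlim hq hdeg
  have hq1 : q < 1 := by
    refine lt_of_le_of_ne (le_of_tendsto' hlim fun n => (hqn n).2.le) ?_
    rintro rfl
    obtain ⟨M, hM⟩ := isCompact_Icc.exists_bound_of_continuousOn ha
    have hM0 : 0 ≤ M := (norm_nonneg _).trans (hM 0 (left_mem_Icc.2 hL.le))
    obtain ⟨x, hx, hwx⟩ := hne
    refine hwx (eq_zero_of_double_zero hw hw' hw0 (mul_nonneg hμ.le hM0) (fun y hy => ?_)
      hz hwz hwz' x hx)
    rw [Real.rpow_one, abs_neg, abs_mul, abs_mul, abs_of_pos hμ, abs_of_nonneg (hw0 y hy)]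
    exact mul_le_mul_of_nonneg_right (mul_le_mul_of_nonneg_left (hM y hy) hμ.le) (hw0 y hy)
  refine ⟨hq1, ?_⟩
  have h1q : q - 1 ≠ 0 := by linarith
  set k : ℝ := μ ^ (1 / (q - 1)) with hk
  have hk0 : 0 < k := Real.rpow_pos_of_pos hμ _
  have hkμ : k ^ q = k * μ := by
    have h1 : k ^ (q - 1) = μ := by
      rw [hk, ← Real.rpow_mul hμ.le, one_div_mul_cancel h1q, Real.rpow_one]
    rw [Real.rpow_sub_one hk0.ne', div_eq_iff hk0.ne'] at h1
    rw [h1, mul_comm]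
  have hwc : ContinuousOn w (Icc 0 L) := fun x hx => (hw x hx).continuousWithinAt
  obtain ⟨x, hx, hwx⟩ := hne
  refine ⟨fun x => k * w x, fun x => k * w' x, fun x => k * -(μ * a x * w x ^ q),
    ⟨fun x hx => (hw x hx).const_mul k, fun x hx => (hw' x hx).const_mul k, ?_,
      fun x hx => mul_nonneg hk0.le (hw0 x hx), by simp [h0], by simp [hL'], fun x hx => ?_⟩,
    ⟨x, hx, mul_ne_zero hk0.ne' hwx⟩, z, hz, by simp [hwz], by simp [hwz']⟩
  · exact continuousOn_const.mul
      ((continuousOn_const.mul ha).mul (hwc.rpow_const fun x _ => Or.inr hq.le)).neg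
  · rw [Real.mul_rpow hk0.le (hw0 x hx), hkμ]
    ring

/-! ### Solutions between a sub- and a supersolution -/

theorem abs_max_min_sub_le (b c s t : ℝ) : |max b (min s c) - max b (min t c)| ≤ |s - t| := by
  refine (abs_max_sub_max_le_max _ _ _ _).trans (max_le (by simp) ?_)
  exact (abs_min_sub_min_le_max _ _ _ _).trans (max_le le_rfl (by simp))

theorem abs_add_rpow_sub_le {η p s t : ℝ} (hη : 0 < η) (hp : 0 < p) (hp1 : p < 1) (hs : 0 ≤ s)
    (ht : 0 ≤ t) : |(s + η) ^ p - (t + η) ^ p| ≤ p * η ^ (p - 1) * |s - t| := by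
  refine (convex_Ici (0 : ℝ)).norm_image_sub_le_of_norm_hasDerivWithin_le
    (f := fun s => (s + η) ^ p) (f' := fun s => 1 * p * (s + η) ^ (p - 1)) (fun x hx => ?_)
    (fun x hx => ?_) ht hs
  · have hx0 : 0 < x + η := add_pos_of_nonneg_of_pos hx hη
    exact (((hasDerivAt_id x).add_const η).rpow_const (Or.inl hx0.ne')).hasDerivWithinAt
  · have hx : 0 ≤ x := hx
    rw [one_mul, Real.norm_eq_abs, abs_mul, abs_of_pos hp,
      abs_of_nonneg (Real.rpow_nonneg (by linarith) _)]
    exact mul_le_mul_of_nonneg_left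
      (Real.rpow_le_rpow_of_nonpos hη (by linarith) (by linarith)) hp.le

theorem exists_truncated_solution {A B p : ℝ} (hAB : A < B) {a φ v : ℝ → ℝ}
    (ha : ContinuousOn a (Icc A B)) (hφ : ContinuousOn φ (Icc A B)) (hv : ContinuousOn v (Icc A B))
    (hφ0 : ∀ x ∈ Icc A B, 0 ≤ φ x) (hφv : ∀ x ∈ Icc A B, φ x ≤ v x) (hp : 0 < p) (hp1 : p < 1) :
    ∃ z z' : ℝ → ℝ, (∀ x ∈ Icc A B, HasDerivWithinAt z (z' x) (Icc A B) x) ∧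
      (∀ x ∈ Icc A B,
        HasDerivWithinAt z' (-(a x * max (φ x) (min (z x) (v x)) ^ p)) (Icc A B) x) ∧
      z A = 0 ∧ z B = 0 := by
  obtain ⟨M, hM⟩ := isCompact_Icc.exists_bound_of_continuousOn ha
  obtain ⟨R, hR⟩ := isCompact_Icc.exists_bound_of_continuousOn hv
  have hA : A ∈ Icc A B := left_mem_Icc.2 hAB.le
  have hB : B ∈ Icc A B := right_mem_Icc.2 hAB.le
  have hM0 : 0 ≤ M := (norm_nonneg _).trans (hM A hA)
  have hT : ∀ x ∈ Icc A B, ∀ t, max (φ x) (min t (v x)) ∈ Icc 0 R := fun x hx t =>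
    ⟨(hφ0 x hx).trans (le_max_left _ _), max_le ((hφv x hx).trans ((le_abs_self _).trans (hR x hx)))
      ((min_le_right _ _).trans ((le_abs_self _).trans (hR x hx)))⟩
  have hR0 : 0 ≤ R := (hT A hA 0).1.trans (hT A hA 0).2
  have hη : ∀ n : ℕ, (0 : ℝ) < 1 / ((n : ℝ) + 1) := fun n => by positivity
  have hη1 : ∀ n : ℕ, 1 / ((n : ℝ) + 1) ≤ 1 := fun n => by
    rw [div_le_one (by positivity)]; linarith [n.cast_nonneg (α := ℝ)]
  have hTn : ∀ n : ℕ, ∀ x ∈ Icc A B, ∀ t,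
      max (φ x) (min t (v x)) + 1 / ((n : ℝ) + 1) ∈ Icc 0 (R + 1) := fun n x hx t =>
    ⟨add_nonneg (hT x hx t).1 (hη n).le, add_le_add (hT x hx t).2 (hη1 n)⟩
  have hbd : ∀ n : ℕ, ∀ x ∈ Icc A B, ∀ t,
      |a x * (max (φ x) (min t (v x)) + 1 / ((n : ℝ) + 1)) ^ p| ≤ M * (R + 1) ^ p := by
    intro n x hx t
    rw [abs_mul, abs_of_nonneg (Real.rpow_nonneg (hTn n x hx t).1 _)]
    exact mul_le_mul (hM x hx) (Real.rpow_le_rpow (hTn n x hx t).1 (hTn n x hx t).2 hp.le)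
      (Real.rpow_nonneg (hTn n x hx t).1 _) hM0
  have hsol : ∀ n : ℕ, ∃ z z' : ℝ → ℝ, (∀ x ∈ Icc A B, HasDerivWithinAt z (z' x) (Icc A B) x) ∧
      (∀ x ∈ Icc A B, HasDerivWithinAt z'
        (-(a x * (max (φ x) (min (z x) (v x)) + 1 / ((n : ℝ) + 1)) ^ p)) (Icc A B) x) ∧
      z A = 0 ∧ z B = 0 := by
    intro n
    have hk : 0 ≤ p * (1 / ((n : ℝ) + 1)) ^ (p - 1) :=
      mul_nonneg hp.le (Real.rpow_nonneg (hη n).le _)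
    refine exists_dirichlet_of_lipschitz hAB
      (f := fun x t => a x * (max (φ x) (min t (v x)) + 1 / ((n : ℝ) + 1)) ^ p)
      (K := (M * (p * (1 / ((n : ℝ) + 1)) ^ (p - 1))).toNNReal) (fun t => ?_) (fun x hx => ?_)
      (hbd n)
    · exact ha.mul (((hφ.sup (continuousOn_const.inf hv)).add continuousOn_const).rpow_const
        fun x _ => Or.inr hp.le)
    · refine LipschitzWith.of_dist_le_mul fun s t => ?_
      rw [Real.dist_eq, Real.dist_eq, Real.coe_toNNReal _ (mul_nonneg hM0 hk), ← mul_sub, abs_mul,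
        mul_assoc]
      refine mul_le_mul (hM x hx) ?_ (abs_nonneg _) hM0
      exact (abs_add_rpow_sub_le (hη n) hp hp1 (hT x hx s).1 (hT x hx t).1).trans
        (mul_le_mul_of_nonneg_left (abs_max_min_sub_le _ _ _ _) hk)
  choose z z' hz hz' hzA hzB using hsol
  obtain ⟨ψ, y, y', hψ, hy, hy', hlim, hlim'⟩ := exists_subseq_tendstoUniformlyOn hAB hz hz'
    (fun n x hx => (abs_neg _).trans_le (hbd n x hx (z n x))) hzA hzB
  have hη0 : Tendsto (fun n => 1 / ((ψ n : ℝ) + 1)) atTop (𝓝 0) :=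
    tendsto_one_div_add_atTop_nhds_zero_nat.comp hψ.tendsto_atTop
  have hunif : TendstoUniformlyOn
      (fun n x => max (φ x) (min (z (ψ n) x) (v x)) + 1 / ((ψ n : ℝ) + 1))
      (fun x => max (φ x) (min (y x) (v x))) atTop (Icc A B) := by
    rw [Metric.tendstoUniformlyOn_iff] at hlim ⊢
    intro ε hε
    filter_upwards [hlim (ε / 2) (half_pos hε), hη0.eventually_lt_const (half_pos hε)]
      with n h1 h2 x hx
    have h3 := h1 x hx
    rw [Real.dist_eq] at h3 ⊢
    have h4 := abs_max_min_sub_le (φ x) (v x) (y x) (z (ψ n) x)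
    rw [← sub_sub]
    refine (abs_sub _ _).trans_lt ?_
    rw [abs_of_pos (hη (ψ n))]
    linarith
  have hrhs := tendstoUniformlyOn_neg_mul_rpow (c := 1) (qn := fun _ => p) (cn := fun _ => 1) hM
    (fun n x hx => hTn (ψ n) x hx _) (fun x hx => ⟨(hT x hx _).1, (hT x hx _).2.trans
      (le_add_of_nonneg_right zero_le_one)⟩) hunif hp tendsto_const_nhds tendsto_const_nhds
  simp only [one_mul] at hrhs
  refine ⟨y, y', hasDerivWithinAt_of_tendsto (fun n => hz (ψ n)) (fun x hx => hlim.tendsto_at hx)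
    hlim' hy', hasDerivWithinAt_of_tendsto (fun n => hz' (ψ n)) (fun x hx => hlim'.tendsto_at hx)
    hrhs ?_, ?_, ?_⟩
  · exact (ha.mul ((hφ.sup (hy.inf hv)).rpow_const fun x _ => Or.inr hp.le)).neg
  · exact tendsto_nhds_unique (hlim.tendsto_at hA) (by simp [hzA])
  · exact tendsto_nhds_unique (hlim.tendsto_at hB) (by simp [hzB])

/-- Near a point of positive weight there are arbitrarily small compactly supported subsolutions. -/
theorem exists_cos_subsolution {p δ a₀ m : ℝ} (hp1 : p < 1) (hδ : 0 < δ) (ha₀ : 0 < a₀)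
    (hm : 0 < m) : ∃ ε k : ℝ, 0 < ε ∧ ε ≤ m ∧ k * δ = π / 2 ∧
      ∀ t ∈ Icc 0 ε, k ^ 2 * t ≤ a₀ * t ^ p := by
  have h1p : 0 < 1 - p := by linarith
  set k : ℝ := π / (2 * δ) with hk
  have hk0 : 0 < k := by positivity
  have hc : 0 < a₀ / k ^ 2 := by positivity
  refine ⟨min m ((a₀ / k ^ 2) ^ (1 / (1 - p))), k, lt_min hm (Real.rpow_pos_of_pos hc _),
    min_le_left _ _, by rw [hk]; field_simp, fun t ht => ?_⟩
  rcases ht.1.eq_or_lt with rfl | ht0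
  · rw [mul_zero]; exact mul_nonneg ha₀.le (Real.rpow_nonneg le_rfl _)
  have h1 : t ^ (1 - p) ≤ a₀ / k ^ 2 := by
    have := Real.rpow_le_rpow ht0.le (ht.2.trans (min_le_right _ _)) h1p.le
    rwa [← Real.rpow_mul hc.le, one_div_mul_cancel h1p.ne', Real.rpow_one] at this
  rw [le_div_iff₀ (by positivity)] at h1
  have h2 : t = t ^ (1 - p) * t ^ p := by rw [← Real.rpow_add ht0]; simp
  calc k ^ 2 * t = t ^ (1 - p) * k ^ 2 * t ^ p := by nth_rewrite 1 [h2]; ring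
    _ ≤ a₀ * t ^ p := mul_le_mul_of_nonneg_right h1 (Real.rpow_nonneg ht0.le _)

/-- A positive supersolution dominates a solution that is positive at a prescribed point of
positive weight. -/
theorem exists_solution_le {A B p x₁ : ℝ} {a v v' v'' : ℝ → ℝ}
    (ha : ContinuousOn a (Icc A B)) (hv : ContinuousOn v (Icc A B))
    (hv' : ∀ x ∈ Ioo A B, HasDerivAt v (v' x) x) (hv'' : ∀ x ∈ Ioo A B, HasDerivAt v' (v'' x) x)
    (hsup : ∀ x ∈ Ioo A B, a x * v x ^ p ≤ -v'' x) (hv0 : ∀ x ∈ Ioo A B, 0 < v x)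
    (hvA : v A = 0) (hvB : v B = 0) (hp : 0 < p) (hp1 : p < 1) (hx₁ : x₁ ∈ Ioo A B)
    (hax₁ : 0 < a x₁) :
    ∃ z z' : ℝ → ℝ, (∀ x ∈ Icc A B, HasDerivWithinAt z (z' x) (Icc A B) x) ∧
      (∀ x ∈ Icc A B, HasDerivWithinAt z' (-(a x * z x ^ p)) (Icc A B) x) ∧
      z A = 0 ∧ z B = 0 ∧ (∀ x ∈ Icc A B, 0 ≤ z x ∧ z x ≤ v x) ∧ 0 < z x₁ := by
  have hAB : A < B := hx₁.1.trans hx₁.2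
  have hvnn : ∀ x ∈ Icc A B, 0 ≤ v x := by
    intro x hx
    rcases hx.1.eq_or_lt with rfl | h1
    · exact hvA.ge
    rcases hx.2.eq_or_lt with rfl | h2
    · exact hvB.ge
    exact (hv0 x ⟨h1, h2⟩).le
  obtain ⟨δ, hδ, hJ⟩ : ∃ δ > 0, ∀ x ∈ Icc (x₁ - δ) (x₁ + δ), x ∈ Ioo A B ∧ a x₁ / 2 ≤ a x := by
    have h1 : ∀ᶠ x in 𝓝 x₁, x ∈ Ioo A B ∧ a x₁ / 2 < a x :=
      Filter.Eventually.and (Ioo_mem_nhds hx₁.1 hx₁.2)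
        ((ha.continuousAt (Icc_mem_nhds hx₁.1 hx₁.2)).eventually (lt_mem_nhds (half_lt_self hax₁)))
    obtain ⟨δ, hδ, h2⟩ := Metric.nhds_basis_closedBall.eventually_iff.1 h1
    rw [Real.closedBall_eq_Icc] at h2
    exact ⟨δ, hδ, fun x hx => ⟨(h2 hx).1, (h2 hx).2.le⟩⟩
  set J := Icc (x₁ - δ) (x₁ + δ) with hJdef
  have hx₁J : x₁ ∈ J := ⟨by linarith, by linarith⟩
  obtain ⟨y, hyJ, hymin⟩ := isCompact_Icc.exists_isMinOn ⟨x₁, hx₁J⟩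
    (hv.mono fun x hx => Ioo_subset_Icc_self (hJ x hx).1)
  obtain ⟨ε, k, hε, hεm, hkδ, hεk⟩ := exists_cos_subsolution hp1 hδ (half_pos hax₁)
    (hv0 y (hJ y hyJ).1)
  have hk : 0 < k := pos_of_mul_pos_left (by rw [hkδ]; positivity) hδ.le
  set φ : ℝ → ℝ := fun x => ε * Real.cos (min (k * |x - x₁|) (π / 2)) with hφ
  have hφ0 : ∀ x, 0 ≤ φ x := fun x => mul_nonneg hε.le <| Real.cos_nonneg_of_mem_Icc
    ⟨(by linarith [pi_pos] : -(π / 2) ≤ 0).trans (le_min (by positivity) (by positivity)),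
      min_le_right _ _⟩
  have hφε : ∀ x, φ x ≤ ε := fun x => mul_le_of_le_one_right hε.le (Real.cos_le_one _)
  have hφout : ∀ x ∉ J, φ x = 0 := by
    intro x hx
    have h1 : δ ≤ |x - x₁| := by
      by_contra! h
      rw [abs_lt] at h
      exact hx ⟨by linarith, by linarith⟩
    have h2 : π / 2 ≤ k * |x - x₁| := hkδ ▸ mul_le_mul_of_nonneg_left h1 hk.le
    simp only [hφ, min_eq_right h2, Real.cos_pi_div_two, mul_zero]
  have hφin : ∀ x ∈ J, φ x = ε * Real.cos (k * (x - x₁)) := by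
    intro x hx
    have h1 : |x - x₁| ≤ δ := abs_le.2 ⟨by linarith [hx.1], by linarith [hx.2]⟩
    have h2 : k * |x - x₁| ≤ π / 2 := hkδ ▸ mul_le_mul_of_nonneg_left h1 hk.le
    simp only [hφ, min_eq_left h2]
    rw [← Real.cos_abs (k * (x - x₁)), abs_mul, abs_of_pos hk]
  have hφv : ∀ x ∈ Icc A B, φ x ≤ v x := by
    intro x hx
    by_cases hxJ : x ∈ J
    · exact (hφε x).trans (hεm.trans (hymin hxJ))
    · exact (hφout x hxJ).trans_le (hvnn x hx)
  obtain ⟨z, z', hz, hz', hzA, hzB⟩ := exists_truncated_solution hAB ha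
    (φ := φ) (by fun_prop) hv (fun x _ => hφ0 x) hφv hp hp1
  have hzd : ∀ x ∈ Ioo A B, HasDerivAt z (z' x) x := fun x hx =>
    (hz x (Ioo_subset_Icc_self hx)).hasDerivAt (Icc_mem_nhds hx.1 hx.2)
  have hzd' : ∀ x ∈ Ioo A B,
      HasDerivAt z' (-(a x * max (φ x) (min (z x) (v x)) ^ p)) x := fun x hx =>
    (hz' x (Ioo_subset_Icc_self hx)).hasDerivAt (Icc_mem_nhds hx.1 hx.2)
  have hzc : ContinuousOn z (Icc A B) := fun x hx => (hz x hx).continuousWithinAt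
  have hz0 : ∀ x ∈ Icc A B, 0 ≤ z x := by
    intro x hx
    refine neg_nonpos.1 (nonpos_of_convex_where_pos (g := fun x => -z x) hzc.neg
      (fun x hx => (hzd x hx).fun_neg) (fun x hx => (hzd' x hx).fun_neg) ?_ (by simp [hzA])
      (by simp [hzB]) x hx)
    intro x hx hzx
    rw [neg_neg, max_eq_left ((min_le_left _ _).trans ((neg_pos.1 hzx).le.trans (hφ0 x)))]
    by_cases hxJ : x ∈ J
    · exact mul_nonneg ((half_pos hax₁).le.trans (hJ x hxJ).2) (Real.rpow_nonneg (hφ0 x) _)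
    · rw [hφout x hxJ, Real.zero_rpow hp.ne', mul_zero]
  have hzJ : ∀ x ∈ J, φ x ≤ z x := by
    intro x hx
    have hcos : ∀ x, HasDerivAt (fun x => ε * Real.cos (k * (x - x₁)))
        (ε * (-Real.sin (k * (x - x₁)) * k)) x := fun x => by
      simpa using ((((hasDerivAt_id x).sub_const x₁).const_mul k).cos).const_mul ε
    have hsin : ∀ x, HasDerivAt (fun x => ε * (-Real.sin (k * (x - x₁)) * k))
        (ε * (-(Real.cos (k * (x - x₁)) * k) * k)) x := fun x => by
      simpa using (((((hasDerivAt_id x).sub_const x₁).const_mul k).sin.neg).mul_const k).const_mul ε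
    have hend : ∀ x ∈ J, |x - x₁| = δ → φ x = 0 := by
      intro x _ h
      simp only [hφ, h, hkδ, min_self, Real.cos_pi_div_two, mul_zero]
    have hl : x₁ - δ ∈ J := ⟨le_rfl, by linarith⟩
    have hr : x₁ + δ ∈ J := ⟨by linarith, le_rfl⟩
    have h1 := nonpos_of_convex_where_pos (c := x₁ - δ) (d := x₁ + δ)
      (g := fun x => ε * Real.cos (k * (x - x₁)) - z x)
      (g' := fun x => ε * (-Real.sin (k * (x - x₁)) * k) - z' x)
      (g'' := fun x => ε * (-(Real.cos (k * (x - x₁)) * k) * k)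
        - -(a x * max (φ x) (min (z x) (v x)) ^ p))
      ((by fun_prop : Continuous fun x => ε * Real.cos (k * (x - x₁))).continuousOn.sub
        (hzc.mono fun x hx => Ioo_subset_Icc_self (hJ x hx).1))
      (fun x hx => (hcos x).fun_sub (hzd x (hJ x (Ioo_subset_Icc_self hx)).1))
      (fun x hx => (hsin x).fun_sub (hzd' x (hJ x (Ioo_subset_Icc_self hx)).1)) ?_ ?_ ?_ x hx
    · rw [hφin x hx]; linarith
    · intro x hx hpos
      have hxJ := Ioo_subset_Icc_self hx
      rw [← hφin x hxJ] at hpos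
      rw [max_eq_left ((min_le_left _ _).trans (by linarith))]
      have h2 := hεk (φ x) ⟨hφ0 x, hφε x⟩
      have h3 := mul_le_mul_of_nonneg_right (hJ x hxJ).2 (Real.rpow_nonneg (hφ0 x) p)
      have h4 : ε * (-(Real.cos (k * (x - x₁)) * k) * k) = -(k ^ 2 * φ x) := by
        rw [hφin x hxJ]; ring
      linarith
    · rw [← hφin _ hl, hend _ hl (by rw [sub_sub_cancel_left, abs_neg, abs_of_pos hδ])]
      linarith [hz0 _ (Ioo_subset_Icc_self (hJ _ hl).1)]
    · rw [← hφin _ hr, hend _ hr (by rw [add_sub_cancel_left, abs_of_pos hδ])]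
      linarith [hz0 _ (Ioo_subset_Icc_self (hJ _ hr).1)]
  have hφz : ∀ x ∈ Icc A B, φ x ≤ z x := by
    intro x hx
    by_cases hxJ : x ∈ J
    · exact hzJ x hxJ
    · exact (hφout x hxJ).trans_le (hz0 x hx)
  have hzv : ∀ x ∈ Icc A B, z x ≤ v x := by
    intro x hx
    refine sub_nonpos.1 (nonpos_of_convex_where_pos (g := fun x => z x - v x) (hzc.sub hv)
      (fun x hx => (hzd x hx).fun_sub (hv' x hx)) (fun x hx => (hzd' x hx).fun_sub (hv'' x hx)) ?_
      (by simp [hzA, hvA]) (by simp [hzB, hvB]) x hx)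
    intro x hx hpos
    rw [min_eq_right (by linarith), max_eq_right (hφv x (Ioo_subset_Icc_self hx))]
    linarith [hsup x hx]
  refine ⟨z, z', hz, fun x hx => ?_, hzA, hzB, fun x hx => ⟨hz0 x hx, hzv x hx⟩, ?_⟩
  · have h1 := hz' x hx
    rwa [min_eq_left (hzv x hx), max_eq_right (hφz x hx)] at h1
  · refine lt_of_lt_of_le ?_ (hzJ x₁ hx₁J)
    rw [hφin x₁ hx₁J]
    simpa using hε

/-! ### Degenerate solutions persist when the exponent decreases -/

/-- Extension by zero of a differentiable function on a subinterval. -/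
theorem hasDerivWithinAt_indicator {A B α β : ℝ} {f f' : ℝ → ℝ}
    (hf : ∀ x ∈ Icc α β, HasDerivWithinAt f (f' x) (Icc α β) x)
    (hα : α = A ∨ f α = 0 ∧ f' α = 0) (hβ : β = B ∨ f β = 0 ∧ f' β = 0) (x : ℝ) :
    HasDerivWithinAt ((Icc α β).indicator f) ((Icc α β).indicator f' x) (Icc A B) x := by
  have hclosed : ∀ {c d : ℝ}, (x ∈ Icc c d → HasDerivWithinAt ((Icc α β).indicator f)
      ((Icc α β).indicator f' x) (Icc c d) x) → HasDerivWithinAt ((Icc α β).indicator f)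
      ((Icc α β).indicator f' x) (Icc c d) x := by
    intro c d h
    by_cases hx : x ∈ Icc c d
    · exact h hx
    · exact hasDerivWithinAt_iff_hasFDerivWithinAt.2
        (.of_notMem_closure (by rwa [isClosed_Icc.closure_eq]))
  have hzero : ∀ {c d : ℝ}, (∀ y ∈ Icc c d, y ∈ Icc α β → f y = 0 ∧ f' y = 0) →
      HasDerivWithinAt ((Icc α β).indicator f) ((Icc α β).indicator f' x) (Icc c d) x := by
    intro c d h
    have h0 : ∀ y ∈ Icc c d, (Icc α β).indicator f y = 0 := fun y hy =>
      indicator_apply_eq_zero.2 fun hy' => (h y hy hy').1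
    refine hclosed fun hx => ?_
    rw [indicator_apply_eq_zero.2 fun hx' => (h x hx hx').2]
    exact (hasDerivWithinAt_const x _ 0).congr h0 (h0 x hx)
  have hl : HasDerivWithinAt ((Icc α β).indicator f) ((Icc α β).indicator f' x) (Icc A α) x := by
    rcases hα with rfl | hα
    · refine hclosed fun hx => ?_
      rw [Icc_self, mem_singleton_iff] at hx
      rw [Icc_self, hx]
      exact hasDerivWithinAt_iff_hasFDerivWithinAt.2 .singleton
    · exact hzero fun y hy hy' => by rwa [le_antisymm hy.2 hy'.1]
  have hr : HasDerivWithinAt ((Icc α β).indicator f) ((Icc α β).indicator f' x) (Icc β B) x := by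
    rcases hβ with rfl | hβ
    · refine hclosed fun hx => ?_
      rw [Icc_self, mem_singleton_iff] at hx
      rw [Icc_self, hx]
      exact hasDerivWithinAt_iff_hasFDerivWithinAt.2 .singleton
    · exact hzero fun y hy hy' => by rwa [le_antisymm hy'.2 hy.1]
  have hm : HasDerivWithinAt ((Icc α β).indicator f) ((Icc α β).indicator f' x) (Icc α β) x := by
    refine hclosed fun hx => ?_
    rw [indicator_of_mem hx]
    exact (hf x hx).congr (fun y hy => indicator_of_mem hy f) (indicator_of_mem hx f)
  refine ((hl.union hm).union hr).mono fun y hy => ?_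
  rcases le_total y α with h | h
  · exact .inl (.inl ⟨hy.1, h⟩)
  rcases le_total y β with h' | h'
  · exact .inl (.inr ⟨h, h'⟩)
  · exact .inr ⟨h', hy.2⟩

theorem derivWithin_eq_zero_of_le_sq {α β e d K : ℝ} {z : ℝ → ℝ} (hαβ : α < β)
    (he : e ∈ Icc α β) (hz : HasDerivWithinAt z d (Icc α β) e)
    (hK : ∀ x ∈ Icc α β, |x - e| ≤ 1 → |z x| ≤ K * (x - e) ^ 2) : d = 0 := by
  have hO : z =O[𝓝[Icc α β] e] fun x => ‖x - e‖ ^ 2 := by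
    refine Asymptotics.IsBigO.of_bound K ?_
    filter_upwards [self_mem_nhdsWithin,
      mem_nhdsWithin_of_mem_nhds (Metric.closedBall_mem_nhds e one_pos)] with x hx hx1
    simpa using hK x hx hx1
  have h1 := (hO.hasFDerivWithinAt (𝕜 := ℝ) he one_lt_two).hasDerivWithinAt
  exact ((uniqueDiffOn_Icc hαβ) e he).eq_deriv (Icc α β) hz (by simpa using h1)

namespace DirichletSolution

variable {L q : ℝ} {a u u' u'' : ℝ → ℝ}

theorem deriv_eq_zero (h : DirichletSolution L q a u u' u'') {x : ℝ} (hx : x ∈ Ioo 0 L)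
    (hux : u x = 0) : u' x = 0 := by
  refine IsLocalMin.hasDerivAt_eq_zero ?_ (h.hasDerivAt hx)
  filter_upwards [Icc_mem_nhds hx.1 hx.2] with y hy
  rw [hux]
  exact h.nonneg hy

theorem rpow_le_of_double_zero (h : DirichletSolution L q a u u' u'') (hq : 0 < q) (hq1 : q < 1)
    {M e x : ℝ} (hM : ∀ x ∈ Icc 0 L, |a x| ≤ M) (he : e ∈ Icc 0 L) (hx : x ∈ Icc 0 L)
    (h0 : u e = 0) (h0' : u' e = 0) : u x ^ (1 - q) ≤ M * (x - e) ^ 2 := by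
  have hsub : uIcc e x ⊆ Icc 0 L := uIcc_subset_Icc he hx
  have hM0 : 0 ≤ M := (abs_nonneg _).trans (hM x hx)
  obtain ⟨t, ht, hmax⟩ := isCompact_uIcc.exists_isMaxOn ⟨e, left_mem_uIcc⟩ (h.continuousOn.mono hsub)
  have ht0 : 0 ≤ u t := h.nonneg (hsub ht)
  have hux : u x ≤ u t := hmax right_mem_uIcc
  have h1q : 0 < 1 - q := by linarith
  refine (Real.rpow_le_rpow (h.nonneg hx) hux h1q.le).trans ?_
  rcases ht0.eq_or_lt with h1 | h1
  · rw [← h1, Real.zero_rpow h1q.ne']; positivity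
  have h2 := (abs_le_of_double_zero h.1 h.2.1 (K := M * u t ^ q) he hx h0 h0' (fun y hy => by
    rw [h.eq_neg (hsub hy), abs_neg, abs_mul,
      abs_of_nonneg (Real.rpow_nonneg (h.nonneg (hsub hy)) _)]
    exact mul_le_mul (hM y (hsub hy)) (Real.rpow_le_rpow (h.nonneg (hsub hy)) (hmax hy) hq.le)
      (Real.rpow_nonneg (h.nonneg (hsub hy)) _) hM0) t ht).2
  rw [abs_of_pos h1] at h2
  have h3 : (t - e) ^ 2 ≤ (x - e) ^ 2 := sq_le_sq.2 (abs_sub_left_of_mem_uIcc ht)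
  have h4 : 0 < u t ^ q := Real.rpow_pos_of_pos h1 q
  rw [Real.rpow_sub h1, Real.rpow_one, div_le_iff₀ h4]
  nlinarith [mul_le_mul_of_nonneg_left h3 (mul_nonneg hM0 h4.le)]

/-- The components of the positivity set of a degenerate solution. -/
theorem exists_positive_interval (h : DirichletSolution L q a u u' u'')
    (hne : ∃ x ∈ Icc (0 : ℝ) L, u x ≠ 0) (hz : ∃ z ∈ Icc (0 : ℝ) L, u z = 0 ∧ u' z = 0) :
    ∃ α β, 0 ≤ α ∧ α < β ∧ β ≤ L ∧ u α = 0 ∧ u β = 0 ∧ (∀ x ∈ Ioo α β, 0 < u x) ∧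
      (α = 0 ∨ u' α = 0) ∧ (β = L ∨ u' β = 0) ∧ (u' α = 0 ∨ u' β = 0) := by
  obtain ⟨x₀, hx₀, hux₀⟩ := hne
  obtain ⟨z, hz, huz, huz'⟩ := hz
  have hc1 : IsCompact (Icc 0 x₀ ∩ u ⁻¹' {0}) :=
    isCompact_Icc.of_isClosed_subset ((h.continuousOn.mono
      (Icc_subset_Icc_right hx₀.2)).preimage_isClosed_of_isClosed isClosed_Icc isClosed_singleton)
      inter_subset_left
  have hc2 : IsCompact (Icc x₀ L ∩ u ⁻¹' {0}) :=
    isCompact_Icc.of_isClosed_subset ((h.continuousOn.mono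
      (Icc_subset_Icc_left hx₀.1)).preimage_isClosed_of_isClosed isClosed_Icc isClosed_singleton)
      inter_subset_left
  obtain ⟨α, ⟨hα, huα⟩, hαmax⟩ := hc1.exists_isGreatest ⟨0, ⟨le_rfl, hx₀.1⟩, h.2.2.2.2.1⟩
  obtain ⟨β, ⟨hβ, huβ⟩, hβmin⟩ := hc2.exists_isLeast ⟨L, ⟨hx₀.2, le_rfl⟩, h.2.2.2.2.2.1⟩
  have hαx : α < x₀ := lt_of_le_of_ne hα.2 (by rintro rfl; exact hux₀ huα)
  have hxβ : x₀ < β := lt_of_le_of_ne hβ.1 (by rintro rfl; exact hux₀ huβ)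
  have hα' : α = 0 ∨ u' α = 0 := hα.1.eq_or_lt.imp Eq.symm fun h1 =>
    h.deriv_eq_zero ⟨h1, hαx.trans_le hx₀.2⟩ huα
  have hβ' : β = L ∨ u' β = 0 := hβ.2.eq_or_lt.imp id fun h1 =>
    h.deriv_eq_zero ⟨hx₀.1.trans_lt hxβ, h1⟩ huβ
  refine ⟨α, β, hα.1, hαx.trans hxβ, hβ.2, huα, huβ, fun x hx => ?_, hα', hβ', ?_⟩
  · refine lt_of_le_of_ne (h.nonneg ⟨hα.1.trans hx.1.le, hx.2.le.trans hβ.2⟩) fun h0 => ?_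
    rcases le_total x x₀ with hxx | hxx
    · exact hx.1.not_ge (hαmax ⟨⟨hα.1.trans hx.1.le, hxx⟩, h0.symm⟩)
    · exact hx.2.not_ge (hβmin ⟨⟨hxx, hx.2.le.trans hβ.2⟩, h0.symm⟩)
  · rcases le_total z x₀ with hzx | hzx
    · refine .inl (hα'.elim (fun h0 => ?_) id)
      have hzα := hαmax ⟨⟨hz.1, hzx⟩, huz⟩
      rwa [le_antisymm (h0.trans_le hz.1) hzα]
    · refine .inr (hβ'.elim (fun h0 => ?_) id)
      have hzβ := hβmin ⟨⟨hzx, hz.2⟩, huz⟩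
      rwa [le_antisymm hzβ (hz.2.trans_eq h0.symm)]

end DirichletSolution

/-- A power of a solution is, after scaling, a supersolution for a smaller exponent. -/
theorem DirichletSolution.exists_supersolution {L q p : ℝ} {a u u' u'' : ℝ → ℝ}
    (h : DirichletSolution L q a u u' u'') (hpq : p < q) (hq1 : q < 1) :
    ∃ c : ℝ, 0 < c ∧ ∃ v' v'' : ℝ → ℝ, ∀ x ∈ Ioo 0 L, 0 < u x →
      HasDerivAt (fun y => c * u y ^ ((1 - q) / (1 - p))) (v' x) x ∧
      HasDerivAt v' (v'' x) x ∧ a x * (c * u x ^ ((1 - q) / (1 - p))) ^ p ≤ -v'' x := by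
  have h1p : 0 < 1 - p := by linarith
  set s : ℝ := (1 - q) / (1 - p) with hs
  have hs0 : 0 < s := div_pos (by linarith) h1p
  have hs1 : s < 1 := (div_lt_one h1p).2 (by linarith)
  have hsp : s * p = s - 1 + q := by rw [hs]; field_simp; ring
  set c : ℝ := s ^ (-1 / (1 - p)) with hc
  have hc0 : 0 < c := Real.rpow_pos_of_pos hs0 _
  have hcp : c ^ p = c * s := by
    have h1 : c ^ (1 - p) = s⁻¹ := by
      rw [hc, ← Real.rpow_mul hs0.le, div_mul_cancel₀ _ h1p.ne', Real.rpow_neg_one]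
    rw [Real.rpow_sub hc0, Real.rpow_one, div_eq_iff (Real.rpow_pos_of_pos hc0 p).ne'] at h1
    nth_rewrite 2 [h1]
    field_simp
  refine ⟨c, hc0, fun x => c * (u' x * s * u x ^ (s - 1)),
    fun x => c * (u'' x * s * u x ^ (s - 1) + u' x * s * (u' x * (s - 1) * u x ^ (s - 1 - 1))),
    fun x hx hux => ⟨?_, ?_, ?_⟩⟩
  · exact ((h.hasDerivAt hx).rpow_const (Or.inl hux.ne')).const_mul c
  · exact (((h.hasDerivAt' hx).mul_const s).mul
      ((h.hasDerivAt hx).rpow_const (Or.inl hux.ne'))).const_mul c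
  · rw [Real.mul_rpow hc0.le (Real.rpow_nonneg hux.le _), ← Real.rpow_mul hux.le, hsp, hcp,
      Real.rpow_add hux]
    beta_reduce
    rw [h.eq_neg (Ioo_subset_Icc_self hx)]
    have h2 : 0 ≤ c * s * (1 - s) * (u' x ^ 2 * u x ^ (s - 1 - 1)) :=
      mul_nonneg (mul_nonneg (mul_pos hc0 hs0).le (by linarith))
        (mul_nonneg (sq_nonneg _) (Real.rpow_nonneg hux.le _))
    linarith

theorem HasDegenerateSolution.of_lt {L p q : ℝ} {a : ℝ → ℝ} (ha : ContinuousOn a (Icc 0 L))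
    (hp : 0 < p) (hpq : p < q) (hq1 : q < 1) (hdeg : HasDegenerateSolution L q a) :
    HasDegenerateSolution L p a := by
  obtain ⟨u, u', u'', h, hne, hz⟩ := hdeg
  obtain ⟨α, β, hα, hαβ, hβ, huα, huβ, hupos, hα', hβ', hαβ'⟩ := h.exists_positive_interval hne hz
  have hq : 0 < q := hp.trans hpq
  have h1p : 0 < 1 - p := by linarith
  have h1q : 0 < 1 - q := by linarith
  have hs0 : 0 < (1 - q) / (1 - p) := div_pos h1q h1p
  have hsub : Icc α β ⊆ Icc 0 L := Icc_subset_Icc hα hβ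
  have hsubo : Ioo α β ⊆ Ioo 0 L := Ioo_subset_Ioo hα hβ
  have hαI : α ∈ Icc α β := left_mem_Icc.2 hαβ.le
  have hβI : β ∈ Icc α β := right_mem_Icc.2 hαβ.le
  obtain ⟨M, hM⟩ := isCompact_Icc.exists_bound_of_continuousOn ha
  have hM0 : 0 ≤ M := (norm_nonneg _).trans (hM α (hsub hαI))
  obtain ⟨c, hc, v', v'', hv⟩ := h.exists_supersolution hpq hq1
  obtain ⟨x₀, hx₀⟩ := nonempty_Ioo.2 hαβ
  obtain ⟨x₁, hx₁, hax₁, -⟩ :=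
    h.exists_weight_pos hα hβ huα huβ (Ioo_subset_Icc_self hx₀) (hupos x₀ hx₀)
  obtain ⟨w, w', hw, hw', hwα, hwβ, hwv, hwx₁⟩ := exists_solution_le
    (v := fun x => c * u x ^ ((1 - q) / (1 - p))) (ha.mono hsub)
    (continuousOn_const.mul ((h.continuousOn.mono hsub).rpow_const fun _ _ => Or.inr hs0.le))
    (fun x hx => (hv x (hsubo hx) (hupos x hx)).1) (fun x hx => (hv x (hsubo hx) (hupos x hx)).2.1)
    (fun x hx => (hv x (hsubo hx) (hupos x hx)).2.2)
    (fun x hx => mul_pos hc (Real.rpow_pos_of_pos (hupos x hx) _))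
    (by simp only [huα, Real.zero_rpow hs0.ne', mul_zero])
    (by simp only [huβ, Real.zero_rpow hs0.ne', mul_zero]) hp (hpq.trans hq1) hx₁ hax₁
  have hdecay : ∀ e ∈ Icc α β, u e = 0 → u' e = 0 → w' e = 0 := by
    intro e he h0 h0'
    refine derivWithin_eq_zero_of_le_sq (K := c * M ^ (1 / (1 - p))) hαβ he (hw e he)
      fun x hx hxe => ?_
    rw [abs_of_nonneg (hwv x hx).1]
    refine (hwv x hx).2.trans ?_
    rw [mul_assoc]
    refine mul_le_mul_of_nonneg_left ?_ hc.le
    have hr : 0 < 1 / (1 - p) := by positivity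
    have hsq : (x - e) ^ 2 ≤ 1 := by rwa [sq_le_one_iff_abs_le_one]
    have h2 := Real.rpow_le_rpow (Real.rpow_nonneg (h.nonneg (hsub hx)) _)
      (h.rpow_le_of_double_zero hq hq1 hM (hsub he) (hsub hx) h0 h0') hr.le
    rw [← Real.rpow_mul (h.nonneg (hsub hx)), mul_one_div,
      Real.mul_rpow hM0 (sq_nonneg _)] at h2
    refine h2.trans (mul_le_mul_of_nonneg_left ?_ (Real.rpow_nonneg hM0 _))
    refine Real.rpow_le_self_of_le_one (sq_nonneg _) hsq ?_
    rw [le_div_iff₀ h1p]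
    linarith
  have hind : ∀ x, -(Icc α β).indicator (fun y => -(a y * w y ^ p)) x =
      a x * (Icc α β).indicator w x ^ p := by
    intro x
    by_cases hx : x ∈ Icc α β
    · simp [indicator_of_mem hx]
    · simp [indicator_of_notMem hx, Real.zero_rpow hp.ne']
  have hext := hasDerivWithinAt_indicator (A := 0) (B := L) hw
    (hα'.imp id fun h0 => ⟨hwα, hdecay α hαI huα h0⟩)
    (hβ'.imp id fun h0 => ⟨hwβ, hdecay β hβI huβ h0⟩)
  have hext' := hasDerivWithinAt_indicator (A := 0) (B := L) hw'
    (hα'.imp id fun h0 => ⟨hdecay α hαI huα h0, by simp [hwα, Real.zero_rpow hp.ne']⟩)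
    (hβ'.imp id fun h0 => ⟨hdecay β hβI huβ h0, by simp [hwβ, Real.zero_rpow hp.ne']⟩)
  refine ⟨_, _, _, ⟨fun x _ => hext x, fun x _ => hext' x, ?_, ?_, ?_, ?_, fun x _ => hind x⟩,
    ⟨x₁, hsub (Ioo_subset_Icc_self hx₁), ?_⟩, ?_⟩
  · have hc1 : ContinuousOn ((Icc α β).indicator w) (Icc 0 L) := fun x _ =>
      (hext x).continuousWithinAt
    exact (ha.mul (hc1.rpow_const fun _ _ => Or.inr hp.le)).neg.congr fun x _ =>
      neg_eq_iff_eq_neg.1 (hind x)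
  · exact fun x _ => indicator_nonneg (fun y hy => (hwv y hy).1) x
  · exact indicator_apply_eq_zero.2 fun h0 => le_antisymm h0.1 hα ▸ hwα
  · exact indicator_apply_eq_zero.2 fun h0 => le_antisymm hβ h0.2 ▸ hwβ
  · rw [indicator_of_mem (Ioo_subset_Icc_self hx₁)]
    exact hwx₁.ne'
  · rcases hαβ' with h0 | h0
    · exact ⟨α, hsub hαI, by rw [indicator_of_mem hαI, hwα],
        by rw [indicator_of_mem hαI, hdecay α hαI huα h0]⟩
    · exact ⟨β, hsub hβI, by rw [indicator_of_mem hβI, hwβ],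
        by rw [indicator_of_mem hβI, hdecay β hβI huβ h0]⟩

theorem forall_stronglyPositive_iff {L q : ℝ} (hL : 0 < L) {a : ℝ → ℝ} :
    (∀ u u' u'' : ℝ → ℝ, DirichletSolution L q a u u' u'' → (∃ x ∈ Icc (0 : ℝ) L, u x ≠ 0) →
      ((∀ x ∈ Ioo (0 : ℝ) L, 0 < u x) ∧ 0 < u' 0 ∧ u' L < 0)) ↔
    ¬ HasDegenerateSolution L q a := by
  constructor
  · rintro H ⟨u, u', u'', h, hne, z, hz, huz, huz'⟩
    obtain ⟨h1, h2, h3⟩ := H u u' u'' h hne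
    rcases hz.1.eq_or_lt with rfl | hz0
    · exact h2.ne' huz'
    rcases hz.2.eq_or_lt with rfl | hzL
    · exact h3.ne huz'
    exact (h1 z ⟨hz0, hzL⟩).ne' huz
  · intro H u u' u'' h hne
    have hnd : ∀ z ∈ Icc 0 L, u z = 0 → u' z ≠ 0 := fun z hz h0 h0' =>
      H ⟨u, u', u'', h, hne, z, hz, h0, h0'⟩
    have h0I : (0 : ℝ) ∈ Icc 0 L := left_mem_Icc.2 hL.le
    have hLI : L ∈ Icc 0 L := right_mem_Icc.2 hL.le
    refine ⟨fun x hx => lt_of_le_of_ne (h.nonneg (Ioo_subset_Icc_self hx)) fun h0 =>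
      hnd x (Ioo_subset_Icc_self hx) h0.symm (h.deriv_eq_zero hx h0.symm),
      lt_of_le_of_ne ?_ (hnd 0 h0I h.2.2.2.2.1).symm, lt_of_le_of_ne ?_ (hnd L hLI h.2.2.2.2.2.1)⟩
    · have h1 : HasDerivWithinAt u (u' 0) (Ioi (0 : ℝ)) 0 :=
        (h.1 0 h0I).mono_of_mem_nhdsWithin (Icc_mem_nhdsGT hL)
      refine ge_of_tendsto ((hasDerivWithinAt_iff_tendsto_slope' (by simp)).1 h1) ?_
      filter_upwards [Ioo_mem_nhdsGT hL] with y hy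
      rw [slope_def_field, h.2.2.2.2.1]
      exact div_nonneg (by linarith [h.nonneg (Ioo_subset_Icc_self hy)]) (by linarith [hy.1])
    · have h1 : HasDerivWithinAt u (u' L) (Iio L) L :=
        (h.1 L hLI).mono_of_mem_nhdsWithin (Icc_mem_nhdsLT hL)
      refine le_of_tendsto ((hasDerivWithinAt_iff_tendsto_slope' (by simp)).1 h1) ?_
      filter_upwards [Ioo_mem_nhdsLT hL] with y hy
      rw [slope_def_field, h.2.2.2.2.2.1]
      exact div_nonpos_of_nonneg_of_nonpos (by linarith [h.nonneg (Ioo_subset_Icc_self hy)])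
        (by linarith [hy.2])

/-- One-dimensional characterization of the Dirichlet positivity set: for a
sign-changing continuous weight whose positivity set in `(0, L)` has finitely many
connected components, there exists `q_D ∈ [0, 1)` such that, for `q ∈ (0, 1)`, every
nontrivial solution of the Dirichlet problem is strongly positive iff `q_D < q`. -/
theorem stmt_16 (L : ℝ) (hL : 0 < L)
    (a : ℝ → ℝ) (ha : ContinuousOn a (Set.Icc 0 L)) (hsign : ChangesSign L a)
    (hfin : Finite (ConnectedComponents {x : ℝ // x ∈ Set.Ioo (0 : ℝ) L ∧ 0 < a x})) :
    ∃ qD : ℝ, 0 ≤ qD ∧ qD < 1 ∧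
      ∀ q : ℝ, 0 < q → q < 1 →
        ((∀ u u' u'' : ℝ → ℝ, DirichletSolution L q a u u' u'' →
            (∃ x ∈ Set.Icc (0 : ℝ) L, u x ≠ 0) →
            ((∀ x ∈ Set.Ioo (0 : ℝ) L, 0 < u x) ∧ 0 < u' 0 ∧ u' L < 0)) ↔ qD < q) := by
  simp only [forall_stronglyPositive_iff hL]
  set N : Set ℝ := {q | q ∈ Ioo (0 : ℝ) 1 ∧ HasDegenerateSolution L q a} with hN
  rcases N.eq_empty_or_nonempty with hempty | hnonempty
  · refine ⟨0, le_rfl, one_pos, fun q hq hq1 => ⟨fun _ => hq, fun _ hdeg => ?_⟩⟩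
    exact (hempty ▸ (⟨⟨hq, hq1⟩, hdeg⟩ : q ∈ N) : q ∈ (∅ : Set ℝ))
  have hbdd : BddAbove N := ⟨1, fun q hq => hq.1.2.le⟩
  have hle : ∀ q ∈ N, q ≤ sSup N := fun q hq => le_csSup hbdd hq
  obtain ⟨q₀, hq₀⟩ := hnonempty
  have hpos : 0 < sSup N := hq₀.1.1.trans_le (hle q₀ hq₀)
  obtain ⟨qn, -, hlim, hqn⟩ := exists_seq_tendsto_sSup ⟨q₀, hq₀⟩ hbdd
  obtain ⟨hlt, hdeg⟩ := hasDegenerateSolution_of_tendsto hL ha hfin (fun n => (hqn n).1) hlim hpos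
    fun n => (hqn n).2
  refine ⟨sSup N, hpos.le, hlt, fun q hq hq1 => ⟨fun hnd => ?_, fun hlt' hdeg' => ?_⟩⟩
  · by_contra! hqle
    rcases hqle.eq_or_lt with rfl | hqlt
    · exact hnd hdeg
    · exact hnd (hdeg.of_lt ha hq hqlt hlt)
  · exact hlt'.not_ge (hle q ⟨⟨hq, hq1⟩, hdeg'⟩)
end

section
/- (One-dimensional characterization of the Neumann positivity set: A_N = (q_N, 1).) Let L > 0 and let a : [0,L] → ℝ be continuous and change sign, assume the open set {x ∈ (0,L) : a(x) > 0} has finitely many connected components, and assume ∫₀^L a(x) dx < 0. Then there exists q_N ∈ [0,1) such that for every q ∈ (0,1) the following equivalence holds: every nontrivial solution of the Neumann problem (P_N) with weight a and exponent q is strongly positive if and only if q_N < q. -/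
open Real Set

/-- `u` (with first and second derivatives `u'`, `u''`) is a solution of the
one-dimensional Neumann problem `(P_N)` on `[0, L]` with weight `a` and exponent `q`:
`u` is twice continuously differentiable on `[0, L]`, nonnegative, has vanishing
derivative at the endpoints, and satisfies `-u'' = a(x) u^q` on `[0, L]`. -/
def NeumannSolution (L q : ℝ) (a u u' u'' : ℝ → ℝ) : Prop :=
  (∀ x ∈ Set.Icc (0 : ℝ) L, HasDerivWithinAt u (u' x) (Set.Icc 0 L) x) ∧
  (∀ x ∈ Set.Icc (0 : ℝ) L, HasDerivWithinAt u' (u'' x) (Set.Icc 0 L) x) ∧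
  ContinuousOn u'' (Set.Icc 0 L) ∧
  (∀ x ∈ Set.Icc (0 : ℝ) L, 0 ≤ u x) ∧
  u' 0 = 0 ∧ u' L = 0 ∧
  (∀ x ∈ Set.Icc (0 : ℝ) L, -u'' x = a x * u x ^ q)

open Filter Topology

/-- `u` solves the linear Neumann problem `-u'' = g` on `[0, L]`, with derivative `u'`. -/
def SolvesNeumann (L : ℝ) (g u u' : ℝ → ℝ) : Prop :=
  (∀ x ∈ Icc (0 : ℝ) L, HasDerivWithinAt u (u' x) (Icc 0 L) x) ∧
  (∀ x ∈ Icc (0 : ℝ) L, HasDerivWithinAt u' (-g x) (Icc 0 L) x) ∧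
  u' 0 = 0 ∧ u' L = 0

/-- One-sided version of the second derivative test, valid up to the endpoints. -/
theorem second_deriv_nonpos_of_isMaxOn {A B x c : ℝ} {f f' : ℝ → ℝ} (hAB : A < B)
    (hx : x ∈ Icc A B) (hf : ∀ t ∈ Icc A B, HasDerivWithinAt f (f' t) (Icc A B) t)
    (hfx : f' x = 0) (hc : HasDerivWithinAt f' c (Icc A B) x) (hmax : IsMaxOn f (Icc A B) x) :
    c ≤ 0 := by
  by_contra! hpos
  rw [hasDerivWithinAt_iff_tendsto_slope] at hc
  have hev := hc.eventually (lt_mem_nhds hpos)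
  rw [eventually_nhdsWithin_iff, Metric.eventually_nhds_iff] at hev
  obtain ⟨δ, hδ, hev⟩ := hev
  have hder : ∀ s t, A ≤ s → t ≤ B → ∀ y ∈ interior (Icc s t),
      HasDerivWithinAt f (f' y) (interior (Icc s t)) y := by
    intro s t hs ht y hy
    have hsub : interior (Icc s t) ⊆ Icc A B := interior_subset.trans (Icc_subset_Icc hs ht)
    exact (hf y (hsub hy)).mono hsub
  have hcont : ContinuousOn f (Icc A B) := fun t ht => (hf t ht).continuousWithinAt
  rcases hx.2.lt_or_eq with hxB | rfl
  · set b := min B (x + δ / 2) with hb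
    have hxb : x < b := lt_min hxB (by linarith)
    have hbB : b ≤ B := min_le_left _ _
    have hbδ : b ≤ x + δ / 2 := min_le_right _ _
    have hmono : StrictMonoOn f (Icc x b) := by
      refine strictMonoOn_of_hasDerivWithinAt_pos (convex_Icc _ _)
        (hcont.mono (Icc_subset_Icc hx.1 hbB)) (hder _ _ hx.1 hbB) ?_
      intro y hy
      rw [interior_Icc] at hy
      have h1 := hev (y := y) (by rw [Real.dist_eq, abs_of_pos (by linarith [hy.1])]; linarith [hy.2])
        ⟨⟨hx.1.trans hy.1.le, hy.2.le.trans hbB⟩, hy.1.ne'⟩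
      rw [slope_def_field, hfx, sub_zero] at h1
      exact (div_pos_iff_of_pos_right (by linarith [hy.1])).1 h1
    have h1 := hmono (left_mem_Icc.2 hxb.le) (right_mem_Icc.2 hxb.le) hxb
    exact absurd (hmax (a := b) ⟨hx.1.trans hxb.le, hbB⟩) (not_le.2 h1)
  · set b := max A (x - δ / 2) with hb
    have hxb : b < x := max_lt hAB (by linarith)
    have hbB : A ≤ b := le_max_left _ _
    have hbδ : x - δ / 2 ≤ b := le_max_right _ _
    have hmono : StrictAntiOn f (Icc b x) := by
      refine strictAntiOn_of_hasDerivWithinAt_neg (convex_Icc _ _)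
        (hcont.mono (Icc_subset_Icc hbB le_rfl)) (hder _ _ hbB le_rfl) ?_
      intro y hy
      rw [interior_Icc] at hy
      have h1 := hev (y := y) (by rw [Real.dist_eq, abs_of_neg (by linarith [hy.2])]; linarith [hy.1])
        ⟨⟨hbB.trans hy.1.le, hy.2.le⟩, hy.2.ne⟩
      rw [slope_def_field, hfx, sub_zero, div_pos_iff] at h1
      rcases h1 with h1 | h1
      · linarith [h1.2, hy.2]
      · exact h1.1
    have h1 := hmono (left_mem_Icc.2 hxb.le) (right_mem_Icc.2 hxb.le) hxb
    exact absurd (hmax (a := b) ⟨hbB, hxb.le⟩) (not_le.2 h1)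

/-- The derivative vanishes at an interior maximum. -/
theorem deriv_eq_zero_of_isMaxOn {A B x : ℝ} {f f' : ℝ → ℝ} (hx : x ∈ Ioo A B)
    (hf : HasDerivWithinAt f (f' x) (Icc A B) x) (hmax : IsMaxOn f (Icc A B) x) : f' x = 0 :=
  (hmax.isLocalMax (Icc_mem_nhds hx.1 hx.2)).hasDerivAt_eq_zero
    (hf.hasDerivAt (Icc_mem_nhds hx.1 hx.2))

/-- Weak maximum principle for `φ'' ≥ K φ`, with Dirichlet or Neumann data at each endpoint. -/
theorem nonpos_of_mul_le_second_deriv {A B K : ℝ} {φ φ' φ'' : ℝ → ℝ} (hAB : A < B) (hK : 0 < K)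
    (hφ : ∀ t ∈ Icc A B, HasDerivWithinAt φ (φ' t) (Icc A B) t)
    (hφ' : ∀ t ∈ Icc A B, HasDerivWithinAt φ' (φ'' t) (Icc A B) t)
    (hA : φ' A = 0 ∨ φ A ≤ 0) (hB : φ' B = 0 ∨ φ B ≤ 0)
    (hineq : ∀ t ∈ Icc A B, K * φ t ≤ φ'' t) : ∀ t ∈ Icc A B, φ t ≤ 0 := by
  have hcont : ContinuousOn φ (Icc A B) := fun t ht => (hφ t ht).continuousWithinAt
  obtain ⟨x, hx, hmax⟩ := isCompact_Icc.exists_isMaxOn ⟨A, left_mem_Icc.2 hAB.le⟩ hcont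
  intro t ht
  refine (hmax ht).trans ?_
  change φ x ≤ 0
  by_contra! hpos
  have h0 : φ' x = 0 := by
    rcases hx.1.eq_or_lt with rfl | h1
    · exact hA.resolve_right (not_le.2 hpos)
    rcases hx.2.eq_or_lt with rfl | h2
    · exact hB.resolve_right (not_le.2 hpos)
    exact deriv_eq_zero_of_isMaxOn ⟨h1, h2⟩ (hφ x hx) hmax
  have h1 := second_deriv_nonpos_of_isMaxOn hAB hx hφ h0 (hφ' x hx) hmax
  have h2 := hineq x hx
  have h3 := mul_pos hK hpos
  linarith

theorem SolvesNeumann.continuousOn {L : ℝ} {g u u' : ℝ → ℝ} (h : SolvesNeumann L g u u') :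
    ContinuousOn u (Icc 0 L) := fun t ht => (h.1 t ht).continuousWithinAt

/-- Comparison principle for `-w'' + K w = g` with Neumann boundary conditions. -/
theorem SolvesNeumann.le {L K : ℝ} {g₁ g₂ w₁ w₁' w₂ w₂' : ℝ → ℝ} (hL : 0 < L) (hK : 0 < K)
    (h₁ : SolvesNeumann L g₁ w₁ w₁') (h₂ : SolvesNeumann L g₂ w₂ w₂')
    (hle : ∀ x ∈ Icc 0 L, g₁ x + K * w₁ x ≤ g₂ x + K * w₂ x) :
    ∀ x ∈ Icc 0 L, w₁ x ≤ w₂ x := by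
  intro x hx
  refine sub_nonpos.1 (nonpos_of_mul_le_second_deriv (φ := fun x => w₁ x - w₂ x)
    (φ' := fun x => w₁' x - w₂' x) (φ'' := fun x => -g₁ x - -g₂ x) hL hK
    (fun t ht => (h₁.1 t ht).sub (h₂.1 t ht)) (fun t ht => (h₁.2.1 t ht).sub (h₂.2.1 t ht))
    (Or.inl ?_) (Or.inl ?_) ?_ x hx)
  · simp [h₁.2.2.1, h₂.2.2.1]
  · simp [h₁.2.2.2, h₂.2.2.2]
  · intro t ht
    have := hle t ht
    linarith

/-- The linear problem `-w'' + k² w = g` with Neumann boundary conditions is solvable. -/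
theorem exists_solvesNeumann {L k : ℝ} (hL : 0 < L) (hk : 0 < k) {g : ℝ → ℝ}
    (hg : ContinuousOn g (Icc 0 L)) :
    ∃ w w' : ℝ → ℝ, SolvesNeumann L (fun x => g x - k ^ 2 * w x) w w' := by
  set G : ℝ → ℝ := IccExtend hL.le ((Icc 0 L).domRestrict g) with hGdef
  have hG : Continuous G := (continuousOn_iff_continuous_domRestrict.1 hg).Icc_extend'
  have hGg : ∀ x ∈ Icc 0 L, G x = g x := fun x hx => by
    rw [hGdef, IccExtend_of_mem _ _ hx]; rfl
  set P : ℝ → ℝ := fun x => ∫ t in (0 : ℝ)..x, cosh (k * t) * G t with hPdef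
  set Q : ℝ → ℝ := fun x => ∫ t in (0 : ℝ)..x, sinh (k * t) * G t with hQdef
  have hP : ∀ x, HasDerivAt P (cosh (k * x) * G x) x := fun x =>
    (Continuous.integral_hasStrictDerivAt (by fun_prop) 0 x).hasDerivAt
  have hQ : ∀ x, HasDerivAt Q (sinh (k * x) * G x) x := fun x =>
    (Continuous.integral_hasStrictDerivAt (by fun_prop) 0 x).hasDerivAt
  have hkx : ∀ x, HasDerivAt (fun x => k * x) k x := fun x => by
    simpa using (hasDerivAt_id x).const_mul k
  have hC : ∀ x, HasDerivAt (fun x => cosh (k * x)) (sinh (k * x) * k) x := fun x => (hkx x).cosh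
  have hS : ∀ x, HasDerivAt (fun x => sinh (k * x)) (cosh (k * x) * k) x := fun x => (hkx x).sinh
  have hsL : sinh (k * L) ≠ 0 := (Real.sinh_pos_iff.2 (mul_pos hk hL)).ne'
  set A : ℝ := (cosh (k * L) * P L - sinh (k * L) * Q L) / (k * sinh (k * L)) with hA
  refine ⟨fun x => A * cosh (k * x) - (sinh (k * x) * P x - cosh (k * x) * Q x) / k,
    fun x => A * (sinh (k * x) * k) - (cosh (k * x) * P x - sinh (k * x) * Q x), ?_, ?_, ?_, ?_⟩
  · intro x _
    refine HasDerivAt.hasDerivWithinAt ?_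
    refine (((hC x).const_mul A).fun_sub
      ((((hS x).fun_mul (hP x)).fun_sub ((hC x).fun_mul (hQ x))).div_const k)).congr_deriv ?_
    field_simp
    ring
  · intro x hx
    refine HasDerivAt.hasDerivWithinAt ?_
    refine ((((hS x).mul_const k).const_mul A).fun_sub
      (((hC x).fun_mul (hP x)).fun_sub ((hS x).fun_mul (hQ x)))).congr_deriv ?_
    simp only [← hGg x hx]
    have := Real.cosh_sq (k * x)
    field_simp
    linear_combination (-G x) * this
  · simp [hPdef, hQdef]
  · simp only [hA]
    field_simp
    ring

theorem SolvesNeumann.abs_deriv_le {L M : ℝ} {g u u' : ℝ → ℝ}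
    (h : SolvesNeumann L g u u') (hg : ∀ x ∈ Icc 0 L, |g x| ≤ M) :
    ∀ x ∈ Icc 0 L, |u' x| ≤ M * L := by
  intro x hx
  have hL : 0 ≤ L := hx.1.trans hx.2
  have h1 := (convex_Icc 0 L).norm_image_sub_le_of_norm_hasDerivWithin_le h.2.1 (C := M)
    (fun y hy => by simpa using hg y hy) (left_mem_Icc.2 hL) hx
  rw [h.2.2.1, sub_zero, sub_zero, Real.norm_eq_abs, Real.norm_eq_abs, abs_of_nonneg hx.1] at h1
  exact h1.trans (mul_le_mul_of_nonneg_left hx.2 ((abs_nonneg _).trans (hg x hx)))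

theorem SolvesNeumann.abs_sub_le {L M : ℝ} {g u u' : ℝ → ℝ}
    (h : SolvesNeumann L g u u') (hg : ∀ x ∈ Icc 0 L, |g x| ≤ M) :
    ∀ x ∈ Icc 0 L, ∀ y ∈ Icc 0 L, |u x - u y| ≤ M * L * |x - y| := fun _ hx _ hy =>
  (convex_Icc 0 L).norm_image_sub_le_of_norm_hasDerivWithin_le h.1 (C := M * L)
    (fun z hz => h.abs_deriv_le hg z hz) hy hx

theorem integral_eq_sub_of_hasDerivWithinAt_Icc {L x : ℝ} {f f' : ℝ → ℝ}
    (h : ∀ t ∈ Icc 0 L, HasDerivWithinAt f (f' t) (Icc 0 L) t) (hf' : ContinuousOn f' (Icc 0 L))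
    (hx : x ∈ Icc 0 L) : ∫ t in (0 : ℝ)..x, f' t = f x - f 0 := by
  have hsub : Icc 0 x ⊆ Icc 0 L := Icc_subset_Icc le_rfl hx.2
  refine intervalIntegral.integral_eq_sub_of_hasDerivAt_of_le hx.1
    (fun t ht => ((h t (hsub ht)).continuousWithinAt).mono hsub) (fun t ht => ?_) ?_
  · exact (h t (hsub (Ioo_subset_Icc_self ht))).hasDerivAt
      (Icc_mem_nhds ht.1 (ht.2.trans_le hx.2))
  · refine ContinuousOn.intervalIntegrable ?_
    rw [uIcc_of_le hx.1]
    exact hf'.mono hsub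

theorem hasDerivWithinAt_integral_Icc {L x : ℝ} {f : ℝ → ℝ} (hf : ContinuousOn f (Icc 0 L))
    (hx : x ∈ Icc 0 L) :
    HasDerivWithinAt (fun y => ∫ t in (0 : ℝ)..y, f t) (f x) (Icc 0 L) x := by
  have hL : 0 ≤ L := hx.1.trans hx.2
  set G : ℝ → ℝ := IccExtend hL ((Icc 0 L).domRestrict f) with hGdef
  have hG : Continuous G := (continuousOn_iff_continuous_domRestrict.1 hf).Icc_extend'
  have hGf : ∀ t ∈ Icc 0 L, G t = f t := fun t ht => by
    rw [hGdef, IccExtend_of_mem _ _ ht]; rfl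
  have h1 : HasDerivAt (fun y => ∫ t in (0 : ℝ)..y, G t) (G x) x :=
    (hG.integral_hasStrictDerivAt 0 x).hasDerivAt
  have h2 : ∀ y ∈ Icc 0 L, ∫ t in (0 : ℝ)..y, f t = ∫ t in (0 : ℝ)..y, G t := fun y hy => by
    refine intervalIntegral.integral_congr fun t ht => (hGf t ?_).symm
    rw [uIcc_of_le hy.1] at ht
    exact ⟨ht.1, ht.2.trans hy.2⟩
  rw [← hGf x hx]
  exact h1.hasDerivWithinAt.congr h2 (h2 x hx)

theorem tendsto_integral_of_bounded {L M x : ℝ} {fs : ℕ → ℝ → ℝ} {f : ℝ → ℝ} (hx : x ∈ Icc 0 L)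
    (hfs : ∀ n, ContinuousOn (fs n) (Icc 0 L)) (hM : ∀ n, ∀ t ∈ Icc 0 L, |fs n t| ≤ M)
    (hlim : ∀ t ∈ Icc 0 L, Tendsto (fun n => fs n t) atTop (𝓝 (f t))) :
    Tendsto (fun n => ∫ t in (0 : ℝ)..x, fs n t) atTop (𝓝 (∫ t in (0 : ℝ)..x, f t)) := by
  have hsub : uIoc 0 x ⊆ Icc 0 L := by
    rw [uIoc_of_le hx.1]
    exact fun t ht => ⟨ht.1.le, ht.2.trans hx.2⟩
  refine intervalIntegral.tendsto_integral_filter_of_dominated_convergence (fun _ => M)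
    (Eventually.of_forall fun n => ?_) (Eventually.of_forall fun n => ?_)
    intervalIntegrable_const ?_
  · exact ((hfs n).mono hsub).aestronglyMeasurable measurableSet_uIoc
  · exact Eventually.of_forall fun t ht => hM n t (hsub ht)
  · exact Eventually.of_forall fun t ht => hlim t (hsub ht)

/-- Solutions of the linear Neumann problem are stable under bounded pointwise convergence. -/
theorem SolvesNeumann.of_tendsto {L M : ℝ} {gs us us' : ℕ → ℝ → ℝ} {g u : ℝ → ℝ} (hL : 0 < L)
    (h : ∀ n, SolvesNeumann L (gs n) (us n) (us' n)) (hgs : ∀ n, ContinuousOn (gs n) (Icc 0 L))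
    (hM : ∀ n, ∀ x ∈ Icc 0 L, |gs n x| ≤ M) (hg : ContinuousOn g (Icc 0 L))
    (hlim : ∀ x ∈ Icc 0 L, Tendsto (fun n => gs n x) atTop (𝓝 (g x)))
    (hu : ∀ x ∈ Icc 0 L, Tendsto (fun n => us n x) atTop (𝓝 (u x))) :
    ∃ u', SolvesNeumann L g u u' := by
  have h0 : (0 : ℝ) ∈ Icc 0 L := left_mem_Icc.2 hL.le
  have hLm : L ∈ Icc 0 L := right_mem_Icc.2 hL.le
  set u' : ℝ → ℝ := fun x => ∫ t in (0 : ℝ)..x, -g t with hu'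
  have hu'd : ∀ x ∈ Icc 0 L, HasDerivWithinAt u' (-g x) (Icc 0 L) x := fun x hx =>
    hasDerivWithinAt_integral_Icc hg.neg hx
  have hu'c : ContinuousOn u' (Icc 0 L) := fun x hx => (hu'd x hx).continuousWithinAt
  have husc : ∀ n, ContinuousOn (us' n) (Icc 0 L) := fun n x hx =>
    ((h n).2.1 x hx).continuousWithinAt
  have hlim' : ∀ x ∈ Icc 0 L, Tendsto (fun n => us' n x) atTop (𝓝 (u' x)) := by
    intro x hx
    refine (tendsto_integral_of_bounded (M := M) (fs := fun n t => -gs n t) hx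
      (fun n => (hgs n).neg) (fun n t ht => by simpa using hM n t ht)
      (fun t ht => (hlim t ht).neg)).congr fun n => ?_
    rw [integral_eq_sub_of_hasDerivWithinAt_Icc (h n).2.1 (hgs n).neg hx, (h n).2.2.1, sub_zero]
  have hrep : ∀ x ∈ Icc 0 L, u x = u 0 + ∫ t in (0 : ℝ)..x, u' t := by
    intro x hx
    have h1 := tendsto_integral_of_bounded hx husc (fun n => (h n).abs_deriv_le (hM n)) hlim'
    have h2 := (hu x hx).sub (hu 0 h0)
    have h3 := tendsto_nhds_unique h2 (h1.congr fun n =>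
      integral_eq_sub_of_hasDerivWithinAt_Icc (h n).1 (husc n) hx)
    linarith
  refine ⟨u', fun x hx => ?_, hu'd, by simp [hu'], ?_⟩
  · exact ((hasDerivWithinAt_integral_Icc hu'c hx).const_add (u 0)).congr hrep (hrep x hx)
  · refine tendsto_nhds_unique (hlim' L hLm) (tendsto_const_nhds.congr fun n => ?_)
    exact (h n).2.2.2.symm

/-- A bounded sequence of uniformly Lipschitz functions on `[0, L]` has a pointwise convergent
subsequence. -/
theorem exists_subseq_tendsto_of_lipschitz {L B C : ℝ} {us : ℕ → ℝ → ℝ}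
    (hB : ∀ n, ∀ x ∈ Icc 0 L, |us n x| ≤ B)
    (hC : ∀ n, ∀ x ∈ Icc 0 L, ∀ y ∈ Icc 0 L, |us n x - us n y| ≤ C * |x - y|) :
    ∃ (φ : ℕ → ℕ) (u : ℝ → ℝ), StrictMono φ ∧
      (∀ x ∈ Icc 0 L, Tendsto (fun n => us (φ n) x) atTop (𝓝 (u x))) := by
  have hlip : ∀ n, LipschitzWith C.toNNReal ((Icc 0 L).domRestrict (us n)) := fun n =>
    LipschitzWith.of_dist_le_mul fun x y => by
      rw [Real.dist_eq, Subtype.dist_eq, Real.dist_eq]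
      exact (hC n x x.2 y y.2).trans
        (mul_le_mul_of_nonneg_right (Real.le_coe_toNNReal C) (abs_nonneg _))
  let F : ℕ → BoundedContinuousFunction (Icc 0 L) ℝ := fun n =>
    BoundedContinuousFunction.mkOfCompact ⟨(Icc 0 L).domRestrict (us n), (hlip n).continuous⟩
  have hcomp : IsCompact (closure (range F)) := by
    refine BoundedContinuousFunction.arzela_ascoli (Icc (-B) B) isCompact_Icc (range F) ?_ ?_
    · rintro f x ⟨n, rfl⟩
      exact abs_le.1 (hB n x x.2)
    · refine (LipschitzWith.uniformEquicontinuous _ C.toNNReal ?_).equicontinuous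
      rintro ⟨_, n, rfl⟩
      exact hlip n
  obtain ⟨f, -, φ, hφ, hlim⟩ := hcomp.tendsto_subseq (x := F)
    (fun n => subset_closure (mem_range_self n))
  refine ⟨φ, fun x => if hx : x ∈ Icc 0 L then f ⟨x, hx⟩ else 0, hφ, fun x hx => ?_⟩
  simp only [dif_pos hx]
  exact ((BoundedContinuousFunction.lipschitz_eval_const ⟨x, hx⟩).continuous.tendsto f).comp hlim

theorem continuousOn_of_tendsto_of_lipschitz {L C : ℝ} {us : ℕ → ℝ → ℝ} {u : ℝ → ℝ}
    (hC : ∀ n, ∀ x ∈ Icc 0 L, ∀ y ∈ Icc 0 L, |us n x - us n y| ≤ C * |x - y|)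
    (hu : ∀ x ∈ Icc 0 L, Tendsto (fun n => us n x) atTop (𝓝 (u x))) :
    (∀ x ∈ Icc 0 L, ∀ y ∈ Icc 0 L, |u x - u y| ≤ C * |x - y|) ∧ ContinuousOn u (Icc 0 L) := by
  have h : ∀ x ∈ Icc 0 L, ∀ y ∈ Icc 0 L, |u x - u y| ≤ C * |x - y| := fun x hx y hy =>
    le_of_tendsto' ((hu x hx).sub (hu y hy)).abs fun n => hC n x hx y hy
  refine ⟨h, (LipschitzOnWith.of_dist_le_mul (K := C.toNNReal) fun x hx y hy => ?_).continuousOn⟩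
  rw [Real.dist_eq, Real.dist_eq]
  exact (h x hx y hy).trans (mul_le_mul_of_nonneg_right (Real.le_coe_toNNReal C) (abs_nonneg _))

/-- Monotone iteration from a supersolution `V`, above a subsolution `ψ` supported in `[c, d]`. -/
theorem exists_solution_between {L k c d : ℝ} {f : ℝ → ℝ → ℝ} {g V V' ψ ψ' ψ'' : ℝ → ℝ}
    (hL : 0 < L) (hk : 0 < k) (hf : ContinuousOn (Function.uncurry f) (Icc 0 L ×ˢ univ))
    (hmono : ∀ x ∈ Icc 0 L, ∀ s t, 0 ≤ s → s ≤ t → f x s + k ^ 2 * s ≤ f x t + k ^ 2 * t)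
    (hf0 : ∀ x ∈ Icc 0 L, f x 0 = 0)
    (hV : SolvesNeumann L g V V') (hVg : ∀ x ∈ Icc 0 L, f x (V x) ≤ g x)
    (hV0 : ∀ x ∈ Icc 0 L, 0 ≤ V x)
    (hcd : c < d) (hsub : Icc c d ⊆ Icc 0 L)
    (hψ : ∀ t ∈ Icc c d, HasDerivWithinAt ψ (ψ' t) (Icc c d) t)
    (hψ' : ∀ t ∈ Icc c d, HasDerivWithinAt ψ' (ψ'' t) (Icc c d) t)
    (hψf : ∀ t ∈ Icc c d, -ψ'' t ≤ f t (ψ t)) (hψc : ψ c = 0) (hψd : ψ d = 0)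
    (hψ0 : ∀ t ∈ Icc c d, 0 ≤ ψ t) (hψV : ∀ t ∈ Icc c d, ψ t ≤ V t) :
    ∃ u u', SolvesNeumann L (fun x => f x (u x)) u u' ∧
      (∀ x ∈ Icc 0 L, 0 ≤ u x ∧ u x ≤ V x) ∧ ∀ t ∈ Icc c d, ψ t ≤ u t := by
  have hK : 0 < k ^ 2 := by positivity
  have hfu : ∀ u : ℝ → ℝ, ContinuousOn u (Icc 0 L) →
      ContinuousOn (fun x => f x (u x)) (Icc 0 L) := fun u hu =>
    hf.comp (f := fun x => (x, u x)) (continuousOn_id.prodMk hu) fun x hx => ⟨hx, mem_univ _⟩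
  have hgu : ∀ u : ℝ → ℝ, ContinuousOn u (Icc 0 L) →
      ContinuousOn (fun x => f x (u x) + k ^ 2 * u x) (Icc 0 L) := fun u hu =>
    (hfu u hu).add (continuousOn_const.mul hu)
  have hsol : ∀ u : ℝ → ℝ, ContinuousOn u (Icc 0 L) → ∃ w w' : ℝ → ℝ,
      SolvesNeumann L (fun x => f x (u x) + k ^ 2 * u x - k ^ 2 * w x) w w' := fun u hu =>
    exists_solvesNeumann hL hk (hgu u hu)
  choose! T T' hT using hsol
  have hTmono : ∀ u v, ContinuousOn u (Icc 0 L) → ContinuousOn v (Icc 0 L) →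
      (∀ x ∈ Icc 0 L, 0 ≤ u x ∧ u x ≤ v x) → ∀ x ∈ Icc 0 L, T u x ≤ T v x := by
    intro u v hu hv huv
    refine (hT u hu).le hL hK (hT v hv) fun x hx => ?_
    have := hmono x hx _ _ (huv x hx).1 (huv x hx).2
    linarith
  have hzero : SolvesNeumann L (fun _ => 0) (fun _ => 0) (fun _ => 0) :=
    ⟨fun x _ => hasDerivWithinAt_const _ _ _, fun x _ => by simpa using hasDerivWithinAt_const _ _ _,
      rfl, rfl⟩
  have hTnonneg : ∀ u, ContinuousOn u (Icc 0 L) → (∀ x ∈ Icc 0 L, 0 ≤ u x) →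
      ∀ x ∈ Icc 0 L, 0 ≤ T u x := by
    intro u hu hu0
    refine hzero.le hL hK (hT u hu) fun x hx => ?_
    have := hmono x hx 0 _ le_rfl (hu0 x hx)
    rw [hf0 x hx] at this
    linarith
  have hTψ : ∀ u, ContinuousOn u (Icc 0 L) → (∀ t ∈ Icc c d, ψ t ≤ u t) →
      (∀ x ∈ Icc 0 L, 0 ≤ u x) → ∀ t ∈ Icc c d, ψ t ≤ T u t := by
    intro u hu hψu hu0 t ht
    have hw0 := hTnonneg u hu hu0
    refine sub_nonpos.1 (nonpos_of_mul_le_second_deriv (φ := fun x => ψ x - T u x)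
      (φ' := fun x => ψ' x - T' u x)
      (φ'' := fun x => ψ'' x - -(f x (u x) + k ^ 2 * u x - k ^ 2 * T u x)) hcd hK
      (fun s hs => (hψ s hs).sub (((hT u hu).1 s (hsub hs)).mono hsub))
      (fun s hs => (hψ' s hs).sub (((hT u hu).2.1 s (hsub hs)).mono hsub))
      (Or.inr ?_) (Or.inr ?_) (fun s hs => ?_) t ht)
    · have := hw0 c (hsub (left_mem_Icc.2 hcd.le))
      simp only [hψc]
      linarith
    · have := hw0 d (hsub (right_mem_Icc.2 hcd.le))
      simp only [hψd]
      linarith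
    · have h1 := hmono s (hsub hs) _ _ (hψ0 s hs) (hψu s hs)
      have h2 := hψf s hs
      linarith
  have hVc := hV.continuousOn
  set us : ℕ → ℝ → ℝ := fun n => T^[n] V with hus
  have hsucc : ∀ n, us (n + 1) = T (us n) := fun n => Function.iterate_succ_apply' T n V
  have hcont : ∀ n, ContinuousOn (us n) (Icc 0 L) := by
    intro n
    induction n with
    | zero => exact hVc
    | succ n ih => rw [hsucc]; exact (hT _ ih).continuousOn
  have hnn : ∀ n, ∀ x ∈ Icc 0 L, 0 ≤ us n x := by
    intro n
    induction n with
    | zero => exact hV0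
    | succ n ih => rw [hsucc]; exact hTnonneg _ (hcont n) ih
  have hψn : ∀ n, ∀ t ∈ Icc c d, ψ t ≤ us n t := by
    intro n
    induction n with
    | zero => exact hψV
    | succ n ih => rw [hsucc]; exact hTψ _ (hcont n) ih (hnn n)
  have hanti : ∀ n, ∀ x ∈ Icc 0 L, us (n + 1) x ≤ us n x := by
    intro n
    induction n with
    | zero =>
      refine (hT V hVc).le hL hK hV fun x hx => ?_
      have := hVg x hx
      change f x (V x) + k ^ 2 * V x - k ^ 2 * T V x + k ^ 2 * T V x ≤ g x + k ^ 2 * V x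
      linarith
    | succ n ih =>
      rw [hsucc (n + 1), hsucc n]
      refine hTmono _ _ (hsucc n ▸ hcont (n + 1)) (hcont n) fun x hx => ⟨?_, ?_⟩
      · rw [← hsucc]; exact hnn _ x hx
      · rw [← hsucc]; exact ih x hx
  have hA : ∀ x ∈ Icc 0 L, Antitone fun n => us n x := fun x hx =>
    antitone_nat_of_succ_le fun n => hanti n x hx
  have hleV : ∀ n, ∀ x ∈ Icc 0 L, us n x ≤ V x := fun n x hx => hA x hx (Nat.zero_le n)
  have hlim : ∀ x ∈ Icc 0 L, Tendsto (fun n => us n x) atTop (𝓝 (⨅ n, us n x)) := fun x hx =>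
    tendsto_atTop_ciInf (hA x hx) ⟨0, by rintro _ ⟨n, rfl⟩; exact hnn n x hx⟩
  set u : ℝ → ℝ := fun x => ⨅ n, us n x with hu
  obtain ⟨B, hB⟩ := isCompact_Icc.exists_bound_of_continuousOn (hgu V hVc)
  set gs : ℕ → ℝ → ℝ := fun n x => f x (us n x) + k ^ 2 * us n x - k ^ 2 * us (n + 1) x with hgs
  have hsolves : ∀ n, SolvesNeumann L (gs n) (us (n + 1)) (T' (us n)) := fun n => by
    have := hT _ (hcont n)
    rw [← hsucc] at this
    exact this
  have hgsc : ∀ n, ContinuousOn (gs n) (Icc 0 L) := fun n =>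
    (hgu _ (hcont n)).sub (continuousOn_const.mul (hcont (n + 1)))
  obtain ⟨B', hB'⟩ := isCompact_Icc.exists_bound_of_continuousOn hVc
  have hgsB : ∀ n, ∀ x ∈ Icc 0 L, |gs n x| ≤ B + k ^ 2 * B' := by
    intro n x hx
    have h1 := hmono x hx _ _ (hnn n x hx) (hleV n x hx)
    have h2 := hmono x hx 0 _ le_rfl (hnn n x hx)
    rw [hf0 x hx] at h2
    have h3 := (le_abs_self _).trans (hB x hx)
    have h4 := (le_abs_self _).trans (hB' x hx)
    have h5 := mul_le_mul_of_nonneg_left ((hleV (n + 1) x hx).trans h4) hK.le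
    have h6 := mul_nonneg hK.le (hnn (n + 1) x hx)
    rw [abs_le]
    simp only [hgs]
    constructor <;> linarith
  have hlim1 : ∀ x ∈ Icc 0 L, Tendsto (fun n => us (n + 1) x) atTop (𝓝 (u x)) := fun x hx =>
    (tendsto_add_atTop_iff_nat 1).2 (hlim x hx)
  have huc : ContinuousOn u (Icc 0 L) :=
    (continuousOn_of_tendsto_of_lipschitz (fun n => (hsolves n).abs_sub_le (hgsB n)) hlim1).2
  have hgslim : ∀ x ∈ Icc 0 L, Tendsto (fun n => gs n x) atTop (𝓝 (f x (u x))) := by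
    intro x hx
    have hfx : Continuous (f x) :=
      hf.comp_continuous (f := fun s => (x, s)) (by fun_prop) fun s => ⟨hx, mem_univ _⟩
    have h1 := (((hfx.tendsto _).comp (hlim x hx)).add ((hlim x hx).const_mul (k ^ 2))).sub
      ((hlim1 x hx).const_mul (k ^ 2))
    rw [show f x (u x) = f x (u x) + k ^ 2 * u x - k ^ 2 * u x by ring]
    exact h1
  obtain ⟨u', hu'⟩ := SolvesNeumann.of_tendsto hL hsolves hgsc hgsB (hfu u huc) hgslim hlim1
  exact ⟨u, u', hu', fun x hx => ⟨ge_of_tendsto' (hlim x hx) fun n => hnn n x hx,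
    le_of_tendsto' (hlim x hx) fun n => hleV n x hx⟩,
    fun t ht => ge_of_tendsto' (hlim t (hsub ht)) fun n => hψn n t ht⟩

/-- A regularization of `a(x) s^q`: it vanishes at `s = 0`, the positive part is monotone and the
negative part is Lipschitz in `s`. -/
noncomputable def regularized (a : ℝ → ℝ) (q e δ ρ x s : ℝ) : ℝ :=
  max (a x) 0 * ((1 - e) * max (s - δ) 0 ^ q) - max (-a x) 0 * (s * max s ρ ^ (q - 1))

theorem continuousOn_regularized {L q e δ ρ : ℝ} {a : ℝ → ℝ} (hq : 0 < q) (hρ : 0 < ρ)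
    (ha : ContinuousOn a (Icc 0 L)) :
    ContinuousOn (Function.uncurry (regularized a q e δ ρ)) (Icc 0 L ×ˢ univ) := by
  have h1 : ContinuousOn (fun z : ℝ × ℝ => a z.1) (Icc 0 L ×ˢ univ) :=
    ha.comp continuousOn_fst fun z hz => hz.1
  have h2 : Continuous fun z : ℝ × ℝ => max (z.2 - δ) 0 ^ q :=
    Continuous.rpow_const (by fun_prop) fun _ => Or.inr hq.le
  have h3 : Continuous fun z : ℝ × ℝ => z.2 * max z.2 ρ ^ (q - 1) :=
    continuous_snd.mul (Continuous.rpow_const (by fun_prop) fun z =>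
      Or.inl (hρ.trans_le (le_max_right _ _)).ne')
  exact ((h1.sup continuousOn_const).mul (continuous_const.mul h2).continuousOn).sub
    ((h1.neg.sup continuousOn_const).mul h3.continuousOn)

theorem regularized_zero {a : ℝ → ℝ} {q e δ ρ x : ℝ} (hq : 0 < q) (hδ : 0 ≤ δ) :
    regularized a q e δ ρ x 0 = 0 := by
  simp [regularized, hδ, Real.zero_rpow hq.ne']

theorem regularized_add_mul_mono {a : ℝ → ℝ} {q e δ ρ x s t K : ℝ} (hq : 0 < q) (hq1 : q < 1)
    (he : e ≤ 1) (hρ : 0 < ρ) (hK : |a x| * ρ ^ (q - 1) ≤ K) (hs : 0 ≤ s) (hst : s ≤ t) :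
    regularized a q e δ ρ x s + K * s ≤ regularized a q e δ ρ x t + K * t := by
  have h1 : max (s - δ) 0 ^ q ≤ max (t - δ) 0 ^ q :=
    Real.rpow_le_rpow (le_max_right _ _) (max_le_max (by linarith) le_rfl) hq.le
  have h2 : max t ρ ^ (q - 1) ≤ max s ρ ^ (q - 1) :=
    Real.rpow_le_rpow_of_nonpos (hρ.trans_le (le_max_right _ _)) (max_le_max hst le_rfl)
      (by linarith)
  have h3 : max s ρ ^ (q - 1) ≤ ρ ^ (q - 1) :=
    Real.rpow_le_rpow_of_nonpos hρ (le_max_right _ _) (by linarith)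
  have h4 : t * max t ρ ^ (q - 1) - s * max s ρ ^ (q - 1) ≤ ρ ^ (q - 1) * (t - s) := by
    nlinarith [mul_le_mul_of_nonneg_left h2 (hs.trans hst),
      mul_le_mul_of_nonneg_right h3 (sub_nonneg.2 hst)]
  have h5 : max (-a x) 0 * (t * max t ρ ^ (q - 1) - s * max s ρ ^ (q - 1)) ≤ K * (t - s) := by
    have h6 : max (-a x) 0 ≤ |a x| := max_le (neg_le_abs _) (abs_nonneg _)
    have h7 : 0 ≤ ρ ^ (q - 1) * (t - s) :=
      mul_nonneg (Real.rpow_nonneg hρ.le _) (sub_nonneg.2 hst)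
    calc _ ≤ max (-a x) 0 * (ρ ^ (q - 1) * (t - s)) :=
          mul_le_mul_of_nonneg_left h4 (le_max_right _ _)
      _ ≤ |a x| * (ρ ^ (q - 1) * (t - s)) := mul_le_mul_of_nonneg_right h6 h7
      _ = |a x| * ρ ^ (q - 1) * (t - s) := by ring
      _ ≤ K * (t - s) := mul_le_mul_of_nonneg_right hK (sub_nonneg.2 hst)
  have h8 : max (a x) 0 * ((1 - e) * max (s - δ) 0 ^ q) ≤
      max (a x) 0 * ((1 - e) * max (t - δ) 0 ^ q) :=
    mul_le_mul_of_nonneg_left (mul_le_mul_of_nonneg_left h1 (by linarith)) (le_max_right _ _)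
  simp only [regularized]
  linarith

theorem mul_max_rpow_le {q ρ s : ℝ} (hq : 0 < q) (hq1 : q < 1) (hs : 0 ≤ s) :
    s * max s ρ ^ (q - 1) ≤ s ^ q := by
  rcases hs.eq_or_lt with rfl | hs
  · simp [Real.zero_rpow hq.ne']
  calc s * max s ρ ^ (q - 1) ≤ s * s ^ (q - 1) :=
        mul_le_mul_of_nonneg_left
          (Real.rpow_le_rpow_of_nonpos hs (le_max_left _ _) (by linarith)) hs.le
    _ = s ^ q := by rw [Real.rpow_sub_one hs.ne']; field_simp

theorem abs_regularized_le {a : ℝ → ℝ} {q e δ ρ x s : ℝ} (hq : 0 < q) (hq1 : q < 1)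
    (he0 : 0 ≤ e) (he : e ≤ 1) (hδ : 0 ≤ δ) (hs : 0 ≤ s) :
    |regularized a q e δ ρ x s| ≤ |a x| * s ^ q := by
  have hsq : 0 ≤ s ^ q := Real.rpow_nonneg hs _
  have h1 : max (s - δ) 0 ^ q ≤ s ^ q :=
    Real.rpow_le_rpow (le_max_right _ _) (max_le (by linarith) hs) hq.le
  have h1' : 0 ≤ max (s - δ) 0 ^ q := Real.rpow_nonneg (le_max_right _ _) _
  have h2 : (1 - e) * max (s - δ) 0 ^ q ≤ s ^ q := by nlinarith
  have h2' : 0 ≤ (1 - e) * max (s - δ) 0 ^ q := mul_nonneg (by linarith) h1'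
  have h3 := mul_max_rpow_le (ρ := ρ) hq hq1 hs
  have h3' : 0 ≤ s * max s ρ ^ (q - 1) :=
    mul_nonneg hs (Real.rpow_nonneg (hs.trans (le_max_left _ _)) _)
  rw [abs_le]
  simp only [regularized]
  rcases le_total 0 (a x) with h | h
  · rw [max_eq_left h, max_eq_right (by linarith : -a x ≤ 0), abs_of_nonneg h]
    constructor <;> nlinarith [mul_le_mul_of_nonneg_left h2 h, mul_nonneg h h2', mul_nonneg h hsq]
  · rw [max_eq_right h, max_eq_left (by linarith : 0 ≤ -a x), abs_of_nonpos h]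
    have h' : 0 ≤ -a x := by linarith
    constructor <;>
      nlinarith [mul_le_mul_of_nonneg_left h3 h', mul_nonneg h' h3', mul_nonneg h' hsq]

theorem tendsto_regularized {a : ℝ → ℝ} {q x s : ℝ} {es δs ρs ss : ℕ → ℝ} (hq : 0 < q)
    (hq1 : q < 1) (he : Tendsto es atTop (𝓝 0)) (hδ : Tendsto δs atTop (𝓝 0))
    (hρ : Tendsto ρs atTop (𝓝 0)) (hss : ∀ n, 0 ≤ ss n) (hs : Tendsto ss atTop (𝓝 s)) :
    Tendsto (fun n => regularized a q (es n) (δs n) (ρs n) x (ss n)) atTop (𝓝 (a x * s ^ q)) := by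
  have hs0 : 0 ≤ s := ge_of_tendsto' hs hss
  have h1 : Tendsto (fun n => (1 - es n) * max (ss n - δs n) 0 ^ q) atTop (𝓝 (s ^ q)) := by
    have h := (he.const_sub 1).mul
      (((hs.sub hδ).max (tendsto_const_nhds (x := (0 : ℝ)))).rpow_const (Or.inr hq.le))
    simpa [max_eq_left hs0] using h
  have h2 : Tendsto (fun n => ss n * max (ss n) (ρs n) ^ (q - 1)) atTop (𝓝 (s ^ q)) := by
    rcases hs0.eq_or_lt with rfl | hpos
    · have h3 := hs.rpow_const (p := q) (Or.inr hq.le)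
      refine tendsto_of_tendsto_of_tendsto_of_le_of_le (g := fun _ => (0 : ℝ)) ?_ h3
        (fun n => ?_) (fun n => mul_max_rpow_le hq hq1 (hss n))
      · simp [Real.zero_rpow hq.ne']
      · exact mul_nonneg (hss n) (Real.rpow_nonneg ((hss n).trans (le_max_left _ _)) _)
    · have hm : max s 0 = s := max_eq_left hs0
      have h := hs.mul ((hs.max hρ).rpow_const (p := q - 1) (Or.inl (by rw [hm]; exact hpos.ne')))
      rw [hm, Real.rpow_sub_one hpos.ne', mul_div_cancel₀ _ hpos.ne'] at h
      exact h
  have h := (h1.const_mul (max (a x) 0)).sub (h2.const_mul (max (-a x) 0))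
  have hax : max (a x) 0 - max (-a x) 0 = a x := by
    rcases le_total 0 (a x) with h | h
    · rw [max_eq_left h, max_eq_right (by linarith : -a x ≤ 0)]; ring
    · rw [max_eq_right h, max_eq_left (by linarith : 0 ≤ -a x)]; ring
  rw [← sub_mul, hax] at h
  exact h

/-- The pointwise inequality which makes `c (u + e²)^γ` a supersolution of the regularized
problem with exponent `q` if `u` solves the problem with exponent `p`. -/
theorem regularized_le_of_rpow {a : ℝ → ℝ} {q p γ c e u x : ℝ} (hq : 0 < q) (hp : 0 < p)
    (hp1 : p < 1) (hγ : 0 < γ) (hγq : γ * q = γ - 1 + p) (hc : 0 < c) (hcγ : c ^ q = c * γ)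
    (he : 0 < e) (he1 : e < 1) (hu : 0 ≤ u) :
    regularized a q e (c * e ^ γ) (c * (e ^ 2) ^ γ) x (c * (u + e ^ 2) ^ γ) ≤
      c * γ * (u + e ^ 2) ^ (γ - 1) * (a x * u ^ p) := by
  set y := u + e ^ 2 with hy
  have he2 : 0 < e ^ 2 := by positivity
  have hypos : 0 < y := by positivity
  have hVq : (c * y ^ γ) ^ q = c * γ * y ^ (γ - 1) * y ^ p := by
    rw [Real.mul_rpow hc.le (by positivity), hcγ, ← Real.rpow_mul hypos.le, hγq,
      Real.rpow_add hypos]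
    ring
  have hcy : 0 < c * γ * y ^ (γ - 1) := by positivity
  have hup : 0 ≤ u ^ p := Real.rpow_nonneg hu _
  simp only [regularized]
  rcases le_total 0 (a x) with h | h
  · rw [max_eq_left h, max_eq_right (by linarith : -a x ≤ 0), zero_mul, sub_zero,
      mul_left_comm (c * γ * y ^ (γ - 1))]
    refine mul_le_mul_of_nonneg_left ?_ h
    rcases le_or_gt (c * y ^ γ) (c * e ^ γ) with h1 | h1
    · rw [max_eq_right (by linarith), Real.zero_rpow hq.ne', mul_zero]
      positivity
    · have hey : e < y :=
        (Real.rpow_lt_rpow_iff he.le hypos.le hγ).1 (lt_of_mul_lt_mul_left h1 hc.le)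
      have huy : (1 - e) * y ≤ u := by nlinarith
      have h2 : (1 - e) * y ^ p ≤ u ^ p := by
        calc (1 - e) * y ^ p ≤ (1 - e) ^ p * y ^ p := by
              refine mul_le_mul_of_nonneg_right ?_ (by positivity)
              simpa using Real.rpow_le_rpow_of_exponent_ge (x := 1 - e) (by linarith)
                (by linarith) hp1.le
          _ = ((1 - e) * y) ^ p := (Real.mul_rpow (by linarith) hypos.le).symm
          _ ≤ u ^ p := Real.rpow_le_rpow (mul_nonneg (by linarith) hypos.le) huy hp.le
      have h3 : max (c * y ^ γ - c * e ^ γ) 0 ^ q ≤ (c * y ^ γ) ^ q := by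
        refine Real.rpow_le_rpow (le_max_right _ _) (max_le ?_ (by positivity)) hq.le
        have : 0 < c * e ^ γ := by positivity
        linarith
      calc (1 - e) * max (c * y ^ γ - c * e ^ γ) 0 ^ q ≤ (1 - e) * (c * y ^ γ) ^ q :=
            mul_le_mul_of_nonneg_left h3 (by linarith)
        _ = c * γ * y ^ (γ - 1) * ((1 - e) * y ^ p) := by rw [hVq]; ring
        _ ≤ _ := mul_le_mul_of_nonneg_left h2 hcy.le
  · have hVpos : 0 < c * y ^ γ := by positivity
    have hmax : max (c * y ^ γ) (c * (e ^ 2) ^ γ) = c * y ^ γ := by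
      refine max_eq_left (mul_le_mul_of_nonneg_left ?_ hc.le)
      exact Real.rpow_le_rpow he2.le (by linarith) hγ.le
    rw [max_eq_right h, max_eq_left (by linarith : 0 ≤ -a x), zero_mul, zero_sub, hmax,
      Real.rpow_sub_one hVpos.ne', mul_div_cancel₀ _ hVpos.ne', hVq]
    have h1 : u ^ p ≤ y ^ p := Real.rpow_le_rpow hu (by linarith) hp.le
    have h2 := mul_le_mul_of_nonneg_left (mul_le_mul_of_nonneg_left h1 hcy.le)
      (by linarith : 0 ≤ -a x)
    linarith

/-- A function with nonnegative derivative on a subinterval of `[0, L]` is monotone there. -/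
theorem monotoneOn_Icc_of_deriv_nonneg {L c d : ℝ} {f f' : ℝ → ℝ} (hsub : Icc c d ⊆ Icc 0 L)
    (h : ∀ x ∈ Icc 0 L, HasDerivWithinAt f (f' x) (Icc 0 L) x)
    (h0 : ∀ x ∈ Ioo c d, 0 ≤ f' x) : MonotoneOn f (Icc c d) := by
  refine monotoneOn_of_hasDerivWithinAt_nonneg (f' := f') (convex_Icc c d)
    (fun x hx => ((h x (hsub hx)).continuousWithinAt).mono hsub) (fun x hx => ?_) fun x hx => ?_
  · exact (h x (hsub (interior_subset hx))).mono (interior_subset.trans hsub)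
  · exact h0 x (by rwa [interior_Icc] at hx)

/-- A function with nonpositive derivative on a subinterval of `[0, L]` is antitone there. -/
theorem antitoneOn_Icc_of_deriv_nonpos {L c d : ℝ} {f f' : ℝ → ℝ} (hsub : Icc c d ⊆ Icc 0 L)
    (h : ∀ x ∈ Icc 0 L, HasDerivWithinAt f (f' x) (Icc 0 L) x)
    (h0 : ∀ x ∈ Ioo c d, f' x ≤ 0) : AntitoneOn f (Icc c d) := by
  have := monotoneOn_Icc_of_deriv_nonneg (f := fun x => -f x) (f' := fun x => -f' x) hsub
    (fun x hx => (h x hx).neg) fun x hx => neg_nonneg.2 (h0 x hx)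
  exact fun x hx y hy hxy => neg_le_neg_iff.1 (this hx hy hxy)

/-- The derivative of a nonnegative solution vanishes at its zeros, endpoints included. -/
theorem SolvesNeumann.deriv_eq_zero {L x : ℝ} {g u u' : ℝ → ℝ} (h : SolvesNeumann L g u u')
    (hu : ∀ x ∈ Icc 0 L, 0 ≤ u x) (hx : x ∈ Icc 0 L) (hux : u x = 0) : u' x = 0 := by
  rcases hx.1.eq_or_lt with rfl | h0
  · exact h.2.2.1
  rcases hx.2.eq_or_lt with rfl | hL
  · exact h.2.2.2
  refine neg_eq_zero.1 (deriv_eq_zero_of_isMaxOn (f := fun x => -u x) (f' := fun x => -u' x)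
    ⟨h0, hL⟩ (h.1 x hx).neg fun y hy => ?_)
  simpa [hux] using hu y hy

/-- Positivity of a nonnegative solution propagates along intervals where it is concave. -/
theorem SolvesNeumann.pos_of_pos {L x y : ℝ} {g u u' : ℝ → ℝ} (h : SolvesNeumann L g u u')
    (hu : ∀ x ∈ Icc 0 L, 0 ≤ u x) (hx : x ∈ Icc 0 L) (hy : y ∈ Icc 0 L) (hux : 0 < u x)
    (hg : ∀ t ∈ uIcc y x, 0 ≤ g t) : 0 < u y := by
  refine (hu y hy).lt_of_ne' fun huy => ?_
  have huy' := h.deriv_eq_zero hu hy huy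
  rcases le_total y x with hyx | hyx
  · rw [uIcc_of_le hyx] at hg
    have hsub : Icc y x ⊆ Icc 0 L := Icc_subset_Icc hy.1 hx.2
    have h1 := antitoneOn_Icc_of_deriv_nonpos hsub h.2.1
      fun t ht => neg_nonpos.2 (hg t (Ioo_subset_Icc_self ht))
    have h2 := antitoneOn_Icc_of_deriv_nonpos hsub h.1 fun t ht => by
      rw [← huy']
      exact h1 (left_mem_Icc.2 hyx) (Ioo_subset_Icc_self ht) ht.1.le
    have := h2 (left_mem_Icc.2 hyx) (right_mem_Icc.2 hyx) hyx
    linarith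
  · rw [uIcc_of_ge hyx] at hg
    have hsub : Icc x y ⊆ Icc 0 L := Icc_subset_Icc hx.1 hy.2
    have h1 := antitoneOn_Icc_of_deriv_nonpos hsub h.2.1
      fun t ht => neg_nonpos.2 (hg t (Ioo_subset_Icc_self ht))
    have h2 := monotoneOn_Icc_of_deriv_nonneg hsub h.1 fun t ht => by
      rw [← huy']
      exact h1 (Ioo_subset_Icc_self ht) (right_mem_Icc.2 hyx) ht.2.le
    have := h2 (left_mem_Icc.2 hyx) (right_mem_Icc.2 hyx) hyx
    linarith

/-- If a continuous function is positive somewhere on `[0, L]`, it is so in the interior. -/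
theorem exists_mem_Ioo_pos {L : ℝ} {a : ℝ → ℝ} (hL : 0 < L) (ha : ContinuousOn a (Icc 0 L))
    (hpos : ∃ x ∈ Icc 0 L, 0 < a x) : ∃ x ∈ Ioo 0 L, 0 < a x := by
  by_contra! hcon
  obtain ⟨x, hx, hax⟩ := hpos
  have hcl : closure (Ioo 0 L) = Icc 0 L := closure_Ioo hL.ne
  have := le_on_closure (f := a) (g := fun _ => 0) hcon (by rwa [hcl]) continuousOn_const
    (by rwa [hcl] : x ∈ closure (Ioo 0 L))
  exact absurd hax (not_lt.2 this)

/-- A nontrivial nonnegative solution is positive somewhere on the positivity set of `a`. -/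
theorem SolvesNeumann.exists_pos_pos {L q : ℝ} {a u u' : ℝ → ℝ}
    (h : SolvesNeumann L (fun x => a x * u x ^ q) u u') (hu : ∀ x ∈ Icc 0 L, 0 ≤ u x)
    (hq : 0 < q) (hne : ∃ x ∈ Icc 0 L, u x ≠ 0) (hpos : ∃ x ∈ Ioo 0 L, 0 < a x) :
    ∃ x ∈ Ioo 0 L, 0 < u x ∧ 0 < a x := by
  by_contra! hcon
  obtain ⟨x, hx, hax⟩ := hpos
  obtain ⟨y, hy, huy⟩ := hne
  have hL : 0 ≤ L := hy.1.trans hy.2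
  have hmono := monotoneOn_Icc_of_deriv_nonneg Subset.rfl h.2.1 fun t ht => by
    have hut := hu t (Ioo_subset_Icc_self ht)
    rcases hut.eq_or_lt with h0 | h0
    · simp [← h0, Real.zero_rpow hq.ne']
    · have := mul_nonneg (neg_nonneg.2 (hcon t ht h0)) (Real.rpow_nonneg hut q)
      linarith
  have hu'0 : ∀ t ∈ Icc 0 L, u' t = 0 := fun t ht => le_antisymm
    ((hmono ht (right_mem_Icc.2 hL) ht.2).trans_eq h.2.2.2)
    (h.2.2.1.symm.trans_le (hmono (left_mem_Icc.2 hL) ht ht.1))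
  have h1 := monotoneOn_Icc_of_deriv_nonneg Subset.rfl h.1
    fun t ht => (hu'0 t (Ioo_subset_Icc_self ht)).ge
  have h2 := antitoneOn_Icc_of_deriv_nonpos Subset.rfl h.1
    fun t ht => (hu'0 t (Ioo_subset_Icc_self ht)).le
  have hconst : ∀ t ∈ Icc 0 L, u t = u 0 := fun t ht => le_antisymm
    (h2 (left_mem_Icc.2 hL) ht ht.1) (h1 (left_mem_Icc.2 hL) ht ht.1)
  have hxI := Ioo_subset_Icc_self hx
  have hux : 0 < u x := (hu x hxI).lt_of_ne' (by rwa [hconst x hxI, ← hconst y hy])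
  exact absurd hax (not_lt.2 (hcon x hx hux))

/-- Around an interior point where a continuous function is positive, it stays bounded below. -/
theorem exists_Icc_half_le {L p : ℝ} {f : ℝ → ℝ} (hf : ContinuousOn f (Icc 0 L))
    (hp : p ∈ Ioo 0 L) (hfp : 0 < f p) :
    ∃ ε > 0, Icc (p - ε) (p + ε) ⊆ Ioo 0 L ∧ ∀ t ∈ Icc (p - ε) (p + ε), f p / 2 ≤ f t := by
  have h1 : ∀ᶠ t in 𝓝 p, f p / 2 < f t :=
    (hf.continuousAt (Icc_mem_nhds hp.1 hp.2)).eventually (lt_mem_nhds (by linarith))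
  obtain ⟨ε, hε, hball⟩ := Metric.nhds_basis_closedBall.eventually_iff.1
    (h1.and (Ioo_mem_nhds hp.1 hp.2))
  rw [Real.closedBall_eq_Icc] at hball
  exact ⟨ε, hε, fun t ht => (hball ht).2, fun t ht => (hball ht).1.le⟩

/-- Comparison with the first Dirichlet eigenfunction on an interval where `a` is positive. -/
theorem SolvesNeumann.exists_le_rpow_of_pos_on {L q a₀ c d : ℝ} {a u u' : ℝ → ℝ}
    (h : SolvesNeumann L (fun x => a x * u x ^ q) u u') (hcd : c < d)
    (hsub : Icc c d ⊆ Icc 0 L) (ha : ∀ t ∈ Icc c d, a₀ ≤ a t) (hu : ∀ t ∈ Icc c d, 0 < u t) :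
    ∃ x ∈ Icc c d, a₀ / (π / (d - c)) ^ 2 ≤ u x ^ (1 - q) := by
  set κ := π / (d - c) with hκ
  have hdc : 0 < d - c := sub_pos.2 hcd
  have hκ0 : 0 < κ := div_pos Real.pi_pos hdc
  have hucont : ContinuousOn u (Icc c d) := h.continuousOn.mono hsub
  obtain ⟨x, hx, hmax⟩ := isCompact_Icc.exists_isMaxOn (f := fun t => sin (κ * (t - c)) / u t)
    ⟨c, left_mem_Icc.2 hcd.le⟩
    ((by fun_prop : Continuous fun t => sin (κ * (t - c))).continuousOn.div hucont
      fun t ht => (hu t ht).ne')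
  refine ⟨x, hx, ?_⟩
  set τ := sin (κ * (x - c)) / u x with hτ
  have hmid : (c + d) / 2 ∈ Icc c d := ⟨by linarith, by linarith⟩
  have hτ0 : 0 < τ := by
    refine lt_of_lt_of_le ?_ (hmax hmid)
    have : κ * ((c + d) / 2 - c) = π / 2 := by rw [hκ]; field_simp; ring
    simp only [this, Real.sin_pi_div_two]
    exact one_div_pos.2 (hu _ hmid)
  have hsin : sin (κ * (x - c)) = τ * u x := by rw [hτ, div_mul_cancel₀ _ (hu x hx).ne']
  have hxc : c < x := by
    refine hx.1.lt_of_ne fun he => hτ0.ne' ?_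
    rw [hτ, ← he]; simp
  have hxd : x < d := by
    refine hx.2.lt_of_ne fun he => hτ0.ne' ?_
    have : κ * (d - c) = π := by rw [hκ]; field_simp
    rw [hτ, he, this]; simp
  have hin : ∀ t : ℝ, HasDerivAt (fun t => κ * (t - c)) κ t := fun t => by
    simpa using ((hasDerivAt_id t).sub_const c).const_mul κ
  have hd1 : ∀ t ∈ Icc c d, HasDerivWithinAt (fun t => sin (κ * (t - c)) - τ * u t)
      (cos (κ * (t - c)) * κ - τ * u' t) (Icc c d) t := fun t ht =>
    (hin t).sin.hasDerivWithinAt.sub (((h.1 t (hsub ht)).mono hsub).const_mul τ)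
  have hd2 : ∀ t ∈ Icc c d, HasDerivWithinAt (fun t => cos (κ * (t - c)) * κ - τ * u' t)
      (-sin (κ * (t - c)) * κ * κ - τ * -(a t * u t ^ q)) (Icc c d) t := fun t ht =>
    ((hin t).cos.mul_const κ).hasDerivWithinAt.sub (((h.2.1 t (hsub ht)).mono hsub).const_mul τ)
  have hmax' : IsMaxOn (fun t => sin (κ * (t - c)) - τ * u t) (Icc c d) x := by
    intro t ht
    have := (div_le_iff₀ (hu t ht)).1 (hmax ht)
    simp only [mem_ofPred_eq, hsin, sub_self]
    linarith
  have h1 := deriv_eq_zero_of_isMaxOn (f' := fun t => cos (κ * (t - c)) * κ - τ * u' t)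
    ⟨hxc, hxd⟩ (hd1 x hx) hmax'
  have h2 := second_deriv_nonpos_of_isMaxOn hcd hx hd1 h1 (hd2 x hx) hmax'
  rw [hsin] at h2
  have hux := hu x hx
  have h3 : a x * u x ^ q ≤ κ ^ 2 * u x := by
    refine le_of_mul_le_mul_left ?_ hτ0
    nlinarith
  have huq : 0 < u x ^ q := Real.rpow_pos_of_pos hux q
  rw [Real.rpow_sub hux, Real.rpow_one, div_le_div_iff₀ (by positivity) huq]
  nlinarith [mul_le_mul_of_nonneg_right (ha x hx) huq.le]

/-- If the positivity set of `a` has finitely many components, nontrivial solutions are bounded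
below somewhere, uniformly in `q` in the appropriate sense. -/
theorem exists_le_rpow_of_nontrivial {L : ℝ} {a : ℝ → ℝ} (hL : 0 < L)
    (ha : ContinuousOn a (Icc 0 L)) (hpos : ∃ x ∈ Icc 0 L, 0 < a x)
    (hfin : Finite (ConnectedComponents {x : ℝ // x ∈ Ioo (0 : ℝ) L ∧ 0 < a x})) :
    ∃ c > 0, ∀ (q : ℝ) (u u' : ℝ → ℝ), 0 < q → SolvesNeumann L (fun x => a x * u x ^ q) u u' →
      (∀ x ∈ Icc 0 L, 0 ≤ u x) → (∃ x ∈ Icc 0 L, u x ≠ 0) →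
      ∃ x ∈ Icc 0 L, c ≤ u x ^ (1 - q) := by
  obtain ⟨z, hz, haz⟩ := exists_mem_Ioo_pos hL ha hpos
  have : Nonempty (ConnectedComponents {x : ℝ // x ∈ Ioo (0 : ℝ) L ∧ 0 < a x}) :=
    ⟨((⟨z, hz, haz⟩ : {x : ℝ // x ∈ Ioo (0 : ℝ) L ∧ 0 < a x}) : ConnectedComponents _)⟩
  choose p hp using ConnectedComponents.surjective_coe
    (α := {x : ℝ // x ∈ Ioo (0 : ℝ) L ∧ 0 < a x})
  choose ε hε hεsub hεa using fun C => exists_Icc_half_le ha (p C).2.1 (p C).2.2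
  set c : ConnectedComponents {x : ℝ // x ∈ Ioo (0 : ℝ) L ∧ 0 < a x} → ℝ := fun C =>
    a (p C) / 2 / (π / (p C + ε C - (p C - ε C))) ^ 2 with hc
  have hc0 : ∀ C, 0 < c C := fun C => by
    have h1 := (p C).2.2
    have h2 : 0 < (p C : ℝ) + ε C - (p C - ε C) := by linarith [hε C]
    have := Real.pi_pos
    simp only [hc]
    positivity
  obtain ⟨C₀, hC₀⟩ := Finite.exists_min c
  refine ⟨c C₀, hc0 C₀, fun q u u' hq h hu hne => ?_⟩
  obtain ⟨x, hx, hux, hax⟩ := h.exists_pos_pos hu hq hne ⟨z, hz, haz⟩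
  set X : {x : ℝ // x ∈ Ioo (0 : ℝ) L ∧ 0 < a x} := ⟨x, hx, hax⟩
  set C : ConnectedComponents {x : ℝ // x ∈ Ioo (0 : ℝ) L ∧ 0 < a x} :=
    ConnectedComponents.mk X
  have hpC : p C ∈ connectedComponent X := ConnectedComponents.coe_eq_coe'.1 (hp C)
  have hS : IsPreconnected (Subtype.val '' connectedComponent X) :=
    isPreconnected_connectedComponent.image _ continuous_subtype_val.continuousOn
  have hI : uIcc (p C : ℝ) x ⊆ Subtype.val '' connectedComponent X :=
    hS.ordConnected.uIcc_subset ⟨_, hpC, rfl⟩ ⟨X, mem_connectedComponent, rfl⟩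
  have hg : ∀ t ∈ Icc 0 L, 0 ≤ a t → 0 ≤ a t * u t ^ q := fun t ht hat =>
    mul_nonneg hat (Real.rpow_nonneg (hu t ht) q)
  have hup : 0 < u (p C) := h.pos_of_pos hu (Ioo_subset_Icc_self hx)
    (Ioo_subset_Icc_self (p C).2.1) hux fun t ht => by
      obtain ⟨y, -, rfl⟩ := hI ht
      exact hg y (Ioo_subset_Icc_self y.2.1) y.2.2.le
  have hJsub : Icc (p C - ε C) (p C + ε C) ⊆ Icc 0 L := (hεsub C).trans Ioo_subset_Icc_self
  have hεC := hε C
  obtain ⟨y, hy, hcy⟩ := h.exists_le_rpow_of_pos_on (by linarith) hJsub (hεa C) fun t ht => by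
    refine h.pos_of_pos hu (Ioo_subset_Icc_self (p C).2.1) (hJsub ht) hup fun s hs => ?_
    have hsJ : s ∈ Icc (p C - ε C) (p C + ε C) :=
      ordConnected_Icc.uIcc_subset ht ⟨by linarith, by linarith⟩ hs
    exact hg s (hJsub hsJ) ((half_pos (p C).2.2).le.trans (hεa C s hsJ))
  exact ⟨y, hJsub hy, (hC₀ C).trans hcy⟩

/-- Grönwall-type bound in both directions on an interval. -/
theorem le_mul_exp_of_abs_deriv_le {L k x y : ℝ} {E E' : ℝ → ℝ} (hk : 0 ≤ k)
    (h : ∀ t ∈ Icc 0 L, HasDerivWithinAt E (E' t) (Icc 0 L) t)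
    (hE : ∀ t ∈ Icc 0 L, |E' t| ≤ k * E t) (hx : x ∈ Icc 0 L) (hy : y ∈ Icc 0 L)
    (hE0 : 0 ≤ E x) : E y ≤ E x * exp (k * L) := by
  have hder : ∀ m : ℝ, ∀ t ∈ Icc 0 L, HasDerivWithinAt (fun t => E t * exp (m * (t - x)))
      (E' t * exp (m * (t - x)) + E t * (exp (m * (t - x)) * m)) (Icc 0 L) t := fun m t ht => by
    have h1 : HasDerivAt (fun t => m * (t - x)) m t := by
      simpa using ((hasDerivAt_id t).sub_const x).const_mul m
    exact (h t ht).mul h1.exp.hasDerivWithinAt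
  have key : ∀ m : ℝ, |m| = k → E y * exp (m * (y - x)) ≤ E x → E y ≤ E x * exp (k * L) := by
    intro m hm hle
    have h1 : E y = E y * exp (m * (y - x)) * exp (-(m * (y - x))) := by
      rw [mul_assoc, ← Real.exp_add]; simp
    have hxy : |y - x| ≤ L := abs_le.2 ⟨by linarith [hx.2, hy.1], by linarith [hx.1, hy.2]⟩
    have h2 : -(m * (y - x)) ≤ k * L := by
      refine (neg_le_abs _).trans ?_
      rw [abs_mul, hm]
      exact mul_le_mul_of_nonneg_left hxy hk
    rw [h1]
    exact mul_le_mul hle (Real.exp_le_exp.2 h2) (Real.exp_nonneg _) hE0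
  rcases le_total x y with hxy | hxy
  · refine key (-k) (by rw [abs_neg, abs_of_nonneg hk]) ?_
    have hsub : Icc x y ⊆ Icc 0 L := Icc_subset_Icc hx.1 hy.2
    have := antitoneOn_Icc_of_deriv_nonpos hsub (hder (-k)) (fun t ht => by
      have := (abs_le.1 (hE t (hsub (Ioo_subset_Icc_self ht)))).2
      nlinarith [Real.exp_pos (-k * (t - x))]) (left_mem_Icc.2 hxy) (right_mem_Icc.2 hxy) hxy
    simpa using this
  · refine key k (abs_of_nonneg hk) ?_
    have hsub : Icc y x ⊆ Icc 0 L := Icc_subset_Icc hy.1 hx.2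
    have := monotoneOn_Icc_of_deriv_nonneg hsub (hder k) (fun t ht => by
      have := (abs_le.1 (hE t (hsub (Ioo_subset_Icc_self ht)))).1
      nlinarith [Real.exp_pos (k * (t - x))]) (left_mem_Icc.2 hxy) (right_mem_Icc.2 hxy) hxy
    simpa using this

/-- A solution with a zero stays small if the right-hand side grows at most affinely. -/
theorem SolvesNeumann.add_le_mul_exp {L κ ρ x y : ℝ} {g u u' : ℝ → ℝ}
    (h : SolvesNeumann L g u u') (hu : ∀ x ∈ Icc 0 L, 0 ≤ u x) (hκ : 0 ≤ κ) (hρ : 0 ≤ ρ)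
    (hg : ∀ t ∈ Icc 0 L, |g t| ≤ κ * (u t + ρ)) (hx : x ∈ Icc 0 L) (hux : u x = 0)
    (hy : y ∈ Icc 0 L) : u y + ρ ≤ ρ * exp ((1 + κ) * L) := by
  have hL : 0 ≤ L := hx.1.trans hx.2
  have h1 := le_mul_exp_of_abs_deriv_le (E := fun t => (u t + ρ) ^ 2 + u' t ^ 2)
    (E' := fun t => 2 * (u t + ρ) * u' t + 2 * u' t * -g t) (k := 1 + κ) (by linarith)
    (fun t ht => by
      simpa using (((h.1 t ht).add_const ρ).fun_pow 2).fun_add ((h.2.1 t ht).fun_pow 2))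
    (fun t ht => by
      have hv : 0 ≤ u t + ρ := add_nonneg (hu t ht) hρ
      calc |2 * (u t + ρ) * u' t + 2 * u' t * -g t|
          ≤ 2 * (u t + ρ) * |u' t| + 2 * |u' t| * |g t| := by
            refine (abs_add_le _ _).trans_eq ?_
            simp [abs_mul, abs_of_nonneg hv]
        _ ≤ 2 * (u t + ρ) * |u' t| + 2 * |u' t| * (κ * (u t + ρ)) := by
            gcongr
            exact hg t ht
        _ = (1 + κ) * (2 * (u t + ρ) * |u' t|) := by ring
        _ ≤ (1 + κ) * ((u t + ρ) ^ 2 + u' t ^ 2) := by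
            refine mul_le_mul_of_nonneg_left ?_ (by linarith)
            rw [← sq_abs (u' t)]
            exact two_mul_le_add_sq _ _) hx hy (by positivity)
  simp only [hux, h.deriv_eq_zero hu hx hux] at h1
  have h2 : 1 ≤ exp ((1 + κ) * L) := Real.one_le_exp (by positivity)
  refine le_of_sq_le_sq ?_ (by positivity)
  nlinarith [sq_nonneg (u' y), mul_nonneg (sq_nonneg ρ) (sub_nonneg.2 h2),
    mul_nonneg (mul_nonneg (sq_nonneg ρ) (sub_nonneg.2 h2)) (Real.exp_nonneg ((1 + κ) * L))]

/-- There is a nontrivial nonnegative solution which vanishes somewhere. -/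
def HasDeadCore (L : ℝ) (a : ℝ → ℝ) (q : ℝ) : Prop :=
  ∃ u u' : ℝ → ℝ, SolvesNeumann L (fun x => a x * u x ^ q) u u' ∧ (∀ x ∈ Icc 0 L, 0 ≤ u x) ∧
    (∃ x ∈ Icc 0 L, u x ≠ 0) ∧ ∃ x ∈ Icc 0 L, u x = 0

/-- The exponents admitting a nontrivial solution with a zero stay away from `1`. -/
theorem HasDeadCore.exists_le_one_sub {L : ℝ} {a : ℝ → ℝ} (hL : 0 < L)
    (ha : ContinuousOn a (Icc 0 L)) (hpos : ∃ x ∈ Icc 0 L, 0 < a x)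
    (hfin : Finite (ConnectedComponents {x : ℝ // x ∈ Ioo (0 : ℝ) L ∧ 0 < a x})) :
    ∃ δ > 0, ∀ q, 0 < q → q < 1 → HasDeadCore L a q → q ≤ 1 - δ := by
  obtain ⟨c, hc, hlow⟩ := exists_le_rpow_of_nontrivial hL ha hpos hfin
  obtain ⟨M, hM⟩ := isCompact_Icc.exists_bound_of_continuousOn ha
  have hM0 : 0 ≤ M := (norm_nonneg _).trans (hM 0 (left_mem_Icc.2 hL.le))
  set κ := M * (2 / c) with hκ
  have hκ0 : 0 ≤ κ := by positivity
  have hK : 0 < (1 + κ) * L := by positivity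
  refine ⟨log 2 / ((1 + κ) * L), div_pos (Real.log_pos one_lt_two) hK, ?_⟩
  rintro q hq hq1 ⟨u, u', h, hu, hne, x, hx, hux⟩
  obtain ⟨y, hy, hcy⟩ := hlow q u u' hq h hu hne
  have hq1' : 0 < 1 - q := by linarith
  set ρ := (c / 2) ^ (1 / (1 - q)) with hρ
  have hρ0 : 0 < ρ := by positivity
  have hρq : ρ ^ (1 - q) = c / 2 := by
    rw [hρ, ← Real.rpow_mul (by positivity), one_div_mul_cancel hq1'.ne', Real.rpow_one]
  have hρq' : ρ ^ (q - 1) = 2 / c := by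
    rw [← neg_sub, Real.rpow_neg hρ0.le, hρq, inv_div]
  have h1 := h.add_le_mul_exp hu hκ0 hρ0.le (fun t ht => by
    have hut := hu t ht
    have hv : 0 < u t + ρ := by linarith
    rw [abs_mul, abs_of_nonneg (Real.rpow_nonneg hut q), hκ, mul_assoc]
    refine mul_le_mul (hM t ht) ?_ (Real.rpow_nonneg hut q) hM0
    calc u t ^ q ≤ (u t + ρ) ^ q := Real.rpow_le_rpow hut (by linarith) hq.le
      _ = (u t + ρ) ^ (q - 1) * (u t + ρ) := by
          rw [Real.rpow_sub_one hv.ne', div_mul_cancel₀ _ hv.ne']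
      _ ≤ ρ ^ (q - 1) * (u t + ρ) := by
          refine mul_le_mul_of_nonneg_right ?_ hv.le
          exact Real.rpow_le_rpow_of_nonpos hρ0 (by linarith) (by linarith)
      _ = 2 / c * (u t + ρ) := by rw [hρq']) hx hux hy
  have h2 : c ≤ c / 2 * exp ((1 + κ) * L * (1 - q)) := by
    calc c ≤ u y ^ (1 - q) := hcy
      _ ≤ (ρ * exp ((1 + κ) * L)) ^ (1 - q) :=
          Real.rpow_le_rpow (hu y hy) (by linarith) hq1'.le
      _ = _ := by rw [Real.mul_rpow hρ0.le (Real.exp_nonneg _), hρq, ← Real.exp_mul]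
  have h3 : 2 ≤ exp ((1 + κ) * L * (1 - q)) := by
    refine le_of_mul_le_mul_left ?_ (half_pos hc)
    linarith
  have h4 : log 2 ≤ (1 + κ) * L * (1 - q) := (Real.log_le_iff_le_exp two_pos).2 h3
  have h5 : log 2 / ((1 + κ) * L) ≤ 1 - q := by
    rw [div_le_iff₀ hK]
    linarith
  linarith

/-- A priori bound for solutions with a zero. -/
theorem SolvesNeumann.le_of_zero {L M q r : ℝ} {a u u' : ℝ → ℝ}
    (h : SolvesNeumann L (fun x => a x * u x ^ q) u u') (hM : ∀ x ∈ Icc 0 L, |a x| ≤ M)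
    (hu : ∀ x ∈ Icc 0 L, 0 ≤ u x) (hq : 0 ≤ q) (hqr : q ≤ r) (hr : r < 1)
    (hzero : ∃ x ∈ Icc 0 L, u x = 0) :
    ∀ x ∈ Icc 0 L, u x ≤ max 1 ((M * L * L) ^ (1 / (1 - r))) := by
  obtain ⟨z, hz, huz⟩ := hzero
  have hL : 0 ≤ L := hz.1.trans hz.2
  have hM0 : 0 ≤ M := (abs_nonneg _).trans (hM z hz)
  obtain ⟨y, hy, hmax⟩ := isCompact_Icc.exists_isMaxOn ⟨z, hz⟩ h.continuousOn
  refine fun x hx => (hmax hx : u x ≤ u y).trans (le_max_iff.2 ?_)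
  rcases le_or_gt (u y) 1 with h1 | h1
  · exact Or.inl h1
  right
  have huy : 0 < u y := by linarith
  have huq : 0 < u y ^ q := Real.rpow_pos_of_pos huy q
  have h2 := h.abs_sub_le (M := M * u y ^ q) (fun t ht => by
    rw [abs_mul, abs_of_nonneg (Real.rpow_nonneg (hu t ht) q)]
    exact mul_le_mul (hM t ht) (Real.rpow_le_rpow (hu t ht) (hmax ht) hq)
      (Real.rpow_nonneg (hu t ht) q) hM0) y hy z hz
  rw [huz, sub_zero, abs_of_pos huy] at h2
  have h3 : |y - z| ≤ L := abs_le.2 ⟨by linarith [hz.2, hy.1], by linarith [hz.1, hy.2]⟩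
  have h4 : u y ≤ M * L * L * u y ^ q := by
    refine h2.trans ((mul_le_mul_of_nonneg_left h3 (by positivity)).trans_eq ?_)
    ring
  have h5 : u y ^ (1 - r) ≤ M * L * L := by
    refine (Real.rpow_le_rpow_of_exponent_le h1.le (by linarith : 1 - r ≤ 1 - q)).trans ?_
    rwa [Real.rpow_sub huy, Real.rpow_one, div_le_iff₀ huq]
  have hr' : 0 < 1 - r := by linarith
  calc u y = (u y ^ (1 - r)) ^ (1 / (1 - r)) := by
        rw [← Real.rpow_mul huy.le, mul_one_div_cancel hr'.ne', Real.rpow_one]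
    _ ≤ _ := Real.rpow_le_rpow (by positivity) h5 (by positivity)

/-- Pointwise convergence of equi-Lipschitz functions is continuous convergence. -/
theorem tendsto_eval_of_lipschitz {L C x : ℝ} {us : ℕ → ℝ → ℝ} {u : ℝ → ℝ} {xs : ℕ → ℝ}
    (hC : ∀ n, ∀ x ∈ Icc 0 L, ∀ y ∈ Icc 0 L, |us n x - us n y| ≤ C * |x - y|)
    (hu : ∀ x ∈ Icc 0 L, Tendsto (fun n => us n x) atTop (𝓝 (u x)))
    (hxs : ∀ n, xs n ∈ Icc 0 L) (hx : x ∈ Icc 0 L) (hlim : Tendsto xs atTop (𝓝 x)) :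
    Tendsto (fun n => us n (xs n)) atTop (𝓝 (u x)) := by
  have h1 : Tendsto (fun n => C * |xs n - x|) atTop (𝓝 0) := by
    simpa using ((hlim.sub_const x).abs).const_mul C
  have h2 : Tendsto (fun n => us n (xs n) - us n x) atTop (𝓝 0) :=
    squeeze_zero_norm (fun n => hC n _ (hxs n) x hx) h1
  simpa using h2.add (hu x hx)

/-- The set of exponents admitting a nontrivial solution with a zero is closed under limits from
below. -/
theorem HasDeadCore.of_tendsto {L s : ℝ} {a : ℝ → ℝ} {qs : ℕ → ℝ} (hL : 0 < L)
    (ha : ContinuousOn a (Icc 0 L)) (hpos : ∃ x ∈ Icc 0 L, 0 < a x)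
    (hfin : Finite (ConnectedComponents {x : ℝ // x ∈ Ioo (0 : ℝ) L ∧ 0 < a x}))
    (hs : s < 1) (hqs : ∀ n, 0 < qs n) (hqs' : ∀ n, qs n ≤ s) (hlim : Tendsto qs atTop (𝓝 s))
    (h : ∀ n, HasDeadCore L a (qs n)) : HasDeadCore L a s := by
  obtain ⟨c, hc, hlow⟩ := exists_le_rpow_of_nontrivial hL ha hpos hfin
  obtain ⟨M, hM⟩ := isCompact_Icc.exists_bound_of_continuousOn ha
  simp only [Real.norm_eq_abs] at hM
  have hM0 : 0 ≤ M := (abs_nonneg _).trans (hM 0 (left_mem_Icc.2 hL.le))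
  have hs0 : 0 < s := (hqs 0).trans_le (hqs' 0)
  choose us us' hsol hu hne xs hxs hux using h
  choose ys hys hcy using fun n => hlow _ _ _ (hqs n) (hsol n) (hu n) (hne n)
  set B := max 1 ((M * L * L) ^ (1 / (1 - s)))
  have hB1 : 1 ≤ B := le_max_left _ _
  have hB : ∀ n, ∀ x ∈ Icc 0 L, us n x ≤ B := fun n =>
    (hsol n).le_of_zero hM (hu n) (hqs n).le (hqs' n) hs ⟨xs n, hxs n, hux n⟩
  have hg : ∀ n, ∀ x ∈ Icc 0 L, |a x * us n x ^ qs n| ≤ M * B := fun n x hx => by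
    rw [abs_mul, abs_of_nonneg (Real.rpow_nonneg (hu n x hx) _)]
    refine mul_le_mul (hM x hx) ?_ (Real.rpow_nonneg (hu n x hx) _) hM0
    calc us n x ^ qs n ≤ B ^ qs n := Real.rpow_le_rpow (hu n x hx) (hB n x hx) (hqs n).le
      _ ≤ B ^ (1 : ℝ) := Real.rpow_le_rpow_of_exponent_le hB1 ((hqs' n).trans hs.le)
      _ = B := Real.rpow_one B
  have hC : ∀ n, ∀ x ∈ Icc 0 L, ∀ y ∈ Icc 0 L, |us n x - us n y| ≤ M * B * L * |x - y| :=
    fun n => (hsol n).abs_sub_le (hg n)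
  obtain ⟨φ, u, hφ, hconv⟩ := exists_subseq_tendsto_of_lipschitz (B := B)
    (fun n x hx => by rw [abs_of_nonneg (hu n x hx)]; exact hB n x hx) hC
  obtain ⟨⟨x, y⟩, ⟨hx, hy⟩, ψ, hψ, hxy⟩ := (isCompact_Icc.prod isCompact_Icc).tendsto_subseq
    (fun n => (⟨hxs (φ n), hys (φ n)⟩ : (xs (φ n), ys (φ n)) ∈ Icc 0 L ×ˢ Icc 0 L))
  have hconv' : ∀ x ∈ Icc 0 L, Tendsto (fun n => us (φ (ψ n)) x) atTop (𝓝 (u x)) :=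
    fun x hx => (hconv x hx).comp hψ.tendsto_atTop
  have hq' : Tendsto (fun n => qs (φ (ψ n))) atTop (𝓝 s) :=
    hlim.comp (hφ.tendsto_atTop.comp hψ.tendsto_atTop)
  have hucont := (continuousOn_of_tendsto_of_lipschitz (fun n => hC (φ (ψ n))) hconv').2
  obtain ⟨u', hu'⟩ := SolvesNeumann.of_tendsto hL (fun n => hsol (φ (ψ n)))
    (fun n => ha.mul ((hsol (φ (ψ n))).continuousOn.rpow_const fun _ _ => Or.inr (hqs _).le))
    (fun n => hg (φ (ψ n))) (ha.mul (hucont.rpow_const fun _ _ => Or.inr hs0.le))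
    (fun x hx => ((hconv' x hx).rpow hq' (Or.inr hs0)).const_mul (a x)) hconv'
  have hlimx := tendsto_eval_of_lipschitz (fun n => hC (φ (ψ n))) hconv'
    (fun n => hxs (φ (ψ n))) hx ((continuous_fst.tendsto _).comp hxy)
  have hlimy := tendsto_eval_of_lipschitz (fun n => hC (φ (ψ n))) hconv'
    (fun n => hys (φ (ψ n))) hy ((continuous_snd.tendsto _).comp hxy)
  refine ⟨u, u', hu', fun t ht => ge_of_tendsto' (hconv' t ht) fun n => hu _ t ht,
    ⟨y, hy, fun huy => ?_⟩, x, hx, ?_⟩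
  · have h1 := ge_of_tendsto' (hlimy.rpow (hq'.const_sub 1) (Or.inr (by linarith)))
      fun n => hcy (φ (ψ n))
    rw [huy, Real.zero_rpow (by linarith)] at h1
    linarith
  · simp only [hux] at hlimx
    exact tendsto_nhds_unique hlimx tendsto_const_nhds

/-- A power `c (u + η)^γ` of a shifted solution, with `γ ≤ 1`, is superharmonic up to the
transformed right-hand side. -/
theorem SolvesNeumann.rpow_add {L c γ η : ℝ} {g u u' : ℝ → ℝ} (h : SolvesNeumann L g u u')
    (hu : ∀ x ∈ Icc 0 L, 0 ≤ u x) (hη : 0 < η) :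
    SolvesNeumann L
      (fun x => c * γ * (u x + η) ^ (γ - 1) * g x -
        c * γ * (γ - 1) * (u x + η) ^ (γ - 1 - 1) * u' x ^ 2)
      (fun x => c * (u x + η) ^ γ) fun x => c * γ * (u x + η) ^ (γ - 1) * u' x := by
  have hy : ∀ x ∈ Icc 0 L, u x + η ≠ 0 := fun x hx => by linarith [hu x hx]
  refine ⟨fun x hx => ?_, fun x hx => ?_, by simp [h.2.2.1], by simp [h.2.2.2]⟩
  · refine ((((h.1 x hx).add_const η).rpow_const (p := γ) (Or.inl (hy x hx))).const_mul
      c).congr_deriv ?_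
    ring
  · refine (((((h.1 x hx).add_const η).rpow_const (p := γ - 1) (Or.inl (hy x hx))).const_mul
      (c * γ)).mul (h.2.1 x hx)).congr_deriv ?_
    ring

theorem exists_pos_le_mul_rpow {A B q : ℝ} (hA : 0 < A) (hB : 0 < B) (hq1 : q < 1) :
    ∃ σ > 0, σ ≤ B ∧ σ ≤ A * σ ^ q := by
  have hq : 0 < 1 - q := by linarith
  have hσ : 0 < min B (A ^ (1 / (1 - q))) := lt_min hB (by positivity)
  refine ⟨_, hσ, min_le_left _ _, ?_⟩
  set σ := min B (A ^ (1 / (1 - q))) with hσdef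
  have h1 : σ ^ (1 - q) ≤ A := by
    refine (Real.rpow_le_rpow hσ.le (min_le_right _ _) hq.le).trans_eq ?_
    rw [← Real.rpow_mul hA.le, one_div_mul_cancel hq.ne', Real.rpow_one]
  rwa [Real.rpow_sub hσ, Real.rpow_one, div_le_iff₀ (Real.rpow_pos_of_pos hσ q)] at h1

/-- The bump `2σ (1 - cos θ)` is a subsolution of the regularized problem where `a ≥ a₀ > 0`. -/
theorem neg_cos_le_regularized {a : ℝ → ℝ} {q e δ ρ x a₀ κ σ θ : ℝ} (hq : 0 < q)
    (he : e ≤ 1 / 2) (hδ : δ ≤ σ) (hσ : 0 < σ) (ha₀ : 0 < a₀) (ha : a₀ ≤ a x)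
    (hσκ : 2 * σ * κ ^ 2 ≤ a₀ / 2 * σ ^ q) :
    -(2 * σ * κ ^ 2 * cos θ) ≤ regularized a q e δ ρ x (2 * σ * (1 - cos θ)) := by
  have hax : 0 < a x := ha₀.trans_le ha
  simp only [regularized]
  rw [max_eq_left hax.le, max_eq_right (by linarith : -a x ≤ 0), zero_mul, sub_zero]
  rcases le_or_gt 0 (cos θ) with h | h
  · have h1 : 0 ≤ a x * ((1 - e) * max (2 * σ * (1 - cos θ) - δ) 0 ^ q) :=
      mul_nonneg hax.le (mul_nonneg (by linarith) (Real.rpow_nonneg (le_max_right _ _) q))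
    have h2 : 0 ≤ 2 * σ * κ ^ 2 * cos θ := by positivity
    linarith
  · have h1 : σ ≤ max (2 * σ * (1 - cos θ) - δ) 0 := le_max_of_le_left (by nlinarith)
    have h2 : σ ^ q ≤ max (2 * σ * (1 - cos θ) - δ) 0 ^ q := Real.rpow_le_rpow hσ.le h1 hq.le
    have h3 : 0 ≤ σ ^ q := by positivity
    calc -(2 * σ * κ ^ 2 * cos θ) = 2 * σ * κ ^ 2 * -cos θ := by ring
      _ ≤ 2 * σ * κ ^ 2 * 1 := by
          refine mul_le_mul_of_nonneg_left ?_ (by positivity)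
          linarith [Real.neg_one_le_cos θ]
      _ ≤ a₀ * (1 / 2 * σ ^ q) := by linarith
      _ ≤ _ := by
          refine mul_le_mul ha (mul_le_mul (by linarith) h2 h3 (by linarith)) (by positivity)
            hax.le

/-- If `p` admits a nontrivial solution with a zero, so does every smaller exponent. -/
theorem HasDeadCore.mono {L p q : ℝ} {a : ℝ → ℝ} (hL : 0 < L) (ha : ContinuousOn a (Icc 0 L))
    (hpos : ∃ x ∈ Icc 0 L, 0 < a x) (hq : 0 < q) (hqp : q < p) (hp1 : p < 1)
    (h : HasDeadCore L a p) : HasDeadCore L a q := by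
  obtain ⟨u, u', hsol, hu, hne, z, hz, huz⟩ := h
  have hp : 0 < p := hq.trans hqp
  have hq1 : q < 1 := hqp.trans hp1
  have hq1' : 0 < 1 - q := by linarith
  obtain ⟨M, hM⟩ := isCompact_Icc.exists_bound_of_continuousOn ha
  obtain ⟨U, hU⟩ := isCompact_Icc.exists_bound_of_continuousOn hsol.continuousOn
  simp only [Real.norm_eq_abs] at hM hU
  have hM0 : 0 ≤ M := (abs_nonneg _).trans (hM z hz)
  set γ := (1 - p) / (1 - q) with hγdef
  have hγ : 0 < γ := div_pos (by linarith) hq1'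
  have hγ1 : γ < 1 := (div_lt_one hq1').2 (by linarith)
  have hγq : γ * q = γ - 1 + p := by
    have : γ * (1 - q) = 1 - p := div_mul_cancel₀ _ hq1'.ne'
    linarith
  set c := γ⁻¹ ^ (1 / (1 - q)) with hcdef
  have hc : 0 < c := by positivity
  have hcγ : c ^ q = c * γ := by
    have h1 : c ^ (1 - q) = γ⁻¹ := by
      rw [hcdef, ← Real.rpow_mul (by positivity), one_div_mul_cancel hq1'.ne', Real.rpow_one]
    rw [Real.rpow_sub hc, Real.rpow_one, div_eq_iff (Real.rpow_pos_of_pos hc q).ne'] at h1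
    calc c ^ q = γ⁻¹ * c ^ q * γ := by field_simp
      _ = c * γ := by rw [← h1]
  obtain ⟨x₁, hx₁, hux₁, hax₁⟩ := hsol.exists_pos_pos hu hp hne (exists_mem_Ioo_pos hL ha hpos)
  obtain ⟨r₁, hr₁, hr₁sub, har₁⟩ := exists_Icc_half_le ha hx₁ hax₁
  obtain ⟨r₂, hr₂, -, hur₂⟩ := exists_Icc_half_le hsol.continuousOn hx₁ hux₁
  set r := min r₁ r₂
  have hr : 0 < r := lt_min hr₁ hr₂
  have hJ₁ : Icc (x₁ - r) (x₁ + r) ⊆ Icc (x₁ - r₁) (x₁ + r₁) :=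
    Icc_subset_Icc (by linarith [min_le_left r₁ r₂]) (by linarith [min_le_left r₁ r₂])
  have hJ₂ : Icc (x₁ - r) (x₁ + r) ⊆ Icc (x₁ - r₂) (x₁ + r₂) :=
    Icc_subset_Icc (by linarith [min_le_right r₁ r₂]) (by linarith [min_le_right r₁ r₂])
  have hJ : Icc (x₁ - r) (x₁ + r) ⊆ Icc 0 L := (hJ₁.trans hr₁sub).trans Ioo_subset_Icc_self
  set κ := π / r with hκdef
  have hκ : 0 < κ := div_pos Real.pi_pos hr
  obtain ⟨σ, hσ, hσm, hσA⟩ := exists_pos_le_mul_rpow (A := a x₁ / 2 / (4 * κ ^ 2))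
    (B := c * (u x₁ / 2) ^ γ / 4) (q := q) (by positivity) (by positivity) hq1
  have hσκ : 2 * σ * κ ^ 2 ≤ a x₁ / 2 / 2 * σ ^ q := by
    rw [div_mul_eq_mul_div, le_div_iff₀ (by positivity)] at hσA
    linarith
  set E := min (1 / 2) ((σ / c) ^ (1 / γ))
  have hE : 0 < E := lt_min (by norm_num) (by positivity)
  set e : ℕ → ℝ := fun n => E * (1 / ((n : ℝ) + 1)) with hedef
  have he : ∀ n, 0 < e n := fun n => by positivity
  have heE : ∀ n, e n ≤ E := fun n => by
    refine mul_le_of_le_one_right hE.le ((div_le_one (by positivity)).2 ?_)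
    linarith [Nat.cast_nonneg (α := ℝ) n]
  have he2 : ∀ n, e n ≤ 1 / 2 := fun n => (heE n).trans (min_le_left _ _)
  have heσ : ∀ n, c * e n ^ γ ≤ σ := fun n => by
    calc c * e n ^ γ ≤ c * ((σ / c) ^ (1 / γ)) ^ γ := by
          refine mul_le_mul_of_nonneg_left ?_ hc.le
          exact Real.rpow_le_rpow (he n).le ((heE n).trans (min_le_right _ _)) hγ.le
      _ = σ := by
          rw [← Real.rpow_mul (by positivity), one_div_mul_cancel hγ.ne', Real.rpow_one]
          field_simp
  have helim : Tendsto e atTop (𝓝 0) := by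
    simpa [hedef] using (tendsto_one_div_add_atTop_nhds_zero_nat (𝕜 := ℝ)).const_mul E
  have hδlim : Tendsto (fun n => c * e n ^ γ) atTop (𝓝 0) := by
    simpa [Real.zero_rpow hγ.ne'] using (helim.rpow_const (Or.inr hγ.le)).const_mul c
  have hρlim : Tendsto (fun n => c * (e n ^ 2) ^ γ) atTop (𝓝 0) := by
    simpa [Real.zero_rpow hγ.ne'] using ((helim.pow 2).rpow_const (Or.inr hγ.le)).const_mul c
  have hρ : ∀ n, 0 < c * (e n ^ 2) ^ γ := fun n => by
    have := he n
    positivity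
  have hθ : ∀ t : ℝ, HasDerivAt (fun t => κ * (t - (x₁ - r))) κ t := fun t => by
    simpa using ((hasDerivAt_id t).sub_const (x₁ - r)).const_mul κ
  have hexists : ∀ n, ∃ v v',
      SolvesNeumann L
        (fun x => regularized a q (e n) (c * e n ^ γ) (c * (e n ^ 2) ^ γ) x (v x)) v v' ∧
      (∀ x ∈ Icc 0 L, 0 ≤ v x ∧ v x ≤ c * (u x + e n ^ 2) ^ γ) ∧
      ∀ t ∈ Icc (x₁ - r) (x₁ + r), 2 * σ * (1 - cos (κ * (t - (x₁ - r)))) ≤ v t := by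
    intro n
    have hen := he n
    have hK : 0 ≤ M * (c * (e n ^ 2) ^ γ) ^ (q - 1) := by
      have := hρ n
      positivity
    refine exists_solution_between hL (k := M * (c * (e n ^ 2) ^ γ) ^ (q - 1) + 1) (by linarith)
      (continuousOn_regularized hq (hρ n) ha) (fun x hx s t hs hst => ?_)
      (fun x _ => regularized_zero hq (by positivity)) (hsol.rpow_add hu (by positivity))
      (fun x hx => ?_) (fun x hx => ?_) (by linarith) hJ
      (ψ' := fun t => 2 * σ * κ * sin (κ * (t - (x₁ - r))))
      (ψ'' := fun t => 2 * σ * κ ^ 2 * cos (κ * (t - (x₁ - r)))) (fun t _ => ?_) (fun t _ => ?_)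
      (fun t ht => ?_) ?_ ?_ (fun t _ => ?_) (fun t ht => ?_)
    · refine regularized_add_mul_mono hq hq1 (by linarith [he2 n]) (hρ n) ?_ hs hst
      have : |a x| * (c * (e n ^ 2) ^ γ) ^ (q - 1) ≤ M * (c * (e n ^ 2) ^ γ) ^ (q - 1) :=
        mul_le_mul_of_nonneg_right (hM x hx) (Real.rpow_nonneg (hρ n).le _)
      nlinarith
    · have h1 := regularized_le_of_rpow (a := a) (x := x) hq hp hp1 hγ hγq hc hcγ hen
        (by linarith [he2 n]) (hu x hx)
      have hy : 0 < u x + e n ^ 2 := by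
        have := hu x hx
        positivity
      have h2 : 0 ≤ c * γ * (1 - γ) * (u x + e n ^ 2) ^ (γ - 1 - 1) * u' x ^ 2 := by
        have : 0 ≤ 1 - γ := by linarith
        positivity
      linarith
    · have := hu x hx
      positivity
    · exact (((hθ t).cos.const_sub 1).const_mul (2 * σ)).hasDerivWithinAt.congr_deriv (by ring)
    · exact ((hθ t).sin.const_mul (2 * σ * κ)).hasDerivWithinAt.congr_deriv (by ring)
    · exact neg_cos_le_regularized hq (he2 n) (heσ n) hσ (half_pos hax₁) (har₁ t (hJ₁ ht)) hσκ
    · simp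
    · have : κ * (x₁ + r - (x₁ - r)) = 2 * π := by
        rw [hκdef]
        field_simp
        ring
      simp only [this, Real.cos_two_pi, sub_self, mul_zero]
    · exact mul_nonneg (by positivity) (sub_nonneg.2 (Real.cos_le_one _))
    · have h1 : (u x₁ / 2) ^ γ ≤ (u t + e n ^ 2) ^ γ :=
        Real.rpow_le_rpow (by positivity) ((hur₂ t (hJ₂ ht)).trans (by simp [sq_nonneg])) hγ.le
      have h2 := mul_le_mul_of_nonneg_left h1 hc.le
      have h3 : 2 * σ * (1 - cos (κ * (t - (x₁ - r)))) ≤ 2 * σ * 2 :=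
        mul_le_mul_of_nonneg_left (by linarith [Real.neg_one_le_cos (κ * (t - (x₁ - r)))])
          (by positivity)
      linarith
  choose vs vs' hvsol hvb hvψ using hexists
  set B := c * (U + 1) ^ γ
  have hvB : ∀ n, ∀ x ∈ Icc 0 L, vs n x ≤ B := fun n x hx => by
    refine (hvb n x hx).2.trans (mul_le_mul_of_nonneg_left ?_ hc.le)
    have h1 : e n ^ 2 ≤ 1 := by nlinarith [he n, he2 n]
    exact Real.rpow_le_rpow (add_nonneg (hu x hx) (sq_nonneg _))
      (add_le_add ((le_abs_self _).trans (hU x hx)) h1) hγ.le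
  have hg : ∀ n, ∀ x ∈ Icc 0 L,
      |regularized a q (e n) (c * e n ^ γ) (c * (e n ^ 2) ^ γ) x (vs n x)| ≤ M * B ^ q := by
    intro n x hx
    have hv := (hvb n x hx).1
    have hen := he n
    refine (abs_regularized_le hq hq1 hen.le (by linarith [he2 n]) (by positivity) hv).trans ?_
    exact mul_le_mul (hM x hx) (Real.rpow_le_rpow hv (hvB n x hx) hq.le)
      (Real.rpow_nonneg hv q) hM0
  have hC : ∀ n, ∀ x ∈ Icc 0 L, ∀ y ∈ Icc 0 L,
      |vs n x - vs n y| ≤ M * B ^ q * L * |x - y| := fun n => (hvsol n).abs_sub_le (hg n)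
  obtain ⟨φ, v, hφ, hconv⟩ := exists_subseq_tendsto_of_lipschitz (B := B)
    (fun n x hx => by rw [abs_of_nonneg (hvb n x hx).1]; exact hvB n x hx) hC
  have hvcont := (continuousOn_of_tendsto_of_lipschitz (fun n => hC (φ n)) hconv).2
  obtain ⟨v', hv'⟩ := SolvesNeumann.of_tendsto hL (fun n => hvsol (φ n))
    (fun n => (continuousOn_regularized hq (hρ (φ n)) ha).comp (f := fun x => (x, vs (φ n) x))
      (continuousOn_id.prodMk (hvsol (φ n)).continuousOn) fun x hx => ⟨hx, mem_univ _⟩)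
    (fun n => hg (φ n)) (ha.mul (hvcont.rpow_const fun _ _ => Or.inr hq.le))
    (fun x hx => tendsto_regularized hq hq1 (helim.comp hφ.tendsto_atTop)
      (hδlim.comp hφ.tendsto_atTop) (hρlim.comp hφ.tendsto_atTop)
      (fun n => (hvb (φ n) x hx).1) (hconv x hx)) hconv
  have hv0 : ∀ x ∈ Icc 0 L, 0 ≤ v x := fun x hx =>
    ge_of_tendsto' (hconv x hx) fun n => (hvb (φ n) x hx).1
  refine ⟨v, v', hv', hv0, ⟨x₁, Ioo_subset_Icc_self hx₁, ?_⟩, z, hz, ?_⟩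
  · have h1 := ge_of_tendsto' (hconv x₁ (Ioo_subset_Icc_self hx₁)) fun n =>
      hvψ (φ n) x₁ ⟨by linarith, by linarith⟩
    have h2 : κ * (x₁ - (x₁ - r)) = π := by
      rw [hκdef]
      field_simp
      ring
    rw [h2, Real.cos_pi] at h1
    intro h3
    linarith
  · refine le_antisymm ?_ (hv0 z hz)
    refine le_of_tendsto_of_tendsto' (hconv z hz) (hρlim.comp hφ.tendsto_atTop) fun n => ?_
    simpa [huz] using (hvb (φ n) z hz).2

/-- One-dimensional characterization of the Neumann positivity set: for a sign-changing
continuous weight with `∫₀^L a < 0` whose positivity set in `(0, L)` has finitely many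
connected components, there exists `q_N ∈ [0, 1)` such that, for `q ∈ (0, 1)`, every
nontrivial solution of the Neumann problem is strongly positive iff `q_N < q`. -/
theorem stmt_17 (L : ℝ) (hL : 0 < L)
    (a : ℝ → ℝ) (ha : ContinuousOn a (Set.Icc 0 L)) (hsign : ChangesSign L a)
    (hfin : Finite (ConnectedComponents {x : ℝ // x ∈ Set.Ioo (0 : ℝ) L ∧ 0 < a x}))
    (hA0 : (∫ x in (0 : ℝ)..L, a x) < 0) :
    ∃ qN : ℝ, 0 ≤ qN ∧ qN < 1 ∧
      ∀ q : ℝ, 0 < q → q < 1 →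
        ((∀ u u' u'' : ℝ → ℝ, NeumannSolution L q a u u' u'' →
            (∃ x ∈ Set.Icc (0 : ℝ) L, u x ≠ 0) →
            (∀ x ∈ Set.Icc (0 : ℝ) L, 0 < u x)) ↔ qN < q) := by
  have hpos := hsign.1
  obtain ⟨δ, hδ, hδq⟩ := HasDeadCore.exists_le_one_sub hL ha hpos hfin
  have key : ∀ q : ℝ, 0 < q → ((∀ u u' u'' : ℝ → ℝ, NeumannSolution L q a u u' u'' →
      (∃ x ∈ Set.Icc (0 : ℝ) L, u x ≠ 0) → (∀ x ∈ Set.Icc (0 : ℝ) L, 0 < u x)) ↔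
      ¬ HasDeadCore L a q) := by
    refine fun q hq => ⟨?_, fun h u u' u'' hu hne x hx => ?_⟩
    · rintro h ⟨u, u', hsol, hu, hne, x, hx, hux⟩
      refine (h u u' (fun x => -(a x * u x ^ q)) ⟨hsol.1, hsol.2.1, ?_, hu, hsol.2.2.1, hsol.2.2.2,
        fun x _ => neg_neg _⟩ hne x hx).ne' hux
      exact (ha.mul (hsol.continuousOn.rpow_const fun _ _ => Or.inr hq.le)).neg
    · obtain ⟨h1, h2, -, hu0, h3, h4, h5⟩ := hu
      refine (hu0 x hx).lt_of_ne' fun hux => h ⟨u, u', ⟨h1, fun t ht => ?_, h3, h4⟩, hu0, hne,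
        x, hx, hux⟩
      exact (h2 t ht).congr_deriv (by linarith [h5 t ht])
  set F : Set ℝ := {q | 0 < q ∧ q < 1 ∧ HasDeadCore L a q} with hF
  rcases F.eq_empty_or_nonempty with hempty | hFne
  · refine ⟨0, le_rfl, one_pos, fun q hq hq1 => ?_⟩
    rw [key q hq]
    exact iff_of_true (fun h => (hempty ▸ (⟨hq, hq1, h⟩ : q ∈ F) : q ∈ (∅ : Set ℝ))) hq
  have hbdd : BddAbove F := ⟨1 - δ, fun q hq => hδq q hq.1 hq.2.1 hq.2.2⟩
  have hsup : sSup F ≤ 1 - δ := csSup_le hFne fun q hq => hδq q hq.1 hq.2.1 hq.2.2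
  obtain ⟨qs, -, hqlim, hqF⟩ := exists_seq_tendsto_sSup hFne hbdd
  have hle : ∀ n, qs n ≤ sSup F := fun n => le_csSup hbdd (hqF n)
  have hmem : HasDeadCore L a (sSup F) := HasDeadCore.of_tendsto hL ha hpos hfin (by linarith)
    (fun n => (hqF n).1) hle hqlim fun n => (hqF n).2.2
  refine ⟨sSup F, (hqF 0).1.le.trans (hle 0), by linarith, fun q hq hq1 => ?_⟩
  rw [key q hq]
  refine ⟨fun h => ?_, fun h hdc => not_lt.2 (le_csSup hbdd ⟨hq, hq1, hdc⟩) h⟩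
  by_contra! hqle
  rcases hqle.eq_or_lt with heq | hlt
  · exact h (heq ▸ hmem)
  · exact h (hmem.mono hL ha hpos hq hlt (by linarith))
end
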